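/- arXiv:1801.02957 — 2 statements merged into one kernel-verified Lean document; each statement's English description precedes it below -/
import Mathlib

section
/- Let A, B ∈ ℤ with |A| ≤ B and B ≥ 2, let M be a 2×2 integer matrix with characteristic polynomial x² + A·x + B, let v ∈ ℤ² be such that v and M·v are linearly independent over ℝ, and let T be the associated self-affine tile with digit set D = {0, v, 2v, …, (B−1)v}. If 2|A| ≤ B + 2, then T is homeomorphic to the closed unit disk {p ∈ ℝ² : ‖p‖ ≤ 1}. -/
open Polynomial
open Filter Topology

section Conjugacy

variable {E : Type*} [NormedAddCommGroup E] [NormedSpace ℝ E]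

/-- A compact set that is covered by its images under the contractions `x ↦ Φ (x + d)` lies in
every closed nonempty set that contains its own images. -/
theorem subset_of_contraction {N : Seminorm ℝ E} {c C K : ℝ} (hc : 0 < c)
    (hcN : ∀ x, c * ‖x‖ ≤ N x) (hNC : ∀ x, N x ≤ C * ‖x‖) (hK0 : 0 ≤ K) (hK1 : K < 1)
    {Φ : E → E} (hΦ : ∀ x y, N (Φ x - Φ y) ≤ K * N (x - y)) {D S S' : Set E}
    (hS : IsCompact S) (hS' : IsCompact S') (hne : S'.Nonempty)
    (hsub : ∀ x ∈ S, ∃ y ∈ S, ∃ d ∈ D, x = Φ (y + d))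
    (hsup : ∀ y ∈ S', ∀ d ∈ D, Φ (y + d) ∈ S') : S ⊆ S' := by
  obtain ⟨z, hz⟩ := hne
  obtain ⟨R, hR⟩ := hS.isBounded.exists_norm_le
  obtain ⟨R', hR'⟩ := hS'.isBounded.exists_norm_le
  have hC : 0 ≤ |C| := abs_nonneg C
  have key : ∀ n : ℕ, ∀ x ∈ S, ∃ y ∈ S', N (x - y) ≤ K ^ n * (|C| * (R + R')) := by
    intro n
    induction n with
    | zero =>
      intro x hx
      refine ⟨z, hz, ?_⟩
      have h1 : ‖x - z‖ ≤ R + R' := (norm_sub_le _ _).trans (add_le_add (hR x hx) (hR' z hz))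
      calc N (x - z) ≤ C * ‖x - z‖ := hNC _
        _ ≤ |C| * ‖x - z‖ := by gcongr; exact le_abs_self C
        _ ≤ K ^ 0 * (|C| * (R + R')) := by rw [pow_zero, one_mul]; gcongr
    | succ n ih =>
      intro x hx
      obtain ⟨x', hx', d, hd, rfl⟩ := hsub x hx
      obtain ⟨y, hy, hxy⟩ := ih x' hx'
      refine ⟨Φ (y + d), hsup y hy d hd, ?_⟩
      calc _ ≤ K * N (x' + d - (y + d)) := hΦ _ _
        _ = K * N (x' - y) := by congr 2; abel
        _ ≤ K * (K ^ n * (|C| * (R + R'))) := by gcongr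
        _ = _ := by ring
  intro x hx
  rw [← hS'.isClosed.closure_eq, Metric.mem_closure_iff]
  intro ε hε
  have ht : Tendsto (fun n : ℕ => K ^ n * (|C| * (R + R'))) atTop (𝓝 (0 * (|C| * (R + R')))) :=
    (tendsto_pow_atTop_nhds_zero_of_lt_one hK0 hK1).mul_const _
  rw [zero_mul] at ht
  obtain ⟨n, hn⟩ := (ht.eventually (gt_mem_nhds (mul_pos hc hε))).exists
  obtain ⟨y, hy, hxy⟩ := key n x hx
  refine ⟨y, hy, ?_⟩
  rw [dist_eq_norm]
  have := (hcN (x - y)).trans_lt (hxy.trans_lt hn)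
  exact lt_of_mul_lt_mul_left this hc.le

theorem seminorm_symm_le {N : Seminorm ℝ E} {C K R : ℝ}
    (hNC : ∀ x, N x ≤ C * ‖x‖) (M : E ≃L[ℝ] E)
    {Φ : E → E} (hΦ : ∀ x y, N (Φ x - Φ y) ≤ K * N (x - y))
    (hR : ∀ x, ‖Φ x - M.symm x‖ ≤ R) (x : E) : N (M.symm x) ≤ K * N x := by
  have hR0 : 0 ≤ R := (norm_nonneg _).trans (hR 0)
  have hb : ∀ z, N (Φ z - M.symm z) ≤ |C| * R := fun z =>
    (hNC _).trans (mul_le_mul (le_abs_self C) (hR z) (norm_nonneg _) (abs_nonneg C))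
  have key : ∀ n : ℕ, (n : ℝ) * (N (M.symm x) - K * N x) ≤ 2 * (|C| * R) := by
    intro n
    have e : M.symm ((n : ℝ) • x) = (Φ ((n : ℝ) • x) - Φ 0)
        + (-(Φ ((n : ℝ) • x) - M.symm ((n : ℝ) • x)) + (Φ 0 - M.symm 0)) := by
      rw [map_zero]; abel
    have h1 : N (M.symm ((n : ℝ) • x)) ≤ K * N ((n : ℝ) • x) + (|C| * R + |C| * R) := by
      rw [e]
      refine (map_add_le_add N _ _).trans (add_le_add ?_ ((map_add_le_add N _ _).trans
        (add_le_add ?_ (hb 0))))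
      · simpa using hΦ ((n : ℝ) • x) 0
      · rw [map_neg_eq_map]; exact hb _
    rw [map_smul, map_smul_eq_mul, map_smul_eq_mul] at h1
    simp only [Real.norm_natCast] at h1
    linarith
  by_contra! h
  obtain ⟨n, hn⟩ := exists_nat_gt (2 * (|C| * R) / (N (M.symm x) - K * N x))
  rw [div_lt_iff₀ (by linarith)] at hn
  exact absurd (key n) (by linarith)

/-- If the linear expansion `M` is shadowed by the inverse of a contraction `Φ` that is equivariant
for a lattice `Λ` containing the digits, then the self-affine tile of `M` is homeomorphic to
the attractor of the maps `x ↦ Φ (x + d)`. -/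
theorem nonempty_homeomorph_of_conj [CompleteSpace E] {N : Seminorm ℝ E} {c C K R : ℝ} (hc : 0 < c)
    (hcN : ∀ x, c * ‖x‖ ≤ N x) (hNC : ∀ x, N x ≤ C * ‖x‖) (hK0 : 0 ≤ K) (hK1 : K < 1)
    (M : E ≃L[ℝ] E) {Φ : E → E} (hΦ : ∀ x y, N (Φ x - Φ y) ≤ K * N (x - y))
    (hinj : Function.Injective Φ)
    (hR : ∀ x, ‖Φ x - M.symm x‖ ≤ R) {Λ D : Set E} (hMΛ : ∀ l ∈ Λ, M l ∈ Λ)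
    (hper : ∀ x, ∀ l ∈ Λ, Φ (x + M l) = Φ x + l) (hDΛ : D ⊆ Λ) {Q T : Set E}
    (hQ : IsCompact Q) (hQne : Q.Nonempty) (hT : IsCompact T) (hTne : T.Nonempty)
    (hQsub : ∀ x ∈ Q, ∃ y ∈ Q, ∃ d ∈ D, x = Φ (y + d))
    (hQsup : ∀ y ∈ Q, ∀ d ∈ D, Φ (y + d) ∈ Q)
    (hTsub : ∀ x ∈ T, ∃ y ∈ T, ∃ d ∈ D, M x = y + d)
    (hTsup : ∀ y ∈ T, ∀ d ∈ D, M.symm (y + d) ∈ T) : Nonempty (T ≃ₜ Q) := by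
  have hC : ∀ x, N x ≤ |C| * ‖x‖ := fun x =>
    (hNC x).trans (mul_le_mul_of_nonneg_right (le_abs_self C) (norm_nonneg x))
  have hR0 : 0 ≤ R := (norm_nonneg _).trans (hR 0)
  have hiter : ∀ (n : ℕ) x y, N (Φ^[n] x - Φ^[n] y) ≤ K ^ n * N (x - y) := by
    intro n
    induction n with
    | zero => intro x y; simp
    | succ n ih =>
      intro x y
      rw [Function.iterate_succ_apply', Function.iterate_succ_apply']
      calc _ ≤ K * N (Φ^[n] x - Φ^[n] y) := hΦ _ _
        _ ≤ K * (K ^ n * N (x - y)) := by gcongr; exact ih x y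
        _ = _ := by ring
  have hnorm : ∀ (n : ℕ) x y, ‖Φ^[n] x - Φ^[n] y‖ ≤ K ^ n * (|C| / c * ‖x - y‖) := by
    intro n x y
    have h1 := (hcN _).trans ((hiter n x y).trans
      (mul_le_mul_of_nonneg_left (hC (x - y)) (pow_nonneg hK0 n)))
    rw [← le_div_iff₀' hc] at h1
    calc _ ≤ _ := h1
      _ = _ := by ring
  have hΦc : Continuous Φ := by
    refine (LipschitzWith.of_dist_le' (K := K * (|C| / c)) ?_).continuous
    intro x y
    have := hnorm 1 x y
    rw [dist_eq_norm, dist_eq_norm, mul_assoc]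
    simpa using this
  set k : ℕ → E → E := fun n x => Φ^[n] (M^[n] x) with hk
  have hMiter : ∀ (n : ℕ) x y, M^[n] (x + y) = M^[n] x + M^[n] y := fun n x y => iterate_map_add M n x y
  have hstep : ∀ n x, dist (k n x) (k (n + 1) x) ≤ (|C| / c * R) * K ^ n := by
    intro n x
    have e : k (n + 1) x = Φ^[n] (Φ (M (M^[n] x))) := by
      simp only [hk]
      rw [Function.iterate_succ_apply, Function.iterate_succ_apply']
    rw [e, dist_comm, dist_eq_norm]
    have h2 := hR (M (M^[n] x))
    rw [M.symm_apply_apply] at h2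
    calc _ ≤ K ^ n * (|C| / c * ‖Φ (M (M^[n] x)) - M^[n] x‖) := hnorm n _ _
      _ ≤ K ^ n * (|C| / c * R) := by gcongr
      _ = _ := by ring
  have hcau : ∀ x, CauchySeq fun n => k n x := fun x =>
    cauchySeq_of_le_geometric K _ hK1 (fun n => hstep n x)
  choose κ hκ using fun x => cauchySeq_tendsto_of_complete (hcau x)
  have hdist : ∀ n x, dist (k n x) (κ x) ≤ (|C| / c * R) * K ^ n / (1 - K) := fun n x =>
    dist_le_of_le_geometric_of_tendsto K _ hK1 (fun n => hstep n x) (hκ x) n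
  have hunif : TendstoUniformly k κ atTop := by
    rw [Metric.tendstoUniformly_iff]
    intro ε hε
    have ht : Tendsto (fun n : ℕ => (|C| / c * R) * K ^ n / (1 - K)) atTop
        (𝓝 ((|C| / c * R) * 0 / (1 - K))) :=
      ((tendsto_pow_atTop_nhds_zero_of_lt_one hK0 hK1).const_mul _).div_const _
    rw [mul_zero, zero_div] at ht
    filter_upwards [ht.eventually (gt_mem_nhds hε)] with n hn x
    rw [dist_comm]
    exact (hdist n x).trans_lt hn
  have hkc : ∀ n, Continuous (k n) := fun n =>
    (hΦc.iterate n).comp (M.continuous.iterate n)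
  have hκc : Continuous κ := hunif.continuous (Frequently.of_forall hkc)
  have hfun : ∀ x, κ x = Φ (κ (M x)) := by
    intro x
    refine tendsto_nhds_unique ((tendsto_add_atTop_iff_nat 1).2 (hκ x)) ?_
    have := (hΦc.tendsto _).comp (hκ (M x))
    refine this.congr fun n => ?_
    simp only [hk, Function.comp]
    rw [Function.iterate_succ_apply' Φ, Function.iterate_succ_apply M]
  have hadd : ∀ x, ∀ l ∈ Λ, κ (x + l) = κ x + l := by
    intro x l hl
    refine tendsto_nhds_unique (hκ (x + l)) (((hκ x).add_const l).congr fun n => ?_)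
    have h1 : ∀ (n : ℕ), ∀ l ∈ Λ, ∀ y, Φ^[n] (y + M^[n] l) = Φ^[n] y + l := by
      intro n
      induction n with
      | zero => intro l _ y; simp
      | succ n ih =>
        intro l hl y
        rw [Function.iterate_succ_apply', Function.iterate_succ_apply M, ih _ (hMΛ l hl),
          hper _ l hl, Function.iterate_succ_apply']
    simp only [hk]
    rw [hMiter, h1 n l hl]
  have hκinj : Function.Injective κ := by
    intro x y hxy
    have h1 : ∀ n : ℕ, κ (M^[n] x) = κ (M^[n] y) := by
      intro n
      induction n with
      | zero => simpa using hxy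
      | succ n ih =>
        rw [hfun, hfun (M^[n] y)] at ih
        rw [Function.iterate_succ_apply', Function.iterate_succ_apply']
        exact hinj ih
    have h2 : ∀ (n : ℕ) z, N z ≤ K ^ n * N (M^[n] z) := by
      intro n
      induction n with
      | zero => intro z; simp
      | succ n ih =>
        intro z
        have := seminorm_symm_le hNC M hΦ hR (M (M^[n] z))
        rw [M.symm_apply_apply] at this
        rw [Function.iterate_succ_apply']
        calc _ ≤ _ := ih z
          _ ≤ K ^ n * (K * N (M (M^[n] z))) := by gcongr
          _ = _ := by ring
    set R' := (|C| / c * R) * K ^ 0 / (1 - K) with hR'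
    have h3 : ∀ n : ℕ, N (x - y) ≤ K ^ n * (|C| * (R' + R')) := by
      intro n
      have e : M^[n] (x - y) = M^[n] x - M^[n] y := iterate_map_sub M n x y
      have h4 : ‖M^[n] x - M^[n] y‖ ≤ R' + R' := by
        rw [← dist_eq_norm]
        refine (dist_triangle _ (κ (M^[n] x)) _).trans (add_le_add (hdist 0 _) ?_)
        rw [h1 n, dist_comm]
        exact hdist 0 _
      refine (h2 n _).trans ?_
      rw [e]
      gcongr
      exact (hC _).trans (by gcongr)
    have ht : Tendsto (fun n : ℕ => K ^ n * (|C| * (R' + R'))) atTop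
        (𝓝 (0 * (|C| * (R' + R')))) :=
      (tendsto_pow_atTop_nhds_zero_of_lt_one hK0 hK1).mul_const _
    rw [zero_mul] at ht
    have h5 := (hcN _).trans (ge_of_tendsto' ht h3)
    have h6 : ‖x - y‖ ≤ 0 := by
      by_contra! h
      exact absurd h5 (not_le.2 (mul_pos hc h))
    exact sub_eq_zero.1 (norm_le_zero_iff.1 h6)
  have hS : IsCompact (κ '' T) := hT.image hκc
  have hsub1 : ∀ x ∈ κ '' T, ∃ y ∈ κ '' T, ∃ d ∈ D, x = Φ (y + d) := by
    rintro _ ⟨t, ht, rfl⟩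
    obtain ⟨y, hy, d, hd, e⟩ := hTsub t ht
    exact ⟨κ y, ⟨y, hy, rfl⟩, d, hd, by rw [hfun, e, hadd _ d (hDΛ hd)]⟩
  have hsup1 : ∀ y ∈ κ '' T, ∀ d ∈ D, Φ (y + d) ∈ κ '' T := by
    rintro _ ⟨t, ht, rfl⟩ d hd
    refine ⟨M.symm (t + d), hTsup t ht d hd, ?_⟩
    rw [hfun, M.apply_symm_apply, hadd _ d (hDΛ hd)]
  have himg : κ '' T = Q :=
    Set.Subset.antisymm
      (subset_of_contraction hc hcN hNC hK0 hK1 hΦ hS hQ hQne hsub1 hQsup)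
      (subset_of_contraction hc hcN hNC hK0 hK1 hΦ hQ hS (hTne.image κ) hQsub hsup1)
  have : CompactSpace T := isCompact_iff_compactSpace.1 hT
  let e : T ≃ Q := (Equiv.Set.image κ T hκinj).trans (Equiv.setCongr himg)
  have he : Continuous e := by
    refine Continuous.subtype_mk ?_ _
    exact hκc.comp continuous_subtype_val
  exact ⟨he.homeoOfEquivCompactToT2⟩

end Conjugacy

theorem Convex.nonempty_homeomorph_closedBall {Q : Set (ℝ × ℝ)} (hc : Convex ℝ Q)
    (hQ : IsCompact Q) (hi : (interior Q).Nonempty) :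
    Nonempty (Q ≃ₜ Metric.closedBall (0 : EuclideanSpace ℝ (Fin 2)) 1) := by
  have hfr : Module.finrank ℝ (ℝ × ℝ) = Module.finrank ℝ (EuclideanSpace ℝ (Fin 2)) := by simp
  let e : (ℝ × ℝ) ≃L[ℝ] EuclideanSpace ℝ (Fin 2) := ContinuousLinearEquiv.ofFinrankEq hfr
  have hi' : (interior (e '' Q)).Nonempty := by
    have := e.toHomeomorph.image_interior Q
    rw [show e '' Q = e.toHomeomorph '' Q from rfl, ← this]
    exact hi.image _
  obtain ⟨h, -, h2, -⟩ := exists_homeomorph_image_interior_closure_frontier_eq_unitBall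
    (hc.linear_image (e : (ℝ × ℝ) →ₗ[ℝ] EuclideanSpace ℝ (Fin 2))) hi'
    (hQ.image e.continuous).isBounded
  have h3 : closure (e '' Q) = e '' Q := (hQ.image e.continuous).isClosed.closure_eq
  have h4 : h '' (e '' Q) = Metric.closedBall 0 1 := by
    rw [← h2]; congr 1; exact h3.symm
  exact ⟨((e.toHomeomorph.image Q).trans (h.image _)).trans (Homeomorph.setCongr h4)⟩

theorem plane_nonempty_homeomorph_of_conj {L : (ℝ × ℝ) →ₗ[ℝ] ℂ} (hL : Function.Injective L)
    {K R : ℝ} (hK0 : 0 ≤ K) (hK1 : K < 1)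
    (M : (ℝ × ℝ) ≃L[ℝ] (ℝ × ℝ)) {Φ : ℝ × ℝ → ℝ × ℝ}
    (hΦ : ∀ x y, ‖L (Φ x - Φ y)‖ ^ 2 ≤ K * ‖L (x - y)‖ ^ 2)
    (hinj : Function.Injective Φ)
    (hR : ∀ x, ‖Φ x - M.symm x‖ ≤ R) {Λ D : Set (ℝ × ℝ)} (hMΛ : ∀ l ∈ Λ, M l ∈ Λ)
    (hper : ∀ x, ∀ l ∈ Λ, Φ (x + M l) = Φ x + l) (hDΛ : D ⊆ Λ) {Q T : Set (ℝ × ℝ)}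
    (hQ : IsCompact Q) (hQne : Q.Nonempty) (hT : IsCompact T) (hTne : T.Nonempty)
    (hQsub : ∀ x ∈ Q, ∃ y ∈ Q, ∃ d ∈ D, x = Φ (y + d))
    (hQsup : ∀ y ∈ Q, ∀ d ∈ D, Φ (y + d) ∈ Q)
    (hTsub : ∀ x ∈ T, ∃ y ∈ T, ∃ d ∈ D, M x = y + d)
    (hTsup : ∀ y ∈ T, ∀ d ∈ D, M.symm (y + d) ∈ T) : Nonempty (T ≃ₜ Q) := by
  obtain ⟨c, hc, hcL⟩ := L.exists_antilipschitzWith (LinearMap.ker_eq_bot.2 hL)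
  let L' : (ℝ × ℝ) →L[ℝ] ℂ := L.toContinuousLinearMap
  let N : Seminorm ℝ (ℝ × ℝ) := (normSeminorm ℝ ℂ).comp L
  have hN : ∀ x, N x = ‖L x‖ := fun x => rfl
  have hc' : (0 : ℝ) < c := hc
  refine nonempty_homeomorph_of_conj (N := N) (c := (c : ℝ)⁻¹) (C := ‖L'‖) (K := √K)
    (inv_pos.2 hc') ?_ (fun x => L'.le_opNorm x) (Real.sqrt_nonneg _) ?_ M ?_ hinj hR hMΛ hper hDΛ
    hQ hQne hT hTne hQsub hQsup hTsub hTsup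
  · intro x
    have := hcL.le_mul_dist x 0
    rw [map_zero, dist_zero_right, dist_zero_right] at this
    rw [hN, inv_mul_le_iff₀ hc']
    exact this
  · rw [Real.sqrt_lt' one_pos]; simpa using hK1
  · intro x y
    rw [hN, hN]
    refine le_of_sq_le_sq ?_ (by positivity)
    rw [mul_pow, Real.sq_sqrt hK0]
    exact hΦ x y

/-- An injective contraction that maps the translates of a fundamental domain `Q` by the digits into
`Q` maps them onto `Q`. -/
theorem exists_eq_of_tiling {E : Type*} [NormedAddCommGroup E] {M Φ : E → E} {Λ D Q Q₀ : Set E}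
    (hsurj : Function.Surjective Φ) (hΦ : Continuous Φ) (hQ : IsCompact Q) (hD : D.Finite)
    (hper : ∀ x, ∀ l ∈ Λ, Φ (x + M l) = Φ x + l)
    (hres : ∀ l ∈ Λ, ∃ d ∈ D, ∃ m ∈ Λ, l = d + M m)
    (hcover : ∀ x, ∃ y ∈ Q, ∃ l ∈ Λ, x = y + l)
    (hQsup : ∀ y ∈ Q, ∀ d ∈ D, Φ (y + d) ∈ Q)
    (hQ₀ : ∀ x ∈ Q, ∀ l ∈ Λ, x + l ∈ Q₀ → l = 0) (hcl : Q ⊆ closure Q₀) :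
    ∀ x ∈ Q, ∃ y ∈ Q, ∃ d ∈ D, x = Φ (y + d) := by
  have hS : IsClosed (⋃ d ∈ D, (fun y => Φ (y + d)) '' Q) :=
    hD.isClosed_biUnion fun d _ =>
      (hQ.image (hΦ.comp (continuous_id.add continuous_const))).isClosed
  have hsub : Q₀ ⊆ ⋃ d ∈ D, (fun y => Φ (y + d)) '' Q := by
    intro w hw
    obtain ⟨z, rfl⟩ := hsurj w
    obtain ⟨y, hy, l, hl, rfl⟩ := hcover z
    obtain ⟨d, hd, m, hm, rfl⟩ := hres l hl
    rw [← add_assoc, hper _ m hm] at hw ⊢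
    have := hQ₀ _ (hQsup y hy d hd) m hm hw
    rw [this, add_zero]
    exact Set.mem_biUnion hd ⟨y, hy, rfl⟩
  intro x hx
  have := hS.closure_subset_iff.2 hsub (hcl hx)
  simp only [Set.mem_iUnion] at this
  obtain ⟨d, hd, y, hy, h⟩ := this
  exact ⟨y, hy, d, hd, h.symm⟩

section Contraction

/-- A positive definite binary quadratic form dominates a multiple of any other form. -/
theorem exists_pos_mul_le_form {α β γ : ℝ} (hα : 0 < α) (h : β ^ 2 < 4 * α * γ)
    (α' β' γ' : ℝ) : ∃ μ, 0 < μ ∧ ∀ x y : ℝ,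
      μ * (α' * x ^ 2 + β' * x * y + γ' * y ^ 2) ≤ α * x ^ 2 + β * x * y + γ * y ^ 2 := by
  have hγ : 0 < γ := by
    by_contra! h0
    nlinarith [sq_nonneg β, mul_nonneg hα.le (neg_nonneg.2 h0)]
  set κ := (4 * α * γ - β ^ 2) / (4 * (α + γ)) with hκ
  have hκ0 : 0 < κ := div_pos (by linarith) (by linarith)
  have hκe : κ * (4 * (α + γ)) = 4 * α * γ - β ^ 2 := div_mul_cancel₀ _ (by positivity)
  have h1 : ∀ x y : ℝ, κ * (x ^ 2 + y ^ 2) ≤ α * x ^ 2 + β * x * y + γ * y ^ 2 := by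
    intro x y
    have e : 4 * (α + γ) * (α * x ^ 2 + β * x * y + γ * y ^ 2 - κ * (x ^ 2 + y ^ 2))
        = (2 * α * x + β * y) ^ 2 + (β * x + 2 * γ * y) ^ 2 := by
      linear_combination -(x ^ 2 + y ^ 2) * hκe
    have : 0 ≤ α * x ^ 2 + β * x * y + γ * y ^ 2 - κ * (x ^ 2 + y ^ 2) := by
      by_contra! h0
      have := mul_neg_of_pos_of_neg (show 0 < 4 * (α + γ) by linarith) h0
      nlinarith [sq_nonneg (2 * α * x + β * y), sq_nonneg (β * x + 2 * γ * y)]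
    linarith
  set C := |α'| + |β'| + |γ'| + 1 with hC
  have hC0 : 0 < C := by positivity
  have h2 : ∀ x y : ℝ, α' * x ^ 2 + β' * x * y + γ' * y ^ 2 ≤ C * (x ^ 2 + y ^ 2) := by
    intro x y
    have a1 : α' * x ^ 2 ≤ |α'| * x ^ 2 := by gcongr; exact le_abs_self _
    have a3 : γ' * y ^ 2 ≤ |γ'| * y ^ 2 := by gcongr; exact le_abs_self _
    have a2 : β' * x * y ≤ |β'| * (x ^ 2 + y ^ 2) := by
      calc β' * x * y ≤ |β' * x * y| := le_abs_self _
        _ = |β'| * (|x| * |y|) := by rw [abs_mul, abs_mul, mul_assoc]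
        _ ≤ |β'| * (x ^ 2 + y ^ 2) := by
          gcongr
          nlinarith [sq_nonneg (|x| - |y|), sq_abs x, sq_abs y, sq_nonneg x, sq_nonneg y]
    nlinarith [mul_nonneg (abs_nonneg α') (sq_nonneg y), mul_nonneg (abs_nonneg γ') (sq_nonneg x),
      sq_nonneg x, sq_nonneg y]
  refine ⟨κ / C, div_pos hκ0 hC0, fun x y => ?_⟩
  calc _ ≤ κ / C * (C * (x ^ 2 + y ^ 2)) := by gcongr; exact h2 x y
    _ = κ * (x ^ 2 + y ^ 2) := by field_simp
    _ ≤ _ := h1 x y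

/-- The two linear maps that govern the piecewise linear model map contract a common quadratic
form. -/
theorem exists_common_form {D t α g c : ℝ} (hD : 0 < D) (hD1 : D < 1) (ht : t * (1 + D) = α * D)
    (h1 : D * (1 + D) / 2 < 1 - α ^ 2 + 2 * t * α)
    (h2 : (t + D * (1 + D) / 2 * g * c) ^ 2 <
      (1 - D * (1 + D) / 2 * g ^ 2) * (D * (1 + D) / 2 * (1 - c ^ 2)))
    (h3 : 0 < 1 - D * (1 + D) / 2 * g ^ 2) (hα : 0 ≤ α) (hα' : α < 1 + D) :
    ∃ τ ρ l : ℝ, τ ^ 2 < 4 * ρ ∧ l < 1 ∧ 0 ≤ l ∧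
      (∀ x y : ℝ, (α * x - D * y) ^ 2 - τ * (α * x - D * y) * x + ρ * x ^ 2 ≤
        l * (x ^ 2 - τ * x * y + ρ * y ^ 2)) ∧
      ∀ x y : ℝ, ρ * (g * x + c * y) ^ 2 ≤ l * (x ^ 2 - τ * x * y + ρ * y ^ 2) := by
  set ρ := D * (1 + D) / 2 with hρ
  have hρD : D ^ 2 < ρ := by rw [hρ]; nlinarith
  have ht0 : 0 ≤ t := by
    by_contra! h
    nlinarith [mul_nonneg hα hD.le]
  have htD : t < D := by
    by_contra! h
    nlinarith
  have hV : (2 * t) ^ 2 < 4 * ρ := by nlinarith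
  obtain ⟨μ₁, hμ₁, H1⟩ := exists_pos_mul_le_form (α := 1 - α ^ 2 + 2 * t * α - ρ) (β := 0)
    (γ := ρ - D ^ 2) (by linarith) (by nlinarith [mul_pos (sub_pos.2 h1) (sub_pos.2 hρD)])
    1 (-(2 * t)) ρ
  obtain ⟨μ₂, hμ₂, H2⟩ := exists_pos_mul_le_form (α := 1 - ρ * g ^ 2)
    (β := -(2 * t) - 2 * ρ * g * c) (γ := ρ * (1 - c ^ 2)) h3 (by nlinarith) 1 (-(2 * t)) ρ
  have hVn : ∀ x y : ℝ, 0 ≤ x ^ 2 - 2 * t * x * y + ρ * y ^ 2 := by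
    intro x y
    nlinarith [sq_nonneg (x - t * y), mul_nonneg (sub_nonneg.2 hV.le) (sq_nonneg y)]
  refine ⟨2 * t, ρ, max 0 (1 - min μ₁ μ₂), hV, ?_, le_max_left _ _, ?_, ?_⟩
  · have := lt_min hμ₁ hμ₂
    exact max_lt one_pos (by linarith)
  · intro x y
    have := H1 x y
    have h5 : (1 - μ₁) * (x ^ 2 - 2 * t * x * y + ρ * y ^ 2) ≤
        max 0 (1 - min μ₁ μ₂) * (x ^ 2 - 2 * t * x * y + ρ * y ^ 2) := by
      refine mul_le_mul_of_nonneg_right (le_max_of_le_right ?_) (hVn x y)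
      have := min_le_left μ₁ μ₂
      linarith
    refine le_trans ?_ h5
    linear_combination this + 2 * x * y * ht
  · intro x y
    have := H2 x y
    have h5 : (1 - μ₂) * (x ^ 2 - 2 * t * x * y + ρ * y ^ 2) ≤
        max 0 (1 - min μ₁ μ₂) * (x ^ 2 - 2 * t * x * y + ρ * y ^ 2) := by
      refine mul_le_mul_of_nonneg_right (le_max_of_le_right ?_) (hVn x y)
      have := min_le_right μ₁ μ₂
      linarith
    refine le_trans ?_ h5
    linear_combination this

set_option maxHeartbeats 800000 in
theorem exists_slope_and_form {a b : ℝ} (h : (a = 1 ∧ 2 ≤ b) ∨ (a = 2 ∧ 3 ≤ b) ∨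
    (3 ≤ a ∧ a + 1 ≤ b ∧ 2 * a ≤ b + 2)) :
    ∃ p τ ρ l : ℝ, 0 < p ∧ p < 1 ∧ p < a ∧ τ ^ 2 < 4 * ρ ∧ l < 1 ∧ 0 ≤ l ∧
      (∀ x y : ℝ, ((a - p) / (b - a + p) * x - y / (b - a + p)) ^ 2 -
        τ * ((a - p) / (b - a + p) * x - y / (b - a + p)) * x + ρ * x ^ 2 ≤
        l * (x ^ 2 - τ * x * y + ρ * y ^ 2)) ∧
      ∀ x y : ℝ, ρ * ((1 - p) * x + p / (a - p) * y) ^ 2 ≤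
        l * (x ^ 2 - τ * x * y + ρ * y ^ 2) := by
  have main : ∀ p D t : ℝ, 0 < p → p < 1 → p < a → D * (b - a + p) = 1 → 0 < D → D < 1 →
      t * (1 + D) = (a - p) * D * D → 
      D * (1 + D) / 2 < 1 - ((a - p) * D) ^ 2 + 2 * t * ((a - p) * D) →
      (t + D * (1 + D) / 2 * (1 - p) * (p / (a - p))) ^ 2 <
        (1 - D * (1 + D) / 2 * (1 - p) ^ 2) * (D * (1 + D) / 2 * (1 - (p / (a - p)) ^ 2)) →
      (a - p) * D < 1 + D →
      ∃ p τ ρ l : ℝ, 0 < p ∧ p < 1 ∧ p < a ∧ τ ^ 2 < 4 * ρ ∧ l < 1 ∧ 0 ≤ l ∧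
      (∀ x y : ℝ, ((a - p) / (b - a + p) * x - y / (b - a + p)) ^ 2 -
        τ * ((a - p) / (b - a + p) * x - y / (b - a + p)) * x + ρ * x ^ 2 ≤
        l * (x ^ 2 - τ * x * y + ρ * y ^ 2)) ∧
      ∀ x y : ℝ, ρ * ((1 - p) * x + p / (a - p) * y) ^ 2 ≤
        l * (x ^ 2 - τ * x * y + ρ * y ^ 2) := by
    intro p D t hp hp1 hpa hDe hD hD1 ht h1 h2 hα
    have hne : b - a + p ≠ 0 := by
      intro h0; rw [h0, mul_zero] at hDe; exact zero_ne_one hDe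
    have hDi : D = 1 / (b - a + p) := by rw [eq_div_iff hne]; exact hDe
    have h3 : 0 < 1 - D * (1 + D) / 2 * (1 - p) ^ 2 := by
      have : D * (1 + D) / 2 < 1 := by nlinarith
      have : (1 - p) ^ 2 ≤ 1 := by nlinarith
      nlinarith [mul_nonneg (mul_nonneg hD.le (show 0 ≤ 1 + D by linarith)) (sub_nonneg.2 this)]
    obtain ⟨τ, ρ, l, c1, c2, c3, c4, c5⟩ := exists_common_form hD hD1 ht h1 h2 h3
      (mul_nonneg (by linarith) hD.le) hα
    refine ⟨p, τ, ρ, l, hp, hp1, hpa, c1, c2, c3, fun x y => ?_, c5⟩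
    have := c4 x y
    rw [hDi] at this
    convert this using 3 <;> ring
  have key : ∀ p : ℝ, 0 < b - a + p → ∃ D t : ℝ, 0 < D ∧ D * (b - a + p) = 1 ∧
      t * (1 + D) = (a - p) * D * D := by
    intro p hp
    have hD : 0 < (b - a + p)⁻¹ := inv_pos.2 hp
    exact ⟨(b - a + p)⁻¹, (a - p) * (b - a + p)⁻¹ * (b - a + p)⁻¹ / (1 + (b - a + p)⁻¹), hD,
      inv_mul_cancel₀ hp.ne', div_mul_cancel₀ _ (by positivity)⟩
  rcases h with ⟨rfl, hb⟩ | ⟨rfl, hb⟩ | ⟨ha, hE, hb⟩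
  · obtain ⟨D, t, hD, hDe, ht⟩ := key (1 / 4) (by linarith)
    have hD1 : D ≤ 4 / 5 := by nlinarith
    have ht0 : 0 ≤ t := by
      by_contra! h0; nlinarith [sq_nonneg D]
    have htD : t ≤ D / 3 := by
      by_contra! h0; nlinarith [sq_nonneg D]
    refine main (1 / 4) D t (by norm_num) (by norm_num) (by norm_num) hDe hD (by linarith) ht
      ?_ ?_ ?_
    · nlinarith [mul_nonneg ht0 hD.le]
    · norm_num
      have : (t + D * (1 + D) / 2 * (3 / 4) * (1 / 3)) ^ 2 ≤
          (D / 3 + D * (1 + D) / 2 * (3 / 4) * (1 / 3)) ^ 2 := by gcongr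
      refine this.trans_lt ?_
      have e : 0 < (1 - D * (1 + D) / 2 * (9 / 16)) * ((1 + D) / 2 * (8 / 9)) -
          D * (1 / 3 + (1 + D) / 2 * (3 / 4) * (1 / 3)) ^ 2 := by
        nlinarith [mul_pos hD hD, mul_nonneg hD.le (sub_nonneg.2 hD1),
          mul_nonneg (mul_nonneg hD.le hD.le) (sub_nonneg.2 hD1)]
      nlinarith [mul_pos hD e]
    · nlinarith
  · obtain ⟨D, t, hD, hDe, ht⟩ := key (1 / 2) (by linarith)
    have hD1 : D ≤ 2 / 3 := by nlinarith
    have ht0 : 0 ≤ t := by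
      by_contra! h0; nlinarith [sq_nonneg D]
    have htD : t ≤ 3 * D / 5 := by
      by_contra! h0; nlinarith [sq_nonneg D]
    refine main (1 / 2) D t (by norm_num) (by norm_num) (by norm_num) hDe hD (by linarith) ht
      ?_ ?_ ?_
    · have : 0 < (1 + D) * (1 - ((2 - 1 / 2) * D) ^ 2 - D * (1 + D) / 2) + 2 *
          ((2 - 1 / 2) * D * D) * ((2 - 1 / 2) * D) := by
        nlinarith [mul_pos hD hD, mul_nonneg hD.le (sub_nonneg.2 hD1),
          mul_nonneg (mul_nonneg hD.le hD.le) (sub_nonneg.2 hD1)]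
      rw [← ht] at this
      have e : (1 + D) * (1 - ((2 - 1 / 2) * D) ^ 2 - D * (1 + D) / 2) + 2 *
          (t * (1 + D)) * ((2 - 1 / 2) * D) = (1 + D) * (1 - ((2 - 1 / 2) * D) ^ 2 +
            2 * t * ((2 - 1 / 2) * D) - D * (1 + D) / 2) := by ring
      rw [e] at this
      have := pos_of_mul_pos_right this (by linarith)
      linarith
    · norm_num
      have : (t + D * (1 + D) / 2 * (1 / 2) * (1 / 3)) ^ 2 ≤
          (3 * D / 5 + D * (1 + D) / 2 * (1 / 2) * (1 / 3)) ^ 2 := by gcongr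
      refine this.trans_lt ?_
      have e : 0 < (1 - D * (1 + D) / 2 * (1 / 4)) * ((1 + D) / 2 * (8 / 9)) -
          D * (3 / 5 + (1 + D) / 2 * (1 / 2) * (1 / 3)) ^ 2 := by
        nlinarith [mul_pos hD hD, mul_nonneg hD.le (sub_nonneg.2 hD1),
          mul_nonneg (mul_nonneg hD.le hD.le) (sub_nonneg.2 hD1)]
      nlinarith [mul_pos hD e]
    · nlinarith
  · obtain ⟨D, t, hD, hDe, ht⟩ := key (3 / 4) (by linarith)
    have hD1 : D ≤ 4 / 7 := by nlinarith
    have hα : (a - 3 / 4) * D ≤ 1 + D / 2 := by nlinarith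
    have hα0 : 0 ≤ (a - 3 / 4) * D := mul_nonneg (by linarith) hD.le
    set α := (a - 3 / 4) * D with hαd
    have ht0 : 0 ≤ t := by
      by_contra! h0; nlinarith [mul_nonneg hα0 hD.le]
    have htD : t ≤ D := by
      by_contra! h0; nlinarith [mul_nonneg hα0 hD.le]
    refine main (3 / 4) D t (by norm_num) (by norm_num) (by linarith) hDe hD (by linarith) ht
      ?_ ?_ (by linarith)
    · have : 0 < (1 + D) * (1 - D * (1 + D) / 2) - α ^ 2 * (1 - D) := by
        have h5 : α ^ 2 * (1 - D) ≤ (1 + D / 2) ^ 2 * (1 - D) := by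
          have : 0 ≤ 1 - D := by linarith
          gcongr
        nlinarith [mul_pos hD hD, mul_nonneg hD.le (sub_nonneg.2 hD1),
          mul_nonneg (mul_nonneg hD.le hD.le) (sub_nonneg.2 hD1)]
      have e : (1 + D) * (1 - D * (1 + D) / 2) - α ^ 2 * (1 - D) =
          (1 + D) * (1 - α ^ 2 + 2 * t * α - D * (1 + D) / 2) := by
        linear_combination -2 * α * ht
      rw [e] at this
      have := pos_of_mul_pos_right this (by linarith)
      rw [hαd] at this
      linarith
    · set c := 3 / 4 / (a - 3 / 4) with hc
      have hc0 : 0 ≤ c := div_nonneg (by norm_num) (by linarith)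
      have hc1 : c ≤ 1 / 3 := by
        rw [hc, div_le_iff₀ (by linarith)]; linarith
      norm_num
      have h6 : (t + D * (1 + D) / 2 * (1 / 4) * c) ^ 2 ≤
          (D + D * (1 + D) / 2 * (1 / 4) * (1 / 3)) ^ 2 := by gcongr
      refine h6.trans_lt ?_
      have e : 0 < (1 - D * (1 + D) / 2 * (1 / 16)) * ((1 + D) / 2 * (8 / 9)) -
          D * (1 + (1 + D) / 2 * (1 / 4) * (1 / 3)) ^ 2 := by
        have e1 : 97 / 100 ≤ 1 - D * (1 + D) / 2 * (1 / 16) := by nlinarith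
        have e2 : 97 / 100 * ((1 + D) / 2 * (8 / 9)) ≤
            (1 - D * (1 + D) / 2 * (1 / 16)) * ((1 + D) / 2 * (8 / 9)) := by gcongr
        have e3 : D * (1 + (1 + D) / 2 * (1 / 4) * (1 / 3)) ^ 2 ≤
            D * (1 + (1 + 4 / 7) / 2 * (1 / 4) * (1 / 3)) ^ 2 := by gcongr
        linarith
      have h7 : (1 - D * (1 + D) / 2 * (1 / 16)) * (D * (1 + D) / 2 * (8 / 9)) ≤
          (1 - D * (1 + D) / 2 * (1 / 16)) * (D * (1 + D) / 2 * (1 - c ^ 2)) := by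
        have h8 : 8 / 9 ≤ 1 - c ^ 2 := by nlinarith
        have h9 : 0 ≤ 1 - D * (1 + D) / 2 * (1 / 16) := by nlinarith
        gcongr
      refine lt_of_lt_of_le ?_ h7
      nlinarith [mul_pos hD e]

end Contraction

section CollinearTile

/-- `T` is a nonempty compact solution of `M T = ⋃ (T + (j, 0))`, the union being over
`0 ≤ j < b`, where `M (x, s) = (a x - b s, x)`. -/
structure IsCollinearTile (a b : ℤ) (T : Set (ℝ × ℝ)) : Prop where
  nonempty : T.Nonempty
  isCompact : IsCompact T
  exists_eq_add : ∀ x ∈ T, ∃ y ∈ T, ∃ j : ℤ, 0 ≤ j ∧ j < b ∧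
    ((a : ℝ) * x.1 - b * x.2, x.1) = y + ((j : ℝ), 0)
  exists_preimage : ∀ y ∈ T, ∀ j : ℤ, 0 ≤ j → j < b →
    ∃ x ∈ T, ((a : ℝ) * x.1 - b * x.2, x.1) = y + ((j : ℝ), 0)

/-- The linear automorphism `(x, s) ↦ (a x - b s, x)` of the plane. -/
noncomputable def companionEquiv (a b : ℝ) (hb : b ≠ 0) : (ℝ × ℝ) ≃L[ℝ] (ℝ × ℝ) :=
  LinearEquiv.toContinuousLinearEquiv
    { toFun := fun p => (a * p.1 - b * p.2, p.1)
      invFun := fun p => (p.2, (a * p.2 - p.1) / b)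
      map_add' := fun p r => by ext <;> simp <;> ring
      map_smul' := fun c p => by ext <;> simp <;> ring
      left_inv := fun p => by ext <;> simp <;> field_simp
      right_inv := fun p => by ext <;> simp <;> field_simp; ring }

theorem companionEquiv_apply {a b : ℝ} (hb : b ≠ 0) (p : ℝ × ℝ) :
    companionEquiv a b hb p = (a * p.1 - b * p.2, p.1) := rfl

/-- The integer lattice in the plane. -/
def intLattice : Set (ℝ × ℝ) := {p | ∃ m n : ℤ, p = ((m : ℝ), (n : ℝ))}

/-- The collinear digits `(0, 0), (1, 0), …, (b - 1, 0)`. -/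
def collinearDigits (b : ℤ) : Set (ℝ × ℝ) := {p | ∃ j : ℤ, 0 ≤ j ∧ j < b ∧ p = ((j : ℝ), 0)}

theorem finite_collinearDigits (b : ℤ) : (collinearDigits b).Finite := by
  refine ((Set.finite_Icc (0 : ℤ) b).image fun j : ℤ => ((j : ℝ), (0 : ℝ))).subset ?_
  rintro _ ⟨j, h0, h1, rfl⟩
  exact ⟨j, ⟨h0, h1.le⟩, rfl⟩

theorem collinearDigits_subset_intLattice (b : ℤ) : collinearDigits b ⊆ intLattice := by
  rintro _ ⟨j, -, -, rfl⟩
  exact ⟨j, 0, by simp⟩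

theorem companionEquiv_mem_intLattice {a b : ℤ} (hb : (b : ℝ) ≠ 0) :
    ∀ l ∈ intLattice, companionEquiv a b hb l ∈ intLattice := by
  rintro _ ⟨m, n, rfl⟩
  exact ⟨a * m - b * n, m, by simp [companionEquiv_apply]⟩

theorem exists_eq_digit_add {a b : ℤ} (hb : 0 < b) (hb' : (b : ℝ) ≠ 0) :
    ∀ l ∈ intLattice, ∃ d ∈ collinearDigits b, ∃ m ∈ intLattice,
      l = d + companionEquiv a b hb' m := by
  rintro _ ⟨m, n, rfl⟩
  refine ⟨_, ⟨(m - a * n) % b, Int.emod_nonneg _ hb.ne', Int.emod_lt_of_pos _ hb, rfl⟩, _,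
    ⟨n, -((m - a * n) / b), rfl⟩, ?_⟩
  have := Int.emod_add_mul_ediv (m - a * n) b
  have h : (((m - a * n) % b : ℤ) : ℝ) + b * (((m - a * n) / b : ℤ) : ℝ) = m - a * n := by
    exact_mod_cast this
  rw [companionEquiv_apply]
  ext <;> simp
  linear_combination -h

theorem IsCollinearTile.exists_companionEquiv_eq {a b : ℤ} {T : Set (ℝ × ℝ)}
    (hT : IsCollinearTile a b T) (hb : (b : ℝ) ≠ 0) :
    ∀ x ∈ T, ∃ y ∈ T, ∃ d ∈ collinearDigits b, companionEquiv a b hb x = y + d := by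
  intro x hx
  obtain ⟨y, hy, j, h0, h1, h⟩ := hT.exists_eq_add x hx
  exact ⟨y, hy, _, ⟨j, h0, h1, rfl⟩, h⟩

theorem IsCollinearTile.companionEquiv_symm_mem {a b : ℤ} {T : Set (ℝ × ℝ)}
    (hT : IsCollinearTile a b T) (hb : (b : ℝ) ≠ 0) :
    ∀ y ∈ T, ∀ d ∈ collinearDigits b, (companionEquiv a b hb).symm (y + d) ∈ T := by
  rintro y hy _ ⟨j, h0, h1, rfl⟩
  obtain ⟨x, hx, h⟩ := hT.exists_preimage y hy j h0 h1
  rw [← h, ← companionEquiv_apply hb, ContinuousLinearEquiv.symm_apply_apply]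
  exact hx

/-- The linear map to `ℂ` whose squared norm is the form `x² - τ x y + ρ y²` in the coordinates `x`
and `y = -b (s - q x)`. -/
noncomputable def formMap (τ ρ b q : ℝ) : (ℝ × ℝ) →ₗ[ℝ] ℂ where
  toFun p := ⟨p.1 - τ / 2 * (-b * (p.2 - q * p.1)),
    √(ρ - τ ^ 2 / 4) * (-b * (p.2 - q * p.1))⟩
  map_add' p r := by apply Complex.ext <;> simp <;> ring
  map_smul' c p := by apply Complex.ext <;> simp <;> ring

theorem norm_formMap_sq {τ ρ b q : ℝ} (h : τ ^ 2 < 4 * ρ) (p : ℝ × ℝ) :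
    ‖formMap τ ρ b q p‖ ^ 2 = p.1 ^ 2 - τ * p.1 * (-b * (p.2 - q * p.1)) +
      ρ * (-b * (p.2 - q * p.1)) ^ 2 := by
  rw [← Complex.normSq_eq_norm_sq, Complex.normSq_apply]
  have : √(ρ - τ ^ 2 / 4) * √(ρ - τ ^ 2 / 4) = ρ - τ ^ 2 / 4 :=
    Real.mul_self_sqrt (by linarith)
  simp only [formMap, LinearMap.coe_mk, AddHom.coe_mk]
  linear_combination (-b * (p.2 - q * p.1)) ^ 2 * this

theorem formMap_injective {τ ρ b q : ℝ} (h : τ ^ 2 < 4 * ρ) (hb : b ≠ 0) :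
    Function.Injective (formMap τ ρ b q) := by
  rw [injective_iff_map_eq_zero]
  intro p hp
  have hs : √(ρ - τ ^ 2 / 4) ≠ 0 := (Real.sqrt_pos.2 (by linarith)).ne'
  have h1 := congrArg Complex.re hp
  have h2 := congrArg Complex.im hp
  simp only [formMap, LinearMap.coe_mk, AddHom.coe_mk, Complex.zero_re, Complex.zero_im,
    mul_eq_zero, hs, false_or, neg_eq_zero, hb] at h1 h2
  rw [h2] at h1
  have h3 : p.1 = 0 := by linarith
  rw [h3] at h2
  exact Prod.ext h3 (by simpa using h2)

theorem IsCollinearTile.nonempty_homeomorph_closedBall_of_conj {a b : ℤ} (hb : 0 < b)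
    {T : Set (ℝ × ℝ)} (hT : IsCollinearTile a b T ∨ IsCollinearTile (-a) b T)
    {L : (ℝ × ℝ) →ₗ[ℝ] ℂ} (hL : Function.Injective L) {K R : ℝ}
    (hK0 : 0 ≤ K) (hK1 : K < 1) {Φ : ℝ × ℝ → ℝ × ℝ}
    (hΦ : ∀ x y, ‖L (Φ x - Φ y)‖ ^ 2 ≤ K * ‖L (x - y)‖ ^ 2)
    (hinj : Function.Injective Φ)
    (hR : ∀ x s, ‖Φ (x, s) - (s, (a * s - x) / b)‖ ≤ R)
    (hper : ∀ (x s : ℝ) (m n : ℤ), Φ (x + (a * m - b * n), s + m) = Φ (x, s) + ((m : ℝ), (n : ℝ)))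
    {Q : Set (ℝ × ℝ)} (hQ : IsCompact Q) (hQc : Convex ℝ Q) (hQi : (interior Q).Nonempty)
    {c : ℝ × ℝ} (hsymm : ∀ x ∈ Q, c - x ∈ Q)
    (hQsub : ∀ x ∈ Q, ∃ y ∈ Q, ∃ d ∈ collinearDigits b, x = Φ (y + d))
    (hQsup : ∀ y ∈ Q, ∀ d ∈ collinearDigits b, Φ (y + d) ∈ Q) :
    Nonempty (T ≃ₜ Metric.closedBall (0 : EuclideanSpace ℝ (Fin 2)) 1) := by
  have hb' : (b : ℝ) ≠ 0 := by exact_mod_cast hb.ne'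
  have hper' : ∀ x, ∀ l ∈ intLattice, Φ (x + companionEquiv a b hb' l) = Φ x + l := by
    rintro ⟨x, s⟩ _ ⟨m, n, rfl⟩
    exact hper x s m n
  obtain ⟨e'⟩ := hQc.nonempty_homeomorph_closedBall hQ hQi
  rcases hT with hT | hT
  · obtain ⟨e⟩ := plane_nonempty_homeomorph_of_conj hL hK0 hK1
      (companionEquiv a b hb') hΦ hinj (fun x => hR x.1 x.2) (companionEquiv_mem_intLattice hb')
      hper' (collinearDigits_subset_intLattice b) hQ (hQi.mono interior_subset) hT.isCompact
      hT.nonempty hQsub hQsup (hT.exists_companionEquiv_eq hb') (hT.companionEquiv_symm_mem hb')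
    exact ⟨e.trans e'⟩
  · let M := (companionEquiv a b hb').trans (ContinuousLinearEquiv.neg ℝ)
    have hM : ∀ x, M x = -companionEquiv a b hb' x := fun x => rfl
    have hMs : ∀ x, M.symm x = -(companionEquiv a b hb').symm x := by
      intro x
      rw [ContinuousLinearEquiv.symm_apply_eq, hM, map_neg,
        ContinuousLinearEquiv.apply_symm_apply, neg_neg]
    let σ : (ℝ × ℝ) ≃L[ℝ] (ℝ × ℝ) :=
      ContinuousLinearEquiv.prodCongr (ContinuousLinearEquiv.refl ℝ ℝ) (ContinuousLinearEquiv.neg ℝ)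
    have hσ : ∀ x s, σ (x, s) = (x, -s) := fun x s => rfl
    have hneg : ∀ l ∈ intLattice, -l ∈ intLattice := by
      rintro _ ⟨m, n, rfl⟩
      exact ⟨-m, -n, by simp⟩
    obtain ⟨e⟩ := plane_nonempty_homeomorph_of_conj hL hK0 hK1 M (Φ := fun x => c - Φ x)
      (R := ‖c‖ + R) (Λ := intLattice) (D := collinearDigits b) (Q := Q) (T := σ '' T) (by
        intro x y
        rw [sub_sub_sub_cancel_left, ← neg_sub, map_neg, norm_neg]
        exact hΦ x y) (fun x y h => hinj (sub_right_injective h)) (by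
        intro x
        have : c - Φ x - M.symm x = c - (Φ x - (companionEquiv a b hb').symm x) := by
          rw [hMs]; abel
        rw [this]
        exact (norm_sub_le _ _).trans (add_le_add le_rfl (hR x.1 x.2))) (by
        intro l hl
        exact hneg _ (companionEquiv_mem_intLattice hb' l hl)) (by
        intro x l hl
        rw [hM, ← map_neg, hper' x (-l) (hneg l hl)]
        abel) (collinearDigits_subset_intLattice b) hQ (hQi.mono interior_subset)
      (hT.isCompact.image σ.continuous) (hT.nonempty.image _) (by
        intro x hx
        obtain ⟨y, hy, d, hd, h⟩ := hQsub _ (hsymm x hx)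
        exact ⟨y, hy, d, hd, by rw [← h]; abel⟩) (by
        intro y hy d hd
        exact hsymm _ (hQsup y hy d hd)) (by
        rintro _ ⟨⟨x, s⟩, hx, rfl⟩
        obtain ⟨⟨y, t⟩, hy, j, h0, h1, h⟩ := hT.exists_eq_add _ hx
        refine ⟨_, ⟨_, hy, rfl⟩, _, ⟨j, h0, h1, rfl⟩, ?_⟩
        rw [hM, hσ, hσ, companionEquiv_apply]
        simp only [Prod.mk_add_mk, Prod.mk.injEq, Int.cast_neg, add_zero] at h
        ext
        · simp; linarith [h.1]
        · simp; linarith [h.2]) (by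
        rintro _ ⟨⟨y, t⟩, hy, rfl⟩ _ ⟨j, h0, h1, rfl⟩
        obtain ⟨⟨x, s⟩, hx, h⟩ := hT.exists_preimage _ hy j h0 h1
        refine ⟨(x, s), hx, ?_⟩
        rw [ContinuousLinearEquiv.eq_symm_apply, hM, hσ, hσ, companionEquiv_apply]
        simp only [Prod.mk_add_mk, Prod.mk.injEq, Int.cast_neg, add_zero] at h
        ext
        · simp; linarith [h.1]
        · simp; linarith [h.2])
    exact ⟨((σ.toHomeomorph.image T).trans e).trans e'⟩

/-- A tile is a disk as soon as its expanding map has a nonlinear model with a convex tile. -/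
theorem IsCollinearTile.nonempty_homeomorph_closedBall_of_model {a b : ℤ} (hb : 0 < b)
    {T : Set (ℝ × ℝ)} (hT : IsCollinearTile a b T ∨ IsCollinearTile (-a) b T)
    {τ ρ q K R : ℝ} (hτ : τ ^ 2 < 4 * ρ)
    (hK0 : 0 ≤ K) (hK1 : K < 1) {Φ : ℝ × ℝ → ℝ × ℝ}
    (hΦ : ∀ x y, ‖formMap τ ρ b q (Φ x - Φ y)‖ ^ 2 ≤ K * ‖formMap τ ρ b q (x - y)‖ ^ 2)
    (hcont : Continuous Φ) (hinj : Function.Injective Φ) (hsurj : Function.Surjective Φ)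
    (hR : ∀ x s, ‖Φ (x, s) - (s, (a * s - x) / b)‖ ≤ R)
    (hper : ∀ (x s : ℝ) (m n : ℤ), Φ (x + (a * m - b * n), s + m) = Φ (x, s) + ((m : ℝ), (n : ℝ)))
    {Q Q₀ : Set (ℝ × ℝ)} (hQ : IsCompact Q) (hQc : Convex ℝ Q) (hQi : (interior Q).Nonempty)
    {c : ℝ × ℝ} (hsymm : ∀ x ∈ Q, c - x ∈ Q)
    (hcover : ∀ x s : ℝ, ∃ m n : ℤ, (x + m, s + n) ∈ Q)
    (hQsup : ∀ x s, (x, s) ∈ Q → ∀ j : ℤ, 0 ≤ j → j < b → Φ (x + j, s) ∈ Q)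
    (hQ₀ : ∀ x s, (x, s) ∈ Q → ∀ m n : ℤ, (x + m, s + n) ∈ Q₀ → m = 0 ∧ n = 0)
    (hcl : Q ⊆ closure Q₀) :
    Nonempty (T ≃ₜ Metric.closedBall (0 : EuclideanSpace ℝ (Fin 2)) 1) := by
  have hb' : (b : ℝ) ≠ 0 := by exact_mod_cast hb.ne'
  have hQsup' : ∀ y ∈ Q, ∀ d ∈ collinearDigits b, Φ (y + d) ∈ Q := by
    rintro ⟨x, s⟩ hx _ ⟨j, h0, h1, rfl⟩
    have := hQsup x s hx j h0 h1
    simpa using this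
  have hQsub := exists_eq_of_tiling (M := companionEquiv a b hb') (Λ := intLattice) hsurj hcont hQ
    (finite_collinearDigits b) (by
      rintro ⟨x, s⟩ _ ⟨m, n, rfl⟩
      exact hper x s m n)
    (exists_eq_digit_add hb hb') (by
      rintro ⟨x, s⟩
      obtain ⟨m, n, h⟩ := hcover x s
      exact ⟨_, h, _, ⟨-m, -n, rfl⟩, by simp⟩) hQsup' (by
      rintro ⟨x, s⟩ hx _ ⟨m, n, rfl⟩ h
      obtain ⟨rfl, rfl⟩ := hQ₀ x s hx m n h
      simp) hcl
  exact nonempty_homeomorph_closedBall_of_conj hb hT (formMap_injective hτ hb') hK0 hK1 hΦ hinj hR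
    hper hQ hQc hQi hsymm hQsub hQsup'

end CollinearTile

section Square

theorem int_eq_zero_of_add_mem_Ioo {α x : ℝ} {m : ℤ} (hx : x ∈ Set.Icc α (α + 1))
    (hm : x + m ∈ Set.Ioo α (α + 1)) : m = 0 := by
  have h1 : (m : ℝ) < 1 := by linarith [hx.1, hm.2]
  have h2 : (-1 : ℝ) < m := by linarith [hx.2, hm.1]
  have h1' : m < 1 := by exact_mod_cast h1
  have h2' : -1 < m := by exact_mod_cast h2
  omega

theorem exists_int_add_mem_Icc (α x : ℝ) : ∃ m : ℤ, x + m ∈ Set.Icc α (α + 1) := by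
  refine ⟨-⌊x - α⌋, ?_⟩
  push_cast
  constructor
  · linarith [Int.floor_le (x - α)]
  · linarith [Int.lt_floor_add_one (x - α)]

theorem IsCollinearTile.nonempty_homeomorph_closedBall_of_eq_zero {b : ℤ} (hb : 2 ≤ b)
    {T : Set (ℝ × ℝ)} (hT : IsCollinearTile 0 b T) :
    Nonempty (T ≃ₜ Metric.closedBall (0 : EuclideanSpace ℝ (Fin 2)) 1) := by
  have hb2 : (2 : ℝ) ≤ b := by exact_mod_cast hb
  have hb0 : (0 : ℝ) < b := by linarith
  set α : ℝ := -b / (b + 1) with hα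
  have hα1 : α * (b + 1) = -b := div_mul_cancel₀ _ (by positivity)
  refine IsCollinearTile.nonempty_homeomorph_closedBall_of_model (a := 0) (by omega) (.inl hT)
    (τ := 0) (ρ := 1 / b)
    (q := 0) (K := 1 / b) (R := 0) (Φ := fun p => (p.2, -p.1 / b))
    (Q := Set.Icc α (α + 1) ×ˢ Set.Icc α (α + 1)) (Q₀ := Set.Ioo α (α + 1) ×ˢ Set.Ioo α (α + 1))
    (c := (2 * α + 1, 2 * α + 1))
    ?_ (by positivity) ?_ ?_ (by fun_prop) ?_ ?_ ?_ ?_ (isCompact_Icc.prod isCompact_Icc)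
    ((convex_Icc _ _).prod (convex_Icc _ _)) ?_ ?_ ?_ ?_ ?_ ?_
  · have : 0 < 1 / (b : ℝ) := by positivity
    linarith
  · rw [div_lt_one hb0]; linarith
  · intro x y
    have h : (0 : ℝ) ^ 2 < 4 * (1 / b) := by
      have : 0 < 1 / (b : ℝ) := by positivity
      linarith
    rw [norm_formMap_sq h, norm_formMap_sq h]
    apply le_of_eq
    simp
    field_simp
    ring
  · rintro ⟨x, s⟩ ⟨x', s'⟩ h
    simp only [Prod.mk.injEq] at h
    obtain ⟨h1, h2⟩ := h
    rw [div_left_inj' hb0.ne', neg_inj] at h2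
    rw [h1, h2]
  · rintro ⟨x, s⟩
    exact ⟨(-b * s, x), by ext <;> simp; field_simp⟩
  · intro x s
    simp
  · intro x s m n
    ext <;> simp
    field_simp
    ring
  · rw [interior_prod_eq, interior_Icc]
    exact (Set.nonempty_Ioo.2 (by linarith)).prod (Set.nonempty_Ioo.2 (by linarith))
  · rintro ⟨x, s⟩ ⟨⟨h0, h1⟩, h2, h3⟩
    simp only at h0 h1 h2 h3
    exact ⟨⟨by simp only [Prod.mk_sub_mk]; linarith, by simp only [Prod.mk_sub_mk]; linarith⟩,
      by simp only [Prod.mk_sub_mk]; linarith, by simp only [Prod.mk_sub_mk]; linarith⟩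
  · intro x s
    obtain ⟨m, hm⟩ := exists_int_add_mem_Icc α x
    obtain ⟨n, hn⟩ := exists_int_add_mem_Icc α s
    exact ⟨m, n, hm, hn⟩
  · rintro x s ⟨hx, hs⟩ j h0 h1
    refine ⟨hs, ?_⟩
    have h0' : (0 : ℝ) ≤ j := by exact_mod_cast h0
    have h1' : (j : ℝ) ≤ b - 1 := by exact_mod_cast (by omega : j ≤ b - 1)
    simp only [Set.mem_Icc] at hx ⊢
    rw [le_div_iff₀ hb0, div_le_iff₀ hb0]
    constructor <;> nlinarith
  · rintro x s ⟨hx, hs⟩ m n ⟨hm, hn⟩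
    exact ⟨int_eq_zero_of_add_mem_Ioo hx hm, int_eq_zero_of_add_mem_Ioo hs hn⟩
  · rw [closure_prod_eq, closure_Ioo (by linarith)]

end Square

section Parallelogram

/-- The monotone function of degree one that increases linearly on `[0, q]` and is constant on
`[q, 1]`. -/
noncomputable def riseFirst (q s : ℝ) : ℝ := ⌊s⌋ + min (Int.fract s / q) 1

/-- The monotone function of degree one that is constant on `[0, q]` and increases linearly on
`[q, 1]`. -/
noncomputable def riseLast (q s : ℝ) : ℝ := ⌊s⌋ + max 0 ((Int.fract s - q) / (1 - q))

/-- The distance to the nearest integer. -/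
noncomputable def distInt (x : ℝ) : ℝ := |x - round x|

theorem riseFirst_add_intCast (q s : ℝ) (n : ℤ) : riseFirst q (s + n) = riseFirst q s + n := by
  simp [riseFirst]; ring

theorem riseLast_add_intCast (q s : ℝ) (n : ℤ) : riseLast q (s + n) = riseLast q s + n := by
  simp [riseLast]; ring

theorem distInt_add_intCast (x : ℝ) (n : ℤ) : distInt (x + n) = distInt x := by
  simp [distInt]

theorem distInt_nonneg (x : ℝ) : 0 ≤ distInt x := abs_nonneg _

theorem distInt_le_half (x : ℝ) : distInt x ≤ 1 / 2 := abs_sub_round x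

theorem distInt_le_abs (x : ℝ) : distInt x ≤ |x| := by
  simpa [distInt] using round_le x 0

theorem le_distInt {x δ : ℝ} (h0 : δ ≤ x) (h1 : x ≤ 1 - δ) : δ ≤ distInt x := by
  rw [distInt, le_abs]
  rcases le_or_gt (round x) 0 with h | h
  · have : (round x : ℝ) ≤ 0 := by exact_mod_cast h
    left; linarith
  · have : (1 : ℝ) ≤ round x := by exact_mod_cast h
    right; linarith

theorem abs_distInt_sub_le (x y : ℝ) : |distInt x - distInt y| ≤ |x - y| := by
  have key : ∀ x y, distInt x - distInt y ≤ |x - y| := by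
    intro x y
    have h1 : distInt x ≤ |x - round y| := round_le x _
    have h2 : |x - round y| ≤ |x - y| + |y - round y| := abs_sub_le _ _ _
    rw [distInt] at h1 ⊢
    rw [distInt]
    linarith
  rw [abs_le]
  refine ⟨?_, key x y⟩
  have := key y x
  rw [abs_sub_comm] at this
  linarith

variable {q : ℝ}

theorem riseFirst_riseLast_cases (hq0 : 0 < q) (hq1 : q < 1) (s : ℝ) :
    (0 ≤ Int.fract s ∧ Int.fract s ≤ q ∧ riseFirst q s = ⌊s⌋ + Int.fract s / q ∧
      riseLast q s = ⌊s⌋) ∨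
    (q ≤ Int.fract s ∧ Int.fract s ≤ 1 ∧ riseFirst q s = ⌊s⌋ + 1 ∧
      riseLast q s = ⌊s⌋ + (Int.fract s - q) / (1 - q)) := by
  rcases le_total (Int.fract s) q with h | h
  · left
    refine ⟨Int.fract_nonneg s, h, ?_, ?_⟩
    · rw [riseFirst, min_eq_left]
      rw [div_le_one hq0]; exact h
    · rw [riseLast, max_eq_left, add_zero]
      exact div_nonpos_of_nonpos_of_nonneg (by linarith) (by linarith)
  · right
    refine ⟨h, (Int.fract_lt_one s).le, ?_, ?_⟩
    · rw [riseFirst, min_eq_right]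
      rw [le_div_iff₀ hq0]; linarith
    · rw [riseLast, max_eq_right]
      exact div_nonneg (by linarith) (by linarith)

theorem mul_riseFirst_add_mul_riseLast (hq0 : 0 < q) (hq1 : q < 1) (s : ℝ) :
    q * riseFirst q s + (1 - q) * riseLast q s = s := by
  have h1 : (1 - q) ≠ 0 := by linarith
  have hf := Int.floor_add_fract s
  rcases riseFirst_riseLast_cases hq0 hq1 s with ⟨-, -, h, h'⟩ | ⟨-, -, h, h'⟩
  · rw [h, h']
    field_simp
    linarith
  · rw [h, h']
    field_simp
    linear_combination hf

theorem riseLast_le_riseFirst (hq0 : 0 < q) (hq1 : q < 1) (s : ℝ) :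
    riseLast q s ≤ riseFirst q s := by
  rcases riseFirst_riseLast_cases hq0 hq1 s with ⟨h0, h1, h, h'⟩ | ⟨h0, h1, h, h'⟩
  · rw [h, h']
    have : 0 ≤ Int.fract s / q := by positivity
    linarith
  · rw [h, h']
    have : (Int.fract s - q) / (1 - q) ≤ 1 := by
      rw [div_le_one (by linarith)]; linarith
    linarith

theorem riseFirst_le_riseLast_add_one (hq0 : 0 < q) (hq1 : q < 1) (s : ℝ) :
    riseFirst q s ≤ riseLast q s + 1 := by
  rcases riseFirst_riseLast_cases hq0 hq1 s with ⟨h0, h1, h, h'⟩ | ⟨h0, h1, h, h'⟩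
  · rw [h, h']
    have : Int.fract s / q ≤ 1 := by
      rw [div_le_one hq0]; linarith
    linarith
  · rw [h, h']
    have : 0 ≤ (Int.fract s - q) / (1 - q) := div_nonneg (by linarith) (by linarith)
    linarith

theorem monotone_floor_add {f : ℝ → ℝ} (hf : Monotone f) (h0 : ∀ t, 0 ≤ t → 0 ≤ f t)
    (h1 : ∀ t, t ≤ 1 → f t ≤ 1) : Monotone fun s : ℝ => (⌊s⌋ : ℝ) + f (Int.fract s) := by
  intro s s' h
  rcases (Int.floor_mono h).eq_or_lt with h2 | h2
  · have : Int.fract s ≤ Int.fract s' := by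
      rw [Int.fract, Int.fract, h2]; linarith
    simp only [h2]
    linarith [hf this]
  · have h3 : (⌊s⌋ : ℝ) + 1 ≤ ⌊s'⌋ := by exact_mod_cast h2
    linarith [h0 _ (Int.fract_nonneg s'), h1 _ (Int.fract_lt_one s).le]

theorem riseFirst_monotone (hq0 : 0 < q) : Monotone (riseFirst q) := by
  refine monotone_floor_add (f := fun t => min (t / q) 1) ?_ ?_ ?_
  · intro t t' h
    exact min_le_min_right _ (by gcongr)
  · intro t ht
    exact le_min (by positivity) zero_le_one
  · intro t _
    exact min_le_right _ _

theorem riseLast_monotone (hq1 : q < 1) : Monotone (riseLast q) := by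
  have hq : 0 < 1 - q := by linarith
  refine monotone_floor_add (f := fun t => max 0 ((t - q) / (1 - q))) ?_ ?_ ?_
  · intro t t' h
    exact max_le_max_left _ (by gcongr)
  · intro t _
    exact le_max_left _ _
  · intro t ht
    refine max_le zero_le_one ?_
    rw [div_le_one hq]; linarith

/-- The increments of both functions are complementary shares of the increment of the argument. -/
theorem exists_share (hq0 : 0 < q) (hq1 : q < 1) (s s' : ℝ) : ∃ θ : ℝ, 0 ≤ θ ∧ θ ≤ 1 ∧
    riseFirst q s - riseFirst q s' = θ * ((s - s') / q) ∧
    riseLast q s - riseLast q s' = (1 - θ) * ((s - s') / (1 - q)) := by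
  have hq : 0 < 1 - q := by linarith
  have h1 := mul_riseFirst_add_mul_riseLast hq0 hq1 s
  have h2 := mul_riseFirst_add_mul_riseLast hq0 hq1 s'
  rcases eq_or_ne s s' with rfl | hne
  · exact ⟨0, le_rfl, zero_le_one, by simp, by simp⟩
  have hd : s - s' ≠ 0 := sub_ne_zero.2 hne
  refine ⟨q * (riseFirst q s - riseFirst q s') / (s - s'), ?_, ?_, ?_, ?_⟩
  · rcases lt_or_gt_of_ne hne with h | h
    · have := riseFirst_monotone hq0 h.le
      exact div_nonneg_of_nonpos (mul_nonpos_of_nonneg_of_nonpos hq0.le (by linarith)) (by linarith)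
    · have := riseFirst_monotone hq0 h.le
      exact div_nonneg (mul_nonneg hq0.le (by linarith)) (by linarith)
  · rcases lt_or_gt_of_ne hne with h | h
    · have := riseLast_monotone hq1 h.le
      rw [div_le_one_of_neg (by linarith)]
      nlinarith
    · have := riseLast_monotone hq1 h.le
      rw [div_le_one (by linarith)]
      nlinarith
  · field_simp
  · field_simp
    linear_combination h1 - h2

theorem continuous_of_abs_sub_le {f : ℝ → ℝ} {C : ℝ} (h : ∀ x y, |f x - f y| ≤ C * |x - y|) :
    Continuous f := by
  refine (LipschitzWith.of_dist_le_mul (K := C.toNNReal) fun x y => ?_).continuous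
  rw [Real.dist_eq, Real.dist_eq]
  exact (h x y).trans (mul_le_mul_of_nonneg_right (Real.le_coe_toNNReal C) (abs_nonneg _))

theorem abs_riseFirst_sub_le (hq0 : 0 < q) (hq1 : q < 1) (s s' : ℝ) :
    |riseFirst q s - riseFirst q s'| ≤ 1 / q * |s - s'| := by
  obtain ⟨θ, h0, h1, h, -⟩ := exists_share hq0 hq1 s s'
  rw [h, abs_mul, abs_div, abs_of_pos hq0, abs_of_nonneg h0, div_mul_eq_mul_div, one_mul]
  exact mul_le_of_le_one_left (by positivity) h1

theorem abs_riseLast_sub_le (hq0 : 0 < q) (hq1 : q < 1) (s s' : ℝ) :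
    |riseLast q s - riseLast q s'| ≤ 1 / (1 - q) * |s - s'| := by
  have hq : 0 < 1 - q := by linarith
  obtain ⟨θ, h0, h1, -, h⟩ := exists_share hq0 hq1 s s'
  rw [h, abs_mul, abs_div, abs_of_pos hq, abs_of_nonneg (sub_nonneg.2 h1), div_mul_eq_mul_div,
    one_mul]
  exact mul_le_of_le_one_left (by positivity) (by linarith)

theorem continuous_riseFirst (hq0 : 0 < q) (hq1 : q < 1) : Continuous (riseFirst q) :=
  continuous_of_abs_sub_le (abs_riseFirst_sub_le hq0 hq1)

theorem continuous_riseLast (hq0 : 0 < q) (hq1 : q < 1) : Continuous (riseLast q) :=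
  continuous_of_abs_sub_le (abs_riseLast_sub_le hq0 hq1)

theorem continuous_distInt : Continuous distInt :=
  continuous_of_abs_sub_le (C := 1) fun x y => by rw [one_mul]; exact abs_distInt_sub_le x y

/-- A periodic perturbation term that is nonnegative below the graph of `riseFirst - riseLast`. -/
noncomputable def bump (q x s : ℝ) : ℝ :=
  (riseFirst q s - riseLast q s) / 2 - distInt (x - (riseFirst q s - riseLast q s) / 2)

theorem bump_add_intCast (q x s : ℝ) (m n : ℤ) : bump q (x + m) (s + n) = bump q x s := by
  rw [bump, bump, riseFirst_add_intCast, riseLast_add_intCast, add_sub_add_right_eq_sub,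
    add_sub_right_comm, distInt_add_intCast]

theorem abs_bump_le (hq0 : 0 < q) (hq1 : q < 1) (x s : ℝ) : |bump q x s| ≤ 1 := by
  have h1 := riseLast_le_riseFirst hq0 hq1 s
  have h2 := riseFirst_le_riseLast_add_one hq0 hq1 s
  have h3 := distInt_nonneg (x - (riseFirst q s - riseLast q s) / 2)
  have h4 := distInt_le_half (x - (riseFirst q s - riseLast q s) / 2)
  rw [bump, abs_le]
  constructor <;> linarith

theorem abs_bump_sub_le (q x x' s s' : ℝ) : |bump q x s - bump q x' s'| ≤
    |x - x'| + (|riseFirst q s - riseFirst q s'| + |riseLast q s - riseLast q s'|) := by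
  set A := riseFirst q s - riseFirst q s' with hA
  set B := riseLast q s - riseLast q s' with hB
  have h := abs_distInt_sub_le (x - (riseFirst q s - riseLast q s) / 2)
    (x' - (riseFirst q s' - riseLast q s') / 2)
  rw [show x - (riseFirst q s - riseLast q s) / 2 - (x' - (riseFirst q s' - riseLast q s') / 2) =
    x - x' - (A - B) / 2 by rw [hA, hB]; ring] at h
  have h2 : |x - x' - (A - B) / 2| ≤ |x - x'| + |(A - B) / 2| := abs_sub _ _
  have h3 : |A - B| ≤ |A| + |B| := abs_sub _ _
  rw [abs_div, abs_of_pos (two_pos : (0 : ℝ) < 2)] at h2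
  have h4 : bump q x s - bump q x' s' = (A - B) / 2 -
      (distInt (x - (riseFirst q s - riseLast q s) / 2) -
        distInt (x' - (riseFirst q s' - riseLast q s') / 2)) := by
    rw [bump, bump, hA, hB]; ring
  rw [h4]
  have h5 := abs_sub ((A - B) / 2) (distInt (x - (riseFirst q s - riseLast q s) / 2) -
        distInt (x' - (riseFirst q s' - riseLast q s') / 2))
  rw [abs_div, abs_of_pos (two_pos : (0 : ℝ) < 2)] at h5
  linarith

end Parallelogram

section ParallelogramModel

variable {q p ε a b : ℝ}

/-- The expanding coordinate of the nonlinear model of the inverse of `(x, s) ↦ (a x - b s, x)`. -/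
noncomputable def modelFst (q ε x s : ℝ) : ℝ := riseLast q s + ε * bump q x s

/-- A nonlinear model of the inverse of `(x, s) ↦ (a x - b s, x)`. -/
noncomputable def model (q p ε b : ℝ) (P : ℝ × ℝ) : ℝ × ℝ :=
  (modelFst q ε P.1 P.2,
    (-P.1 + p * riseFirst q P.2 - p) / b + 1 + q * modelFst q ε P.1 P.2)

theorem continuous_model (hq0 : 0 < q) (hq1 : q < 1) : Continuous (model q p ε b) := by
  have h1 := continuous_riseFirst hq0 hq1
  have h2 := continuous_riseLast hq0 hq1
  have h3 := continuous_distInt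
  unfold model modelFst bump
  fun_prop

theorem model_add (hb : b ≠ 0) (hq : q * b = a - p) {a' b' : ℤ} (ha' : a = a') (hb' : b = b')
    (x s : ℝ) (m n : ℤ) : model q p ε b (x + (a * m - b * n), s + m) =
      model q p ε b (x, s) + ((m : ℝ), (n : ℝ)) := by
  have h1 : modelFst q ε (x + (a * m - b * n)) (s + m) = modelFst q ε x s + m := by
    have := bump_add_intCast q x s (a' * m - b' * n) m
    push_cast at this
    rw [modelFst, modelFst, ha', hb', this, riseLast_add_intCast]
    ring
  ext
  · simp [model, h1]
  · simp only [model, h1, riseFirst_add_intCast, Prod.snd_add]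
    field_simp
    linear_combination (m : ℝ) * hq

theorem modelFst_lt (hq0 : 0 < q) (hq1 : q < 1) (hp0 : 0 < p) (hp1 : p < 1) (hε0 : 0 < ε)
    (hε1 : ε < 1) {x x' s s' : ℝ} (hs : s < s')
    (hx : -x + p * riseFirst q s = -x' + p * riseFirst q s') :
    modelFst q ε x s < modelFst q ε x' s' := by
  have hF := riseFirst_monotone hq0 hs.le
  have hL := riseLast_monotone hq1 hs.le
  have e1 := mul_riseFirst_add_mul_riseLast hq0 hq1 s
  have e2 := mul_riseFirst_add_mul_riseLast hq0 hq1 s'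
  have h := abs_distInt_sub_le (x' - (riseFirst q s' - riseLast q s') / 2)
    (x - (riseFirst q s - riseLast q s) / 2)
  obtain ⟨F, hFd⟩ : ∃ F, F = riseFirst q s' - riseFirst q s := ⟨_, rfl⟩
  obtain ⟨Λ, hΛd⟩ : ∃ Λ, Λ = riseLast q s' - riseLast q s := ⟨_, rfl⟩
  have hF0 : 0 ≤ F := by linarith
  have hΛ0 : 0 ≤ Λ := by linarith
  rw [show x' - (riseFirst q s' - riseLast q s') / 2 - (x - (riseFirst q s - riseLast q s) / 2) =
    (p - 1 / 2) * F + Λ / 2 by rw [hFd, hΛd]; linear_combination hx] at h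
  have h5 : |(p - 1 / 2) * F + Λ / 2| ≤ |p - 1 / 2| * F + Λ / 2 := by
    refine (abs_add_le _ _).trans ?_
    rw [abs_mul, abs_of_nonneg hF0, abs_of_nonneg (by linarith : 0 ≤ Λ / 2)]
  have h6 := (abs_le.1 (h.trans h5)).2
  have hc : |p - 1 / 2| < 1 / 2 := by rw [abs_lt]; constructor <;> linarith
  obtain ⟨c, hcd⟩ : ∃ c, c = |p - 1 / 2| := ⟨_, rfl⟩
  rw [← hcd] at h6 hc
  have h7 : (1 / 2 - c) * F - Λ ≤ bump q x' s' - bump q x s := by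
    rw [bump, bump]; linarith
  have h8 : 0 < (1 - ε) * Λ + ε * ((1 / 2 - c) * F) := by
    have hpos : 0 < q * F + (1 - q) * Λ := by rw [hFd, hΛd]; linarith
    rcases hF0.eq_or_lt with h0 | h0
    · have : 0 < Λ := by
        rw [← h0] at hpos
        by_contra! h9
        nlinarith
      rw [← h0]
      have := mul_pos (sub_pos.2 hε1) this
      linarith
    · have := mul_pos hε0 (mul_pos (sub_pos.2 hc) h0)
      have := mul_nonneg (sub_pos.2 hε1).le hΛ0
      linarith
  have h9 := mul_le_mul_of_nonneg_left h7 hε0.le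
  rw [modelFst, modelFst]
  linarith

theorem model_injective (hb : b ≠ 0) (hq0 : 0 < q) (hq1 : q < 1) (hp0 : 0 < p) (hp1 : p < 1)
    (hε0 : 0 < ε) (hε1 : ε < 1) : Function.Injective (model q p ε b) := by
  rintro ⟨x, s⟩ ⟨x', s'⟩ h
  simp only [model, Prod.mk.injEq] at h
  obtain ⟨h1, h2⟩ := h
  rw [h1, add_left_inj, add_left_inj, div_left_inj' hb] at h2
  have h3 : -x + p * riseFirst q s = -x' + p * riseFirst q s' := by linarith
  rcases lt_trichotomy s s' with hs | hs | hs
  · exact absurd h1 (modelFst_lt hq0 hq1 hp0 hp1 hε0 hε1 hs h3).ne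
  · rw [hs] at h3 ⊢
    rw [show x = x' by linarith]
  · exact absurd h1 (modelFst_lt hq0 hq1 hp0 hp1 hε0 hε1 hs h3.symm).ne'

theorem abs_modelFst_sub_le (hq0 : 0 < q) (hq1 : q < 1) (hε0 : 0 < ε) (hε1 : ε < 1) (x s : ℝ) :
    |modelFst q ε x s - s| ≤ 2 := by
  have e1 := mul_riseFirst_add_mul_riseLast hq0 hq1 s
  have h1 := riseLast_le_riseFirst hq0 hq1 s
  have h2 := riseFirst_le_riseLast_add_one hq0 hq1 s
  have h3 := abs_le.1 (abs_bump_le hq0 hq1 x s)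
  rw [modelFst, abs_le]
  constructor <;> nlinarith

theorem model_surjective (hb : b ≠ 0) (hq0 : 0 < q) (hq1 : q < 1)
    (hε0 : 0 < ε) (hε1 : ε < 1) : Function.Surjective (model q p ε b) := by
  rintro ⟨u, w⟩
  set w' := p + b * (w - 1 - q * u) with hw'
  have hcont : Continuous fun s => modelFst q ε (p * riseFirst q s - w') s := by
    have h1 := continuous_riseFirst hq0 hq1
    have h2 := continuous_riseLast hq0 hq1
    have h3 := continuous_distInt
    unfold modelFst bump
    fun_prop
  obtain ⟨s, hs⟩ := mem_range_of_exists_le_of_exists_ge (c := u) hcont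
    ⟨u - 2, by
      have := abs_le.1 (abs_modelFst_sub_le hq0 hq1 hε0 hε1 (p * riseFirst q (u - 2) - w') (u - 2))
      linarith⟩
    ⟨u + 2, by
      have := abs_le.1 (abs_modelFst_sub_le hq0 hq1 hε0 hε1 (p * riseFirst q (u + 2) - w') (u + 2))
      linarith⟩
  refine ⟨(p * riseFirst q s - w', s), ?_⟩
  simp only at hs
  simp only [model, hs, Prod.mk.injEq, true_and]
  rw [hw']
  field_simp
  ring

theorem norm_model_sub_le (hb : 1 ≤ b) (hq : q * b = a - p) (hq0 : 0 < q) (hq1 : q < 1)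
    (hp0 : 0 < p) (hp1 : p < 1) (hε0 : 0 < ε) (hε1 : ε < 1) (x s : ℝ) :
    ‖model q p ε b (x, s) - (s, (a * s - x) / b)‖ ≤ 6 := by
  have h0 := abs_modelFst_sub_le hq0 hq1 hε0 hε1 x s
  rw [norm_prod_le_iff]
  constructor
  · exact h0.trans (by norm_num)
  · have e1 := mul_riseFirst_add_mul_riseLast hq0 hq1 s
    have h1 := riseLast_le_riseFirst hq0 hq1 s
    have h2 := riseFirst_le_riseLast_add_one hq0 hq1 s
    have h3 : |p * (riseFirst q s - s - 1) / b| ≤ 2 := by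
      rw [abs_div, abs_of_pos (by linarith : 0 < b), div_le_iff₀ (by linarith), abs_mul,
        abs_of_pos hp0]
      have : |riseFirst q s - s - 1| ≤ 2 := by
        rw [abs_le]; constructor <;> nlinarith
      nlinarith [abs_nonneg (riseFirst q s - s - 1)]
    have h4 : |q * (modelFst q ε x s - s)| ≤ 2 := by
      rw [abs_mul, abs_of_pos hq0]
      nlinarith [abs_nonneg (modelFst q ε x s - s)]
    have e : (model q p ε b (x, s) - (s, (a * s - x) / b)).2 =
        p * (riseFirst q s - s - 1) / b + 1 + q * (modelFst q ε x s - s) := by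
      simp only [model, Prod.snd_sub]
      have : b ≠ 0 := by linarith
      field_simp
      linear_combination s * hq
    rw [e, Real.norm_eq_abs, abs_le]
    rw [abs_le] at h3 h4
    constructor <;> linarith

/-- The parallelogram with sides `(0, 1)` and `(1, q)`. -/
def parallelogram (q : ℝ) : Set (ℝ × ℝ) :=
  {P | 0 ≤ P.1 ∧ P.1 ≤ 1 ∧ 0 ≤ P.2 - q * P.1 ∧ P.2 - q * P.1 ≤ 1}

theorem riseFirst_mul (hq0 : 0 < q) (hq1 : q < 1) {x : ℝ} (h0 : 0 ≤ x) (h1 : x ≤ 1) :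
    riseFirst q (q * x) = x := by
  have hfl : ⌊q * x⌋ = 0 := by
    rw [Int.floor_eq_zero_iff]
    exact ⟨by positivity, by nlinarith⟩
  rw [riseFirst, Int.fract, hfl]
  simp [mul_div_cancel_left₀ x hq0.ne', h1]

theorem modelFst_mem_Icc (hq0 : 0 < q) (hq1 : q < 1) (hε0 : 0 < ε) (hε1 : ε < 1) {x s : ℝ}
    (h : (x, s) ∈ parallelogram q) : modelFst q ε x s ∈ Set.Icc 0 1 := by
  obtain ⟨hx0, hx1, h0, h1⟩ := h
  simp only at hx0 hx1 h0 h1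
  have hs0 : 0 ≤ s := by nlinarith
  have hs2 : s < 2 := by nlinarith
  have hq : 0 < 1 - q := by linarith
  have hb := abs_le.1 (abs_bump_le hq0 hq1 x s)
  have hfl := Int.floor_add_fract s
  rw [modelFst]
  rcases lt_or_ge s 1 with hs | hs
  · have hf : ⌊s⌋ = 0 := Int.floor_eq_zero_iff.2 ⟨hs0, hs⟩
    have hfs : Int.fract s = s := by rw [Int.fract, hf]; simp
    rcases riseFirst_riseLast_cases hq0 hq1 s with ⟨-, c1, c2, c3⟩ | ⟨c0, c1, c2, c3⟩
    · rw [hf, hfs] at c2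
      rw [hf] at c3
      simp only [Int.cast_zero, zero_add] at c2 c3
      have hxs : x ≤ s / q := by rw [le_div_iff₀ hq0]; linarith
      have hd : 0 ≤ bump q x s := by
        have := distInt_le_abs (x - (riseFirst q s - riseLast q s) / 2)
        have h5 : |x - (riseFirst q s - riseLast q s) / 2| ≤ s / q / 2 := by
          rw [c2, c3, abs_le]; constructor <;> linarith
        rw [bump, c2, c3] at *
        linarith
      rw [c3]
      constructor <;> nlinarith
    · rw [hf] at c2 c3
      simp only [Int.cast_zero, zero_add] at c2 c3
      rw [hfs] at c3
      have hΛ0 : 0 ≤ riseLast q s := by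
        rw [c3]; exact div_nonneg (by linarith) hq.le
      have hΛ1 : riseLast q s ≤ 1 := by
        rw [c3, div_le_one hq]; linarith
      have hd1 := distInt_nonneg (x - (riseFirst q s - riseLast q s) / 2)
      have hd2 := distInt_le_half (x - (riseFirst q s - riseLast q s) / 2)
      have hb1 : bump q x s ≤ (1 - riseLast q s) / 2 := by
        rw [bump, c2] at *; linarith
      have hb2 : - riseLast q s / 2 ≤ bump q x s := by
        rw [bump, c2] at *; linarith
      constructor <;> nlinarith
  · have hf : ⌊s⌋ = 1 := by
      rw [Int.floor_eq_iff]; push_cast; exact ⟨hs, by linarith⟩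
    have hfs : Int.fract s = s - 1 := by rw [Int.fract, hf]; simp
    have hle : Int.fract s ≤ q := by rw [hfs]; nlinarith
    have hF : riseFirst q s = 1 + (s - 1) / q := by
      rw [riseFirst, hf, hfs, min_eq_left, Int.cast_one]
      rw [div_le_one hq0, ← hfs]; exact hle
    have hL : riseLast q s = 1 := by
      rw [riseLast, hf, max_eq_left]
      · simp
      · exact div_nonpos_of_nonpos_of_nonneg (by linarith) hq.le
    have hxs : (s - 1) / q ≤ x := by rw [div_le_iff₀ hq0]; linarith
    have hd : bump q x s ≤ 0 := by
      have := le_distInt (x := x - (riseFirst q s - riseLast q s) / 2) (δ := (s - 1) / q / 2)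
        (by rw [hF, hL]; linarith) (by rw [hF, hL]; linarith)
      rw [bump]
      rw [hF, hL] at *
      linarith
    rw [hL]
    constructor <;> nlinarith

theorem model_mem_parallelogram (hb : 1 < b) (hq0 : 0 < q) (hq1 : q < 1) (hp0 : 0 < p)
    (hp1 : p < 1) (hε0 : 0 < ε) (hε1 : ε < 1) {x s : ℝ} (h : (x, s) ∈ parallelogram q) {j : ℤ}
    (hj0 : 0 ≤ j) (hjb : (j : ℝ) ≤ b - 1) : model q p ε b (x + j, s) ∈ parallelogram q := by
  have h1 := modelFst_mem_Icc hq0 hq1 hε0 hε1 h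
  have h2 : modelFst q ε (x + j) s = modelFst q ε x s := by
    have := bump_add_intCast q x s j 0
    rw [Int.cast_zero, add_zero] at this
    rw [modelFst, modelFst, this]
  obtain ⟨hx0, hx1, c0, c1⟩ := h
  simp only at hx0 hx1 c0 c1
  have hb0 : 0 < b := by linarith
  have h3 : x ≤ riseFirst q s := by
    have := riseFirst_monotone hq0 (show q * x ≤ s by linarith)
    rwa [riseFirst_mul hq0 hq1 hx0 hx1] at this
  have h4 : riseFirst q s ≤ x + 1 := by
    have := riseFirst_monotone hq0 (show s ≤ q * x + (1 : ℤ) by push_cast; linarith)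
    rwa [riseFirst_add_intCast, riseFirst_mul hq0 hq1 hx0 hx1, Int.cast_one] at this
  have hj : (0 : ℝ) ≤ j := by exact_mod_cast hj0
  refine ⟨?_, ?_, ?_, ?_⟩
  · simpa [model, h2] using h1.1
  · simpa [model, h2] using h1.2
  · simp only [model, h2]
    have : -b ≤ -(x + j) + p * riseFirst q s - p := by nlinarith
    have := (le_div_iff₀ hb0).2 (show -1 * b ≤ -(x + j) + p * riseFirst q s - p by linarith)
    linarith
  · simp only [model, h2]
    have : -(x + j) + p * riseFirst q s - p ≤ 0 := by nlinarith
    have := div_nonpos_of_nonpos_of_nonneg this hb0.le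
    linarith

end ParallelogramModel

section ModelContraction

theorem form_nonneg {τ ρ : ℝ} (h : τ ^ 2 < 4 * ρ) (x y : ℝ) :
    0 ≤ x ^ 2 - τ * x * y + ρ * y ^ 2 := by
  nlinarith [sq_nonneg (x - τ / 2 * y), mul_nonneg (sub_nonneg.2 h.le) (sq_nonneg y)]

theorem form_convex {τ ρ θ : ℝ} (h : τ ^ 2 < 4 * ρ) (h0 : 0 ≤ θ) (h1 : θ ≤ 1) (x y x' y' : ℝ) :
    ((1 - θ) * x + θ * x') ^ 2 - τ * ((1 - θ) * x + θ * x') * ((1 - θ) * y + θ * y') +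
      ρ * ((1 - θ) * y + θ * y') ^ 2 ≤
    (1 - θ) * (x ^ 2 - τ * x * y + ρ * y ^ 2) + θ * (x' ^ 2 - τ * x' * y' + ρ * y' ^ 2) := by
  have := mul_nonneg (mul_nonneg h0 (sub_nonneg.2 h1)) (form_nonneg h (x - x') (y - y'))
  linarith

theorem form_add_le {τ ρ ε : ℝ} (h : τ ^ 2 < 4 * ρ) (h0 : 0 ≤ ε) (x y d : ℝ) :
    (x + ε * d) ^ 2 - τ * (x + ε * d) * y + ρ * y ^ 2 ≤
      (1 + ε) * (x ^ 2 - τ * x * y + ρ * y ^ 2) + (ε + ε ^ 2) * d ^ 2 := by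
  have := mul_nonneg h0 (form_nonneg h (x - d) y)
  linarith

set_option maxHeartbeats 400000 in
theorem exists_model_contraction {a b p q τ ρ l : ℝ} (hb : 0 < b) (hq : q * b = a - p)
    (hq0 : 0 < q) (hq1 : q < 1) (hτ : τ ^ 2 < 4 * ρ) (hl : l < 1) (hl0 : 0 ≤ l)
    (H1 : ∀ x y : ℝ, ((a - p) / (b - a + p) * x - y / (b - a + p)) ^ 2 -
        τ * ((a - p) / (b - a + p) * x - y / (b - a + p)) * x + ρ * x ^ 2 ≤
        l * (x ^ 2 - τ * x * y + ρ * y ^ 2))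
    (H2 : ∀ x y : ℝ, ρ * ((1 - p) * x + p / (a - p) * y) ^ 2 ≤
        l * (x ^ 2 - τ * x * y + ρ * y ^ 2)) :
    ∃ ε K : ℝ, 0 < ε ∧ ε < 1 ∧ 0 ≤ K ∧ K < 1 ∧ ∀ P P' : ℝ × ℝ,
      ‖formMap τ ρ b q (model q p ε b P - model q p ε b P')‖ ^ 2 ≤
        K * ‖formMap τ ρ b q (P - P')‖ ^ 2 := by
  have hq' : 0 < 1 - q := by linarith
  set c := 1 / q + 1 / (1 - q) with hc
  have hc0 : 0 < c := by positivity
  obtain ⟨μ, hμ, Hμ⟩ := exists_pos_mul_le_form (α := 1) (β := -τ) (γ := ρ) one_pos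
    (by linarith) (2 + 2 * c ^ 2 * q ^ 2) (-(4 * c ^ 2 * (q / b))) (2 * c ^ 2 / b ^ 2)
  set ε := (1 - l) / (2 * (1 + 2 / μ)) with hε
  have hε0 : 0 < ε := div_pos (by linarith) (by positivity)
  have hεe : ε * (2 * (1 + 2 / μ)) = 1 - l := div_mul_cancel₀ _ (by positivity)
  have hμ' : 0 < 2 / μ := by positivity
  have hε1 : ε < 1 := by nlinarith [mul_pos hε0 hμ']
  refine ⟨ε, (1 + l) / 2, hε0, hε1, by linarith, by linarith, ?_⟩
  rintro ⟨x₁, s₁⟩ ⟨x₂, s₂⟩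
  rw [norm_formMap_sq hτ, norm_formMap_sq hτ]
  obtain ⟨θ, hθ0, hθ1, hF, hL⟩ := exists_share hq0 hq1 s₁ s₂
  have hd := abs_bump_sub_le q x₁ x₂ s₁ s₂
  have hF' := abs_riseFirst_sub_le hq0 hq1 s₁ s₂
  have hL' := abs_riseLast_sub_le hq0 hq1 s₁ s₂
  obtain ⟨d, hdd⟩ : ∃ d, d = bump q x₁ s₁ - bump q x₂ s₂ := ⟨_, rfl⟩
  obtain ⟨x, hx⟩ : ∃ x, x = x₁ - x₂ := ⟨_, rfl⟩
  obtain ⟨y, hy⟩ : ∃ y, y = -b * (s₁ - s₂ - q * (x₁ - x₂)) := ⟨_, rfl⟩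
  have hs : s₁ - s₂ = q * x - y / b := by rw [hx, hy]; field_simp; ring
  rw [← hdd, ← hx] at hd
  have hd2 : d ^ 2 ≤ (x ^ 2 - τ * x * y + ρ * y ^ 2) / μ := by
    have h1 : |d| ≤ |x| + c * |q * x - y / b| := by
      rw [← hs, hc]; linarith
    have h2 : d ^ 2 ≤ 2 * x ^ 2 + 2 * c ^ 2 * (q * x - y / b) ^ 2 := by
      rw [← sq_abs d, ← sq_abs x, ← sq_abs (q * x - y / b)]
      have : |d| ^ 2 ≤ (|x| + c * |q * x - y / b|) ^ 2 := by gcongr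
      nlinarith [sq_nonneg (|x| - c * |q * x - y / b|)]
    rw [le_div_iff₀ hμ]
    have h3 := Hμ x y
    calc d ^ 2 * μ ≤ (2 * x ^ 2 + 2 * c ^ 2 * (q * x - y / b) ^ 2) * μ := by gcongr
      _ = μ * ((2 + 2 * c ^ 2 * q ^ 2) * x ^ 2 + -(4 * c ^ 2 * (q / b)) * x * y +
          2 * c ^ 2 / b ^ 2 * y ^ 2) := by field_simp; ring
      _ ≤ _ := h3
      _ = _ := by ring
  have hV := form_nonneg hτ x y
  have hap : a - p ≠ 0 := by rw [← hq]; positivity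
  have hbap : b - a + p = b * (1 - q) := by linear_combination hq
  have e1 : (model q p ε b (x₁, s₁) - model q p ε b (x₂, s₂)).1 =
      (1 - θ) * ((a - p) / (b - a + p) * x - y / (b - a + p)) + θ * 0 + ε * d := by
    have : (model q p ε b (x₁, s₁) - model q p ε b (x₂, s₂)).1 =
      riseLast q s₁ - riseLast q s₂ + ε * d := by
      simp only [model, modelFst, Prod.fst_sub, hdd]; ring
    rw [this, hL, hs, hbap, ← hq]
    field_simp
    ring
  have e2 : -b * ((model q p ε b (x₁, s₁) - model q p ε b (x₂, s₂)).2 -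
      q * (model q p ε b (x₁, s₁) - model q p ε b (x₂, s₂)).1) =
      (1 - θ) * x + θ * ((1 - p) * x + p / (a - p) * y) := by
    have : -b * ((model q p ε b (x₁, s₁) - model q p ε b (x₂, s₂)).2 -
      q * (model q p ε b (x₁, s₁) - model q p ε b (x₂, s₂)).1) =
      x - p * (riseFirst q s₁ - riseFirst q s₂) := by
      simp only [model, Prod.fst_sub, Prod.snd_sub, hx]; field_simp; ring
    rw [this, hF, hs, ← hq]
    field_simp
    ring
  rw [e2, e1]
  simp only [Prod.fst_sub, Prod.snd_sub]
  rw [← hy, ← hx]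
  refine (form_add_le hτ hε0.le _ _ _).trans ?_
  have h1 := form_convex hτ hθ0 hθ1 ((a - p) / (b - a + p) * x - y / (b - a + p)) x 0
    ((1 - p) * x + p / (a - p) * y)
  have h2 := mul_le_mul_of_nonneg_left (H1 x y) (sub_nonneg.2 hθ1)
  have h3 := mul_le_mul_of_nonneg_left (H2 x y) hθ0
  have h4 : (1 - θ) * (l * (x ^ 2 - τ * x * y + ρ * y ^ 2)) +
      θ * (l * (x ^ 2 - τ * x * y + ρ * y ^ 2)) = l * (x ^ 2 - τ * x * y + ρ * y ^ 2) := by ring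
  have h1' := h1.trans (show _ ≤ l * (x ^ 2 - τ * x * y + ρ * y ^ 2) by
    rw [← h4]
    refine add_le_add h2 (le_trans (le_of_eq ?_) h3)
    ring)
  have h5 := mul_le_mul_of_nonneg_left h1' (show 0 ≤ 1 + ε by linarith)
  have h6 := mul_le_mul_of_nonneg_left hd2 (show 0 ≤ ε + ε ^ 2 by positivity)
  refine (add_le_add h5 h6).trans ?_
  have e3 : (1 + ε) * (l * (x ^ 2 - τ * x * y + ρ * y ^ 2)) +
      (ε + ε ^ 2) * ((x ^ 2 - τ * x * y + ρ * y ^ 2) / μ) =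
      (l + ε * l + (ε + ε ^ 2) / 2 * (2 / μ)) * (x ^ 2 - τ * x * y + ρ * y ^ 2) := by
    field_simp
  rw [e3]
  refine mul_le_mul_of_nonneg_right ?_ hV
  have : (ε + ε ^ 2) / 2 * (2 / μ) ≤ ε * (2 / μ) := by
    refine mul_le_mul_of_nonneg_right ?_ hμ'.le
    have := mul_le_of_le_one_right hε0.le hε1.le
    rw [pow_two]
    linarith
  have h7 : ε * l ≤ ε := mul_le_of_le_one_right hε0.le hl.le
  linarith

end ModelContraction

section ParallelogramTile

theorem isCompact_parallelogram (q : ℝ) : IsCompact (parallelogram q) := by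
  have : parallelogram q = (fun P : ℝ × ℝ => (P.1, P.2 + q * P.1)) ''
      (Set.Icc 0 1 ×ˢ Set.Icc 0 1) := by
    ext ⟨x, s⟩
    constructor
    · rintro ⟨h0, h1, h2, h3⟩
      exact ⟨(x, s - q * x), ⟨⟨h0, h1⟩, ⟨h2, h3⟩⟩, by simp⟩
    · rintro ⟨⟨x', t⟩, ⟨⟨h0, h1⟩, ⟨h2, h3⟩⟩, h⟩
      simp only [Prod.mk.injEq] at h h0 h1 h2 h3
      obtain ⟨rfl, rfl⟩ := h
      refine ⟨h0, h1, ?_, ?_⟩ <;> simpa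
  rw [this]
  exact (isCompact_Icc.prod isCompact_Icc).image (by fun_prop)

theorem convex_parallelogram (q : ℝ) : Convex ℝ (parallelogram q) := by
  rintro ⟨x, s⟩ ⟨h0, h1, h2, h3⟩ ⟨x', s'⟩ ⟨h0', h1', h2', h3'⟩ u w hu hw huw
  simp only at *
  refine ⟨?_, ?_, ?_, ?_⟩ <;> simp only [Prod.fst_add, Prod.snd_add, Prod.smul_fst, Prod.smul_snd,
    smul_eq_mul]
  · positivity
  · nlinarith
  · nlinarith [mul_nonneg hu h2, mul_nonneg hw h2']
  · nlinarith [mul_nonneg hu (sub_nonneg.2 h3), mul_nonneg hw (sub_nonneg.2 h3')]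

/-- The interior of the parallelogram. -/
def openParallelogram (q : ℝ) : Set (ℝ × ℝ) :=
  {P | 0 < P.1 ∧ P.1 < 1 ∧ 0 < P.2 - q * P.1 ∧ P.2 - q * P.1 < 1}

theorem openParallelogram_subset_interior (q : ℝ) :
    openParallelogram q ⊆ interior (parallelogram q) := by
  refine interior_maximal (fun P h => ⟨h.1.le, h.2.1.le, h.2.2.1.le, h.2.2.2.le⟩) ?_
  have h1 : IsOpen {P : ℝ × ℝ | 0 < P.1} := isOpen_lt (by fun_prop) (by fun_prop)
  have h2 : IsOpen {P : ℝ × ℝ | P.1 < 1} := isOpen_lt (by fun_prop) (by fun_prop)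
  have h3 : IsOpen {P : ℝ × ℝ | 0 < P.2 - q * P.1} := isOpen_lt (by fun_prop) (by fun_prop)
  have h4 : IsOpen {P : ℝ × ℝ | P.2 - q * P.1 < 1} := isOpen_lt (by fun_prop) (by fun_prop)
  exact h1.inter (h2.inter (h3.inter h4))

theorem center_mem_openParallelogram (q : ℝ) : ((1 / 2 : ℝ), 1 / 2 + q / 2) ∈
    openParallelogram q := by
  refine ⟨?_, ?_, ?_, ?_⟩ <;> simp only <;> linarith

theorem parallelogram_subset_closure (q : ℝ) :
    parallelogram q ⊆ closure (openParallelogram q) := by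
  rintro ⟨x, s⟩ ⟨h0, h1, h2, h3⟩
  simp only at h0 h1 h2 h3
  have hcont : Continuous fun t : ℝ =>
      ((1 - t) * x + t * (1 / 2), (1 - t) * s + t * (1 / 2 + q / 2)) := by fun_prop
  have : Tendsto (fun t : ℝ => ((1 - t) * x + t * (1 / 2), (1 - t) * s + t * (1 / 2 + q / 2)))
      (𝓝[>] 0) (𝓝 (x, s)) := by
    have := hcont.tendsto 0
    simp only [sub_zero, one_mul, zero_mul, add_zero] at this
    exact this.mono_left nhdsWithin_le_nhds
  refine mem_closure_of_tendsto this ?_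
  filter_upwards [Ioo_mem_nhdsGT (zero_lt_one' ℝ)] with t ht
  obtain ⟨ht0, ht1⟩ := ht
  refine ⟨?_, ?_, ?_, ?_⟩ <;> simp only <;> nlinarith

theorem IsCollinearTile.nonempty_homeomorph_closedBall_of_pos {a b : ℤ}
    (h : (a = 1 ∧ 2 ≤ b) ∨ (a = 2 ∧ 3 ≤ b) ∨ (3 ≤ a ∧ a + 1 ≤ b ∧ 2 * a ≤ b + 2))
    {T : Set (ℝ × ℝ)} (hT : IsCollinearTile a b T ∨ IsCollinearTile (-a) b T) :
    Nonempty (T ≃ₜ Metric.closedBall (0 : EuclideanSpace ℝ (Fin 2)) 1) := by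
  have hb : 2 ≤ b := by omega
  have hab : a + 1 ≤ b := by omega
  have hb' : (2 : ℝ) ≤ b := by exact_mod_cast hb
  have hab' : (a : ℝ) + 1 ≤ b := by exact_mod_cast hab
  have hb0 : (0 : ℝ) < b := by linarith
  obtain ⟨p, τ, ρ, l, hp0, hp1, hpa, hτ, hl, hl0, H1, H2⟩ :=
    exists_slope_and_form (a := a) (b := b) (by exact_mod_cast h)
  set q : ℝ := (a - p) / b with hqd
  have hq : q * b = a - p := div_mul_cancel₀ _ hb0.ne'
  have hq0 : 0 < q := div_pos (by linarith) hb0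
  have hq1 : q < 1 := by rw [hqd, div_lt_one hb0]; linarith
  obtain ⟨ε, K, hε0, hε1, hK0, hK1, hΦ⟩ :=
    exists_model_contraction hb0 hq hq0 hq1 hτ hl hl0 H1 H2
  refine nonempty_homeomorph_closedBall_of_model (c := (1, 1 + q)) (by omega) hT hτ hK0 hK1 hΦ
    (continuous_model hq0 hq1) (model_injective hb0.ne' hq0 hq1 hp0 hp1 hε0 hε1)
    (model_surjective hb0.ne' hq0 hq1 hε0 hε1)
    (norm_model_sub_le (by linarith) hq hq0 hq1 hp0 hp1 hε0 hε1)
    (model_add hb0.ne' hq rfl rfl) (isCompact_parallelogram q) (convex_parallelogram q)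
    ⟨_, openParallelogram_subset_interior q (center_mem_openParallelogram q)⟩ ?_ ?_ ?_ ?_
    (parallelogram_subset_closure q)
  · rintro ⟨x, s⟩ ⟨h0, h1, h2, h3⟩
    simp only at h0 h1 h2 h3
    refine ⟨?_, ?_, ?_, ?_⟩ <;> simp only [Prod.mk_sub_mk] <;> linarith
  · intro x s
    obtain ⟨m, hm0, hm1⟩ := exists_int_add_mem_Icc 0 x
    obtain ⟨n, hn0, hn1⟩ := exists_int_add_mem_Icc 0 (s - q * (x + m))
    refine ⟨m, n, ?_, ?_, ?_, ?_⟩ <;> simp only <;> linarith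
  · intro x s hx j h0 h1
    have : (j : ℝ) ≤ b - 1 := by exact_mod_cast (by omega : j ≤ b - 1)
    exact model_mem_parallelogram (by linarith) hq0 hq1 hp0 hp1 hε0 hε1 hx h0 this
  · rintro x s ⟨h0, h1, h2, h3⟩ m n ⟨h4, h5, h6, h7⟩
    simp only at *
    have hm := int_eq_zero_of_add_mem_Ioo (α := 0) (x := x) (m := m) ⟨h0, by linarith⟩
      ⟨h4, by linarith⟩
    refine ⟨hm, ?_⟩
    rw [hm, Int.cast_zero, add_zero] at h6 h7
    exact int_eq_zero_of_add_mem_Ioo (α := 0) (x := s - q * x) (m := n) ⟨h2, by linarith⟩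
      ⟨by linarith, by linarith⟩

end ParallelogramTile

section Hexagon

/-- The centrally symmetric hexagon that is the fundamental domain for the twindragon. -/
def InHexagon (x y : ℝ) : Prop :=
  (-2 ≤ 4 * x + y ∧ 4 * x + y ≤ 2) ∧ (-2 ≤ x + 4 * y ∧ x + 4 * y ≤ 2) ∧ (-1 ≤ x - y ∧ x - y ≤ 1)

/-- First coordinate of a piecewise linear contraction of the hexagon onto one of its halves. -/
noncomputable def foldFst (x y : ℝ) : ℝ :=
  -(19 / 50) + 11 / 25 * x + 11 / 100 * y + 1 / 4 * (max (x + 2 / 5) 0 + max (y + 2 / 5) 0)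
    - 33 / 100 * max (x - y) 0

/-- Second coordinate of a piecewise linear contraction of the hexagon onto one of its halves. -/
noncomputable def foldSnd (x y : ℝ) : ℝ :=
  11 / 50 - 9 / 25 * x - 9 / 100 * y + 1 / 4 * (max (x + 2 / 5) 0 + max (y + 2 / 5) 0)
    - 73 / 100 * max (x - y) 0

theorem InHexagon.neg {x y : ℝ} (h : InHexagon x y) : InHexagon (-x) (-y) := by
  obtain ⟨⟨h1, h2⟩, ⟨h3, h4⟩, h5, h6⟩ := h
  refine ⟨⟨?_, ?_⟩, ⟨?_, ?_⟩, ?_, ?_⟩ <;> linarith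

/-- The sectors on each of which the contraction of the hexagon is linear. -/
def sector : Fin 4 → Set (ℝ × ℝ) :=
  ![{p | p.1 ≤ -(2 / 5)}, {p | -(2 / 5) ≤ p.1 ∧ p.1 ≤ p.2}, {p | -(2 / 5) ≤ p.2 ∧ p.2 ≤ p.1},
    {p | p.2 ≤ -(2 / 5)}]

theorem exists_mem_sector (x y : ℝ) : ∃ k, (x, y) ∈ sector k := by
  rcases le_total x (-(2 / 5)) with h | h
  · exact ⟨0, h⟩
  rcases le_total x y with h' | h'
  · exact ⟨1, h, h'⟩
  rcases le_total y (-(2 / 5)) with h'' | h''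
  · exact ⟨3, h''⟩
  · exact ⟨2, h'', h'⟩

theorem fold_eq_of_fst_le {x y : ℝ} (h : InHexagon x y) (hx : x ≤ -(2 / 5)) :
    foldFst x y = -(7 / 25) + 11 / 25 * x + 9 / 25 * y ∧
      foldSnd x y = 8 / 25 - 9 / 25 * x + 4 / 25 * y := by
  obtain ⟨⟨h1, h2⟩, ⟨h3, h4⟩, h5, h6⟩ := h
  unfold foldFst foldSnd
  rw [max_eq_right (by linarith : x + 2 / 5 ≤ 0), max_eq_left (by linarith : 0 ≤ y + 2 / 5),
    max_eq_right (by linarith : x - y ≤ 0)]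
  constructor <;> ring

theorem fold_eq_of_fst_le_snd {x y : ℝ} (hx : -(2 / 5) ≤ x) (hy : x ≤ y) :
    foldFst x y = -(9 / 50) + 69 / 100 * x + 9 / 25 * y ∧
      foldSnd x y = 21 / 50 - 11 / 100 * x + 4 / 25 * y := by
  unfold foldFst foldSnd
  rw [max_eq_left (by linarith : 0 ≤ x + 2 / 5), max_eq_left (by linarith : 0 ≤ y + 2 / 5),
    max_eq_right (by linarith : x - y ≤ 0)]
  constructor <;> ring

theorem fold_eq_of_snd_le_fst {x y : ℝ} (hy : -(2 / 5) ≤ y) (hx : y ≤ x) :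
    foldFst x y = -(9 / 50) + 9 / 25 * x + 69 / 100 * y ∧
      foldSnd x y = 21 / 50 - 21 / 25 * x + 89 / 100 * y := by
  unfold foldFst foldSnd
  rw [max_eq_left (by linarith : 0 ≤ x + 2 / 5), max_eq_left (by linarith : 0 ≤ y + 2 / 5),
    max_eq_left (by linarith : 0 ≤ x - y)]
  constructor <;> ring

theorem fold_eq_of_snd_le {x y : ℝ} (h : InHexagon x y) (hy : y ≤ -(2 / 5)) :
    foldFst x y = -(7 / 25) + 9 / 25 * x + 11 / 25 * y ∧
      foldSnd x y = 8 / 25 - 21 / 25 * x + 16 / 25 * y := by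
  obtain ⟨⟨h1, h2⟩, ⟨h3, h4⟩, h5, h6⟩ := h
  unfold foldFst foldSnd
  rw [max_eq_left (by linarith : 0 ≤ x + 2 / 5), max_eq_right (by linarith : y + 2 / 5 ≤ 0),
    max_eq_left (by linarith : 0 ≤ x - y)]
  constructor <;> ring

theorem fold_cases {x y : ℝ} (h : InHexagon x y) :
    (x ≤ -(2 / 5) ∧ foldFst x y = -(7 / 25) + 11 / 25 * x + 9 / 25 * y ∧
      foldSnd x y = 8 / 25 - 9 / 25 * x + 4 / 25 * y) ∨
    ((-(2 / 5) ≤ x ∧ x ≤ y) ∧ foldFst x y = -(9 / 50) + 69 / 100 * x + 9 / 25 * y ∧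
      foldSnd x y = 21 / 50 - 11 / 100 * x + 4 / 25 * y) ∨
    ((-(2 / 5) ≤ y ∧ y ≤ x) ∧ foldFst x y = -(9 / 50) + 9 / 25 * x + 69 / 100 * y ∧
      foldSnd x y = 21 / 50 - 21 / 25 * x + 89 / 100 * y) ∨
    (y ≤ -(2 / 5) ∧ foldFst x y = -(7 / 25) + 9 / 25 * x + 11 / 25 * y ∧
      foldSnd x y = 8 / 25 - 21 / 25 * x + 16 / 25 * y) := by
  rcases le_total x (-(2 / 5)) with hx | hx
  · exact .inl ⟨hx, fold_eq_of_fst_le h hx⟩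
  rcases le_total x y with hxy | hxy
  · exact .inr (.inl ⟨⟨hx, hxy⟩, fold_eq_of_fst_le_snd hx hxy⟩)
  rcases le_total y (-(2 / 5)) with hy | hy
  · exact .inr (.inr (.inr ⟨hy, fold_eq_of_snd_le h hy⟩))
  · exact .inr (.inr (.inl ⟨⟨hy, hxy⟩, fold_eq_of_snd_le_fst hy hxy⟩))

theorem fold_contraction {x y x' y' : ℝ} (h : InHexagon x y) (h' : InHexagon x' y') {k : Fin 4}
    (hk : (x, y) ∈ sector k) (hk' : (x', y') ∈ sector k) :
    5 * (foldFst x y - foldFst x' y') ^ 2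
        - 3 * (foldFst x y - foldFst x' y') * (foldSnd x y - foldSnd x' y')
        + 4 * (foldSnd x y - foldSnd x' y') ^ 2 ≤
      93 / 100 * (5 * (x - x') ^ 2 - 3 * (x - x') * (y - y') + 4 * (y - y') ^ 2) := by
  have aux : ∃ α β γ δ : ℝ, foldFst x y - foldFst x' y' = α * (x - x') + β * (y - y') ∧
      foldSnd x y - foldSnd x' y' = γ * (x - x') + δ * (y - y') ∧
      ∀ p q : ℝ, 5 * (α * p + β * q) ^ 2 - 3 * (α * p + β * q) * (γ * p + δ * q) +
        4 * (γ * p + δ * q) ^ 2 ≤ 93 / 100 * (5 * p ^ 2 - 3 * p * q + 4 * q ^ 2) := by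
    fin_cases k
    · obtain ⟨e1, e2⟩ := fold_eq_of_fst_le h hk
      obtain ⟨e1', e2'⟩ := fold_eq_of_fst_le h' hk'
      refine ⟨11 / 25, 9 / 25, -(9 / 25), 4 / 25, by linarith, by linarith, fun p q => ?_⟩
      nlinarith [sq_nonneg p, sq_nonneg q, sq_nonneg (p - q), sq_nonneg (p + q)]
    · obtain ⟨e1, e2⟩ := fold_eq_of_fst_le_snd hk.1 hk.2
      obtain ⟨e1', e2'⟩ := fold_eq_of_fst_le_snd hk'.1 hk'.2
      refine ⟨69 / 100, 9 / 25, -(11 / 100), 4 / 25, by linarith, by linarith, fun p q => ?_⟩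
      nlinarith [sq_nonneg p, sq_nonneg q, sq_nonneg (p - q), sq_nonneg (p + q)]
    · obtain ⟨e1, e2⟩ := fold_eq_of_snd_le_fst hk.1 hk.2
      obtain ⟨e1', e2'⟩ := fold_eq_of_snd_le_fst hk'.1 hk'.2
      refine ⟨9 / 25, 69 / 100, -(21 / 25), 89 / 100, by linarith, by linarith, fun p q => ?_⟩
      nlinarith [sq_nonneg p, sq_nonneg q, sq_nonneg (p - q), sq_nonneg (p + q)]
    · obtain ⟨e1, e2⟩ := fold_eq_of_snd_le h hk
      obtain ⟨e1', e2'⟩ := fold_eq_of_snd_le h' hk'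
      refine ⟨9 / 25, 11 / 25, -(21 / 25), 16 / 25, by linarith, by linarith, fun p q => ?_⟩
      nlinarith [sq_nonneg p, sq_nonneg q, sq_nonneg (p - q), sq_nonneg (p + q)]
  obtain ⟨α, β, γ, δ, e1, e2, H⟩ := aux
  rw [e1, e2]
  exact H _ _

theorem InHexagon.fold {x y : ℝ} (h : InHexagon x y) :
    InHexagon (foldFst x y) (foldSnd x y) := by
  have hc := fold_cases h
  obtain ⟨⟨h1, h2⟩, ⟨h3, h4⟩, h5, h6⟩ := h
  rcases hc with ⟨g, e1, e2⟩ | ⟨⟨g, g'⟩, e1, e2⟩ | ⟨⟨g, g'⟩, e1, e2⟩ | ⟨g, e1, e2⟩ <;>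
    rw [e1, e2] <;> refine ⟨⟨?_, ?_⟩, ⟨?_, ?_⟩, ?_, ?_⟩ <;> linarith

theorem exists_fold_eq {u w : ℝ} (h : InHexagon u w) :
    ∃ x y, InHexagon x y ∧ ((foldFst x y = u ∧ foldSnd x y = w) ∨
      (foldFst x y = -u ∧ foldSnd x y = -w)) := by
  wlog hs : 11 * u - 6 * w ≤ 0 generalizing u w
  · obtain ⟨x, y, hxy, H⟩ := this h.neg (by linarith)
    refine ⟨x, y, hxy, ?_⟩
    simpa using H.symm
  suffices H : ∃ x y, InHexagon x y ∧ foldFst x y = u ∧ foldSnd x y = w by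
    obtain ⟨x, y, hxy, H⟩ := H
    exact ⟨x, y, hxy, .inl H⟩
  obtain ⟨⟨h1, h2⟩, ⟨h3, h4⟩, h5, h6⟩ := h
  obtain ⟨p, hp⟩ : ∃ p, u = p - 3 / 5 := ⟨u + 3 / 5, by ring⟩
  obtain ⟨q, hq⟩ : ∃ q, w = q + 2 / 5 := ⟨w - 2 / 5, by ring⟩
  by_cases c1 : 4 * p ≤ 9 * q
  · have hxy : InHexagon (4 / 5 * p - 9 / 5 * q - 2 / 5) (9 / 5 * p + 11 / 5 * q - 2 / 5) := by
      refine ⟨⟨?_, ?_⟩, ⟨?_, ?_⟩, ?_, ?_⟩ <;> linarith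
    obtain ⟨e1, e2⟩ := fold_eq_of_fst_le hxy (by linarith)
    exact ⟨_, _, hxy, by linarith, by linarith⟩
  by_cases c2 : p ≤ 21 * q
  · have hxy : InHexagon (1 / 15 * (16 * p - 36 * q) - 2 / 5)
        (1 / 15 * (11 * p + 69 * q) - 2 / 5) := by
      refine ⟨⟨?_, ?_⟩, ⟨?_, ?_⟩, ?_, ?_⟩ <;> linarith
    obtain ⟨e1, e2⟩ := fold_eq_of_fst_le_snd (x := 1 / 15 * (16 * p - 36 * q) - 2 / 5)
      (y := 1 / 15 * (11 * p + 69 * q) - 2 / 5) (by linarith) (by linarith)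
    exact ⟨_, _, hxy, by linarith, by linarith⟩
  by_cases c3 : 0 ≤ 7 * p + 3 * q
  · have hxy : InHexagon (1 / 90 * (89 * p - 69 * q) - 2 / 5)
        (1 / 90 * (84 * p + 36 * q) - 2 / 5) := by
      refine ⟨⟨?_, ?_⟩, ⟨?_, ?_⟩, ?_, ?_⟩ <;> linarith
    obtain ⟨e1, e2⟩ := fold_eq_of_snd_le_fst (x := 1 / 90 * (89 * p - 69 * q) - 2 / 5)
      (y := 1 / 90 * (84 * p + 36 * q) - 2 / 5) (by linarith) (by linarith)
    exact ⟨_, _, hxy, by linarith, by linarith⟩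
  · have hxy : InHexagon (1 / 60 * (64 * p - 44 * q) - 2 / 5)
        (1 / 60 * (84 * p + 36 * q) - 2 / 5) := by
      refine ⟨⟨?_, ?_⟩, ⟨?_, ?_⟩, ?_, ?_⟩ <;> linarith
    obtain ⟨e1, e2⟩ := fold_eq_of_snd_le hxy (by linarith)
    exact ⟨_, _, hxy, by linarith, by linarith⟩

theorem int_cases_of_hexagon {m n : ℤ} (h1 : |4 * (m : ℝ) + n| ≤ 4) (h2 : |(m : ℝ) + 4 * n| ≤ 4) :
    (m = 0 ∧ n = 0) ∨ (m = 1 ∧ n = 0) ∨ (m = -1 ∧ n = 0) ∨ (m = 0 ∧ n = 1) ∨ (m = 0 ∧ n = -1) ∨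
      (m = 1 ∧ n = -1) ∨ (m = -1 ∧ n = 1) := by
  rw [abs_le] at h1 h2
  norm_cast at h1 h2
  omega

theorem int_cases_of_sub {x y x' y' : ℝ} (h : InHexagon x y) (h' : InHexagon x' y') {m n : ℤ}
    (hm : x - x' = m) (hn : y - y' = n) :
    (m = 0 ∧ n = 0) ∨ (m = 1 ∧ n = 0) ∨ (m = -1 ∧ n = 0) ∨ (m = 0 ∧ n = 1) ∨ (m = 0 ∧ n = -1) ∨
      (m = 1 ∧ n = -1) ∨ (m = -1 ∧ n = 1) := by
  obtain ⟨⟨h1, h2⟩, ⟨h3, h4⟩, h5, h6⟩ := h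
  obtain ⟨⟨g1, g2⟩, ⟨g3, g4⟩, g5, g6⟩ := h'
  refine int_cases_of_hexagon ?_ ?_ <;> rw [← hm, ← hn, abs_le] <;> constructor <;> linarith

theorem fold_sub_eq {x y x' y' : ℝ} (h : InHexagon x y) (h' : InHexagon x' y') {m n : ℤ}
    (hm : x - x' = m - n) (hn : y - y' = m + n) :
    foldFst x y - foldFst x' y' = m ∧ foldSnd x y - foldSnd x' y' = n := by
  wlog hp : 0 ≤ n generalizing x y x' y' m n
  · obtain ⟨e1, e2⟩ := this h' h (m := -m) (n := -n) (by push_cast; linarith)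
      (by push_cast; linarith) (by omega)
    push_cast at e1 e2
    constructor <;> linarith
  have hi := int_cases_of_sub h h' (m := m - n) (n := m + n) (by push_cast; exact hm)
    (by push_cast; exact hn)
  obtain ⟨rfl, rfl | rfl⟩ : m = 0 ∧ (n = 0 ∨ n = 1) := by omega
  · have hx : x = x' := by push_cast at hm; linarith
    have hy : y = y' := by push_cast at hn; linarith
    simp [hx, hy]
  · push_cast at hm hn ⊢
    have hc := fold_eq_of_fst_le h
    have hc' := fold_eq_of_snd_le h'
    obtain ⟨⟨h1, h2⟩, ⟨h3, h4⟩, h5, h6⟩ := h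
    obtain ⟨⟨g1, g2⟩, ⟨g3, g4⟩, g5, g6⟩ := h'
    obtain ⟨e1, e2⟩ := hc (by linarith)
    obtain ⟨e1', e2'⟩ := hc' (by linarith)
    constructor <;> linarith

theorem four_mul_foldFst_add_lt {x y : ℝ} (h : InHexagon x y) :
    4 * foldFst x y + foldSnd x y < 2 := by
  have hc := fold_cases h
  obtain ⟨⟨h1, h2⟩, ⟨h3, h4⟩, h5, h6⟩ := h
  rcases hc with ⟨c, e1, e2⟩ | ⟨⟨c, d⟩, e1, e2⟩ | ⟨⟨c, d⟩, e1, e2⟩ | ⟨c, e1, e2⟩ <;>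
    linarith

theorem foldFst_sub_lt {x y : ℝ} (h : InHexagon x y) : foldFst x y - foldSnd x y < 1 := by
  have hc := fold_cases h
  obtain ⟨⟨h1, h2⟩, ⟨h3, h4⟩, h5, h6⟩ := h
  rcases hc with ⟨c, e1, e2⟩ | ⟨⟨c, d⟩, e1, e2⟩ | ⟨⟨c, d⟩, e1, e2⟩ | ⟨c, e1, e2⟩ <;>
    linarith

theorem eleven_mul_foldFst_sub_le {x y : ℝ} (h : InHexagon x y) :
    11 * foldFst x y - 6 * foldSnd x y ≤ 0 := by
  have hc := fold_cases h
  obtain ⟨⟨h1, h2⟩, ⟨h3, h4⟩, h5, h6⟩ := h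
  rcases hc with ⟨c, e1, e2⟩ | ⟨⟨c, d⟩, e1, e2⟩ | ⟨⟨c, d⟩, e1, e2⟩ | ⟨c, e1, e2⟩ <;>
    linarith

theorem fold_seam {x y : ℝ} (h : InHexagon x y) (he : 0 ≤ 11 * foldFst x y - 6 * foldSnd x y) :
    -(2 / 5) ≤ y ∧ y ≤ x ∧ 4 * x + y = 2 := by
  have hc := fold_cases h
  obtain ⟨⟨h1, h2⟩, ⟨h3, h4⟩, h5, h6⟩ := h
  rcases hc with ⟨c, e1, e2⟩ | ⟨⟨c, d⟩, e1, e2⟩ | ⟨⟨c, d⟩, e1, e2⟩ | ⟨c, e1, e2⟩ <;>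
    refine ⟨?_, ?_, ?_⟩ <;> linarith

theorem fold_edge_southwest {x y : ℝ} (h : InHexagon x y)
    (he : 4 * foldFst x y + foldSnd x y ≤ -2) : y ≤ -(2 / 5) ∧ x + 4 * y = -2 := by
  have hc := fold_cases h
  obtain ⟨⟨h1, h2⟩, ⟨h3, h4⟩, h5, h6⟩ := h
  rcases hc with ⟨c, e1, e2⟩ | ⟨⟨c, d⟩, e1, e2⟩ | ⟨⟨c, d⟩, e1, e2⟩ | ⟨c, e1, e2⟩ <;>
    constructor <;> linarith

theorem fold_edge_south {x y : ℝ} (h : InHexagon x y)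
    (he : foldFst x y + 4 * foldSnd x y ≤ -2) : y ≤ -(2 / 5) ∧ x - y = 1 := by
  have hc := fold_cases h
  obtain ⟨⟨h1, h2⟩, ⟨h3, h4⟩, h5, h6⟩ := h
  rcases hc with ⟨c, e1, e2⟩ | ⟨⟨c, d⟩, e1, e2⟩ | ⟨⟨c, d⟩, e1, e2⟩ | ⟨c, e1, e2⟩ <;>
    constructor <;> linarith

theorem fold_edge_northwest {x y : ℝ} (h : InHexagon x y)
    (he : foldFst x y - foldSnd x y ≤ -1) : x ≤ -(2 / 5) ∧ 4 * x + y = -2 := by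
  have hc := fold_cases h
  obtain ⟨⟨h1, h2⟩, ⟨h3, h4⟩, h5, h6⟩ := h
  rcases hc with ⟨c, e1, e2⟩ | ⟨⟨c, d⟩, e1, e2⟩ | ⟨⟨c, d⟩, e1, e2⟩ | ⟨c, e1, e2⟩ <;>
    constructor <;> linarith

theorem fold_edge_north {x y : ℝ} (h : InHexagon x y)
    (he : 2 ≤ foldFst x y + 4 * foldSnd x y) :
    (x ≤ -(2 / 5) ∧ x - y = -1) ∨ (-(2 / 5) ≤ x ∧ x ≤ y ∧ x + 4 * y = 2) := by
  have hc := fold_cases h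
  obtain ⟨⟨h1, h2⟩, ⟨h3, h4⟩, h5, h6⟩ := h
  rcases hc with ⟨c, e1, e2⟩ | ⟨⟨c, d⟩, e1, e2⟩ | ⟨⟨c, d⟩, e1, e2⟩ | ⟨c, e1, e2⟩
  · left; constructor <;> linarith
  all_goals right; refine ⟨?_, ?_, ?_⟩ <;> linarith

theorem fold_injective {x y x' y' : ℝ} (h : InHexagon x y) (h' : InHexagon x' y')
    (hm : foldFst x y = foldFst x' y') (hn : foldSnd x y = foldSnd x' y') : x = x' ∧ y = y' := by
  have hc := fold_cases h
  have hc' := fold_cases h'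
  obtain ⟨⟨h1, -⟩, ⟨h2, -⟩, -⟩ := h
  obtain ⟨⟨g1, -⟩, ⟨g2, -⟩, -⟩ := h'
  rcases hc with ⟨c, e1, e2⟩ | ⟨⟨c, d⟩, e1, e2⟩ | ⟨⟨c, d⟩, e1, e2⟩ | ⟨c, e1, e2⟩ <;>
    rcases hc' with ⟨c', e1', e2'⟩ | ⟨⟨c', d'⟩, e1', e2'⟩ | ⟨⟨c', d'⟩, e1', e2'⟩ |
      ⟨c', e1', e2'⟩ <;>
    rw [e1, e1'] at hm <;> rw [e2, e2'] at hn <;> clear e1 e1' e2 e2' <;>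
    constructor <;> linarith

theorem sub_eq_of_fold_sub_eq {x y x' y' : ℝ} (h : InHexagon x y) (h' : InHexagon x' y') {m n : ℤ}
    (hm : foldFst x y - foldFst x' y' = m) (hn : foldSnd x y - foldSnd x' y' = n) :
    x - x' = m - n ∧ y - y' = m + n := by
  have hi := int_cases_of_sub h.fold h'.fold hm hn
  wlog hp : 0 ≤ n ∧ (n = 0 → 0 ≤ m) generalizing x y x' y' m n
  · obtain ⟨e1, e2⟩ := this h' h (m := -m) (n := -n) (by push_cast; linarith)
      (by push_cast; linarith) (by omega) (by omega)
    push_cast at e1 e2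
    constructor <;> linarith
  obtain ⟨⟨h1, h2⟩, ⟨h3, h4⟩, h5, h6⟩ := h.fold
  obtain ⟨⟨g1, g2⟩, ⟨g3, g4⟩, g5, g6⟩ := h'.fold
  obtain ⟨rfl, rfl⟩ | ⟨rfl, rfl⟩ | ⟨rfl, rfl⟩ | ⟨rfl, rfl⟩ :
      (m = 0 ∧ n = 0) ∨ (m = 1 ∧ n = 0) ∨ (m = 0 ∧ n = 1) ∨ (m = -1 ∧ n = 1) := by omega
  all_goals push_cast at hm hn ⊢
  · obtain ⟨rfl, rfl⟩ := fold_injective h h' (by linarith) (by linarith)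
    simp
  · linarith [four_mul_foldFst_add_lt h]
  · obtain ⟨c', d'⟩ := fold_edge_south h' (by linarith)
    obtain ⟨e1', e2'⟩ := fold_eq_of_snd_le h' c'
    rcases fold_edge_north h (by linarith) with ⟨c, d⟩ | ⟨c, d, _⟩
    · obtain ⟨e1, e2⟩ := fold_eq_of_fst_le h c
      constructor <;> linarith
    · obtain ⟨e1, e2⟩ := fold_eq_of_fst_le_snd c d
      constructor <;> linarith
  · linarith [foldFst_sub_lt h']

theorem fold_add_eq {x y x' y' : ℝ} (h : InHexagon x y) (h' : InHexagon x' y') {m n : ℤ}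
    (hm : x + x' = 1 + (m - n)) (hn : y + y' = m + n) :
    foldFst x y + foldFst x' y' = m ∧ foldSnd x y + foldSnd x' y' = n := by
  have hi := int_cases_of_sub h h'.neg (m := 1 + (m - n)) (n := m + n)
    (by push_cast; linarith) (by push_cast; linarith)
  have hc := fold_eq_of_fst_le h
  have hc' := fold_eq_of_fst_le h'
  have hd := fold_eq_of_snd_le h
  have hd' := fold_eq_of_snd_le h'
  obtain ⟨⟨h1, h2⟩, ⟨h3, h4⟩, h5, h6⟩ := h
  obtain ⟨⟨g1, g2⟩, ⟨g3, g4⟩, g5, g6⟩ := h'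
  obtain ⟨rfl, rfl⟩ | ⟨rfl, rfl⟩ | ⟨rfl, rfl⟩ | ⟨rfl, rfl⟩ :
      (m = 0 ∧ n = 0) ∨ (m = 0 ∧ n = 1) ∨ (m = -1 ∧ n = 0) ∨ (m = -1 ∧ n = 1) := by omega
  all_goals push_cast at hm hn ⊢
  · obtain ⟨e1, e2⟩ := fold_eq_of_snd_le_fst (x := x) (y := y) (by linarith) (by linarith)
    obtain ⟨e1', e2'⟩ := fold_eq_of_snd_le_fst (x := x') (y := y') (by linarith) (by linarith)
    constructor <;> linarith
  · obtain ⟨e1, e2⟩ := fold_eq_of_fst_le_snd (x := x) (y := y) (by linarith) (by linarith)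
    obtain ⟨e1', e2'⟩ := fold_eq_of_fst_le_snd (x := x') (y := y') (by linarith) (by linarith)
    constructor <;> linarith
  · obtain ⟨e1, e2⟩ := hd (by linarith)
    obtain ⟨e1', e2'⟩ := hd' (by linarith)
    constructor <;> linarith
  · obtain ⟨e1, e2⟩ := hc (by linarith)
    obtain ⟨e1', e2'⟩ := hc' (by linarith)
    constructor <;> linarith

theorem add_eq_of_fold_add_eq {x y x' y' : ℝ} (h : InHexagon x y) (h' : InHexagon x' y') {m n : ℤ}
    (hm : foldFst x y + foldFst x' y' = m) (hn : foldSnd x y + foldSnd x' y' = n) :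
    x + x' = 1 + (m - n) ∧ y + y' = m + n := by
  have hi := int_cases_of_sub h.fold h'.fold.neg (m := m) (n := n) (by linarith) (by linarith)
  obtain ⟨⟨h1, h2⟩, ⟨h3, h4⟩, h5, h6⟩ := h.fold
  obtain ⟨⟨g1, g2⟩, ⟨g3, g4⟩, g5, g6⟩ := h'.fold
  obtain ⟨rfl, rfl⟩ | ⟨rfl, rfl⟩ | ⟨rfl, rfl⟩ | ⟨rfl, rfl⟩ | ⟨rfl, rfl⟩ | ⟨rfl, rfl⟩ |
    ⟨rfl, rfl⟩ := hi
  all_goals push_cast at hm hn ⊢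
  · have k := eleven_mul_foldFst_sub_le h
    have k' := eleven_mul_foldFst_sub_le h'
    obtain ⟨c, d, _⟩ := fold_seam h (by linarith)
    obtain ⟨c', d', _⟩ := fold_seam h' (by linarith)
    obtain ⟨e1, e2⟩ := fold_eq_of_snd_le_fst c d
    obtain ⟨e1', e2'⟩ := fold_eq_of_snd_le_fst c' d'
    constructor <;> linarith
  · linarith [four_mul_foldFst_add_lt h]
  · obtain ⟨c, _⟩ := fold_edge_southwest h (by linarith)
    obtain ⟨c', _⟩ := fold_edge_southwest h' (by linarith)
    obtain ⟨e1, e2⟩ := fold_eq_of_snd_le h c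
    obtain ⟨e1', e2'⟩ := fold_eq_of_snd_le h' c'
    constructor <;> linarith
  · rcases fold_edge_north h (by linarith) with ⟨c, _⟩ | ⟨c, d, _⟩ <;>
      rcases fold_edge_north h' (by linarith) with ⟨c', _⟩ | ⟨c', d', _⟩
    · obtain ⟨e1, e2⟩ := fold_eq_of_fst_le h c
      obtain ⟨e1', e2'⟩ := fold_eq_of_fst_le h' c'
      constructor <;> linarith
    · obtain ⟨e1, e2⟩ := fold_eq_of_fst_le h c
      obtain ⟨e1', e2'⟩ := fold_eq_of_fst_le_snd c' d'
      constructor <;> linarith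
    · obtain ⟨e1, e2⟩ := fold_eq_of_fst_le_snd c d
      obtain ⟨e1', e2'⟩ := fold_eq_of_fst_le h' c'
      constructor <;> linarith
    · obtain ⟨e1, e2⟩ := fold_eq_of_fst_le_snd c d
      obtain ⟨e1', e2'⟩ := fold_eq_of_fst_le_snd c' d'
      constructor <;> linarith
  · obtain ⟨c, _⟩ := fold_edge_south h (by linarith)
    obtain ⟨c', _⟩ := fold_edge_south h' (by linarith)
    obtain ⟨e1, e2⟩ := fold_eq_of_snd_le h c
    obtain ⟨e1', e2'⟩ := fold_eq_of_snd_le h' c'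
    constructor <;> linarith
  · linarith [foldFst_sub_lt h]
  · obtain ⟨c, _⟩ := fold_edge_northwest h (by linarith)
    obtain ⟨c', _⟩ := fold_edge_northwest h' (by linarith)
    obtain ⟨e1, e2⟩ := fold_eq_of_fst_le h c
    obtain ⟨e1', e2'⟩ := fold_eq_of_fst_le h' c'
    constructor <;> linarith

theorem exists_int_add_inHexagon (x y : ℝ) : ∃ m n : ℤ, InHexagon (x - m) (y - n) := by
  obtain ⟨m, hm1, hm2⟩ := exists_int_add_mem_Icc (-(1 / 2)) x
  obtain ⟨n, hn1, hn2⟩ := exists_int_add_mem_Icc (-(1 / 2)) y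
  have key : ∀ u w : ℝ, -(1 / 2) ≤ u → u ≤ 1 / 2 → -(1 / 2) ≤ w → w ≤ 1 / 2 → w ≤ u →
      InHexagon u w ∨ InHexagon (u - 1) w ∨ InHexagon u (w + 1) := by
    intro u w h1 h2 h3 h4 h5
    by_cases c1 : 4 * u + w ≤ 2
    · by_cases c2 : -2 ≤ u + 4 * w
      · left; refine ⟨⟨?_, ?_⟩, ⟨?_, ?_⟩, ?_, ?_⟩ <;> linarith
      · right; right; refine ⟨⟨?_, ?_⟩, ⟨?_, ?_⟩, ?_, ?_⟩ <;> linarith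
    · right; left; refine ⟨⟨?_, ?_⟩, ⟨?_, ?_⟩, ?_, ?_⟩ <;> linarith
  rcases le_total (y + n) (x + m) with hle | hle
  · rcases key (x + m) (y + n) hm1 (by linarith) hn1 (by linarith) hle with H | H | H
    · exact ⟨-m, -n, by simpa using H⟩
    · exact ⟨-m + 1, -n, by convert H using 1 <;> push_cast <;> ring⟩
    · exact ⟨-m, -n - 1, by convert H using 1 <;> push_cast <;> ring⟩
  · rcases key (-(x + m)) (-(y + n)) (by linarith) (by linarith) (by linarith) (by linarith)
      (by linarith) with H | H | H
    · exact ⟨-m, -n, by convert H.neg using 1 <;> push_cast <;> ring⟩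
    · exact ⟨-m - 1, -n, by convert H.neg using 1 <;> push_cast <;> ring⟩
    · exact ⟨-m, -n + 1, by convert H.neg using 1 <;> push_cast <;> ring⟩

end Hexagon

section LocalLipschitz

theorem norm_sub_le_of_eventually {E F : Type*} [NormedAddCommGroup E] [NormedSpace ℝ E]
    [NormedAddCommGroup F] {f : E → F} {ν : E → ℝ} {k : ℝ}
    (hν : ∀ (t : ℝ) x, 0 ≤ t → ν (t • x) = t * ν x)
    (hf : Continuous f) (h : ∀ p, ∀ᶠ q in 𝓝 p, ‖f q - f p‖ ≤ k * ν (q - p)) (x y : E) :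
    ‖f y - f x‖ ≤ k * ν (y - x) := by
  set γ : ℝ → E := fun t => x + t • (y - x) with hγ
  have hγc : Continuous γ := by fun_prop
  set S : Set ℝ := {t | ‖f (γ t) - f x‖ ≤ k * (t * ν (y - x))} with hS
  have hcl : IsClosed (S ∩ Set.Icc 0 1) := by
    refine IsClosed.inter (isClosed_le ?_ ?_) isClosed_Icc <;> fun_prop
  have h0 : (0 : ℝ) ∈ S := by simp [hS, hγ]
  have hsub : Set.Icc (0 : ℝ) 1 ⊆ S := by
    refine hcl.Icc_subset_of_forall_exists_gt h0 fun t ht z hz => ?_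
    have h1 : ∀ᶠ s in 𝓝 t, ‖f (γ s) - f (γ t)‖ ≤ k * ν (γ s - γ t) :=
      hγc.continuousAt.eventually (h (γ t))
    have h2 : ∀ᶠ s in 𝓝[>] t, s ∈ Set.Ioc t z := Ioc_mem_nhdsGT hz
    obtain ⟨s, hs1, hs2⟩ := ((h1.filter_mono nhdsWithin_le_nhds).and h2).exists
    refine ⟨s, ?_, hs2⟩
    have e : γ s - γ t = (s - t) • (y - x) := by simp only [hγ]; module
    rw [e, hν _ _ (by linarith [hs2.1])] at hs1
    have ht' : ‖f (γ t) - f x‖ ≤ k * (t * ν (y - x)) := ht.1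
    calc ‖f (γ s) - f x‖ ≤ ‖f (γ s) - f (γ t)‖ + ‖f (γ t) - f x‖ := by
          have := norm_add_le (f (γ s) - f (γ t)) (f (γ t) - f x)
          simpa using this
      _ ≤ k * ((s - t) * ν (y - x)) + k * (t * ν (y - x)) := add_le_add hs1 ht'
      _ = k * (s * ν (y - x)) := by ring
  have := hsub (Set.right_mem_Icc.2 zero_le_one)
  simpa [hS, hγ] using this

theorem norm_map_sub_sq_le_of_eventually {E F : Type*} [NormedAddCommGroup E] [NormedSpace ℝ E]
    [FiniteDimensional ℝ E] [NormedAddCommGroup F] [NormedSpace ℝ F] {L : E →ₗ[ℝ] F}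
    {Φ : E → E} {K : ℝ} (hK : 0 ≤ K)
    (h : ∀ p, ∀ᶠ q in 𝓝 p, ‖L (Φ q - Φ p)‖ ^ 2 ≤ K * ‖L (q - p)‖ ^ 2) (x y : E) :
    ‖L (Φ x - Φ y)‖ ^ 2 ≤ K * ‖L (x - y)‖ ^ 2 := by
  have hLc : Continuous L := L.continuous_of_finiteDimensional
  have h' : ∀ p, ∀ᶠ q in 𝓝 p, ‖L (Φ q) - L (Φ p)‖ ≤ √K * ‖L (q - p)‖ := fun p => by
    filter_upwards [h p] with q hq
    rw [← map_sub]
    refine le_of_sq_le_sq ?_ (by positivity)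
    rwa [mul_pow, Real.sq_sqrt hK]
  have hcont : Continuous fun p => L (Φ p) := by
    refine continuous_iff_continuousAt.2 fun p => ?_
    refine tendsto_iff_norm_sub_tendsto_zero.2 (squeeze_zero' (.of_forall fun _ => norm_nonneg _)
      (h' p) ?_)
    have : Continuous fun q => √K * ‖L (q - p)‖ := by fun_prop
    simpa using this.tendsto p
  have := norm_sub_le_of_eventually (f := fun p => L (Φ p)) (ν := fun v => ‖L v‖) (k := √K)
    (fun t x ht => by rw [map_smul, norm_smul, Real.norm_of_nonneg ht]) hcont h' y x
  calc ‖L (Φ x - Φ y)‖ ^ 2 ≤ (√K * ‖L (x - y)‖) ^ 2 := by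
        rw [map_sub]; gcongr
    _ = K * ‖L (x - y)‖ ^ 2 := by rw [mul_pow, Real.sq_sqrt hK]

end LocalLipschitz

section Twindragon

/-- The graph of the equivariant extension of the contraction of the hexagon to the plane. -/
def IsFold (p w : ℝ × ℝ) : Prop :=
  ∃ m n : ℤ,
    (InHexagon (p.1 - p.2 - (m - 2 * n)) (p.2 - m) ∧
      w.1 - w.2 = foldFst (p.1 - p.2 - (m - 2 * n)) (p.2 - m) + (m - n) ∧
      w.2 = foldSnd (p.1 - p.2 - (m - 2 * n)) (p.2 - m) + n) ∨
    (InHexagon (1 - (p.1 - p.2 - (m - 2 * n))) (-(p.2 - m)) ∧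
      w.1 - w.2 = -foldFst (1 - (p.1 - p.2 - (m - 2 * n))) (-(p.2 - m)) + (m - n) ∧
      w.2 = -foldSnd (1 - (p.1 - p.2 - (m - 2 * n))) (-(p.2 - m)) + n)

theorem exists_isFold (p : ℝ × ℝ) : ∃ w, IsFold p w := by
  obtain ⟨M, N, h⟩ := exists_int_add_inHexagon (p.1 - p.2) p.2
  rcases Int.even_or_odd' (N - M) with ⟨n, hn | hn⟩
  · have e : (M : ℝ) = N - 2 * n := by
      have : M = N - 2 * n := by omega
      exact_mod_cast this
    rw [e] at h
    exact ⟨(_ + (N - n) + (_ + n), _ + n), N, n, .inl ⟨h, add_sub_cancel_right _ _, rfl⟩⟩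
  · have e : (M : ℝ) = N - 2 * (n + 1 : ℤ) + 1 := by
      have : M = N - 2 * (n + 1) + 1 := by omega
      exact_mod_cast this
    have h' := h.neg
    rw [e, show -(p.1 - p.2 - ((N : ℝ) - 2 * (n + 1 : ℤ) + 1)) =
      1 - (p.1 - p.2 - ((N : ℝ) - 2 * (n + 1 : ℤ))) by ring] at h'
    exact ⟨(-_ + (N - (n + 1 : ℤ)) + (-_ + (n + 1 : ℤ)), -_ + (n + 1 : ℤ)), N, n + 1,
      .inr ⟨h', add_sub_cancel_right _ _, rfl⟩⟩

theorem IsFold.unique {p w w' : ℝ × ℝ} (h : IsFold p w) (h' : IsFold p w') : w = w' := by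
  obtain ⟨m, n, h⟩ := h
  obtain ⟨m', n', h'⟩ := h'
  suffices H : w.1 - w.2 = w'.1 - w'.2 ∧ w.2 = w'.2 from Prod.ext (by linarith) H.2
  rcases h with ⟨h, e1, e2⟩ | ⟨h, e1, e2⟩ <;> rcases h' with ⟨h', e1', e2'⟩ | ⟨h', e1', e2'⟩
  · have := fold_sub_eq h h' (m := m' - n' - (m - n)) (n := n' - n) (by push_cast; ring)
      (by push_cast; ring)
    push_cast at this
    constructor <;> linarith
  · have := fold_add_eq h h' (m := m' - n' - (m - n)) (n := n' - n) (by push_cast; ring)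
      (by push_cast; ring)
    push_cast at this
    constructor <;> linarith
  · have := fold_add_eq h' h (m := m - n - (m' - n')) (n := n - n') (by push_cast; ring)
      (by push_cast; ring)
    push_cast at this
    constructor <;> linarith
  · have := fold_sub_eq h' h (m := m' - n' - (m - n)) (n := n' - n) (by push_cast; ring)
      (by push_cast; ring)
    push_cast at this
    constructor <;> linarith

theorem IsFold.injective {p p' w : ℝ × ℝ} (h : IsFold p w) (h' : IsFold p' w) : p = p' := by
  obtain ⟨m, n, h⟩ := h
  obtain ⟨m', n', h'⟩ := h'
  suffices H : p.1 - p.2 = p'.1 - p'.2 ∧ p.2 = p'.2 from Prod.ext (by linarith) H.2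
  rcases h with ⟨h, e1, e2⟩ | ⟨h, e1, e2⟩ <;> rcases h' with ⟨h', e1', e2'⟩ | ⟨h', e1', e2'⟩
  · have := sub_eq_of_fold_sub_eq h h' (m := m' - n' - (m - n)) (n := n' - n)
      (by push_cast; linarith) (by push_cast; linarith)
    push_cast at this
    constructor <;> linarith
  · have := add_eq_of_fold_add_eq h h' (m := m' - n' - (m - n)) (n := n' - n)
      (by push_cast; linarith) (by push_cast; linarith)
    push_cast at this
    constructor <;> linarith
  · have := add_eq_of_fold_add_eq h' h (m := m - n - (m' - n')) (n := n - n')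
      (by push_cast; linarith) (by push_cast; linarith)
    push_cast at this
    constructor <;> linarith
  · have := sub_eq_of_fold_sub_eq h' h (m := m' - n' - (m - n)) (n := n' - n)
      (by push_cast; linarith) (by push_cast; linarith)
    push_cast at this
    constructor <;> linarith

theorem IsFold.add_lattice {p w : ℝ × ℝ} (h : IsFold p w) (m n : ℤ) :
    IsFold (p.1 + (2 * m - 2 * n), p.2 + m) (w + ((m : ℝ), (n : ℝ))) := by
  obtain ⟨m', n', h⟩ := h
  refine ⟨m' + m, n' + n, ?_⟩
  have e1 : p.1 + (2 * m - 2 * n) - (p.2 + m) - ((m' + m : ℤ) - 2 * (n' + n : ℤ)) =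
    p.1 - p.2 - ((m' : ℝ) - 2 * n') := by push_cast; ring
  have e2 : p.2 + m - (m' + m : ℤ) = p.2 - (m' : ℝ) := by push_cast; ring
  dsimp only [Prod.fst_add, Prod.snd_add]
  rw [e1, e2]
  push_cast
  refine h.imp ?_ ?_ <;> exact fun ⟨h, h1, h2⟩ => ⟨h, by linarith, by linarith⟩

/-- The translates of the sectors of the hexagon, rotated by a half turn when `ε = -1`. -/
def hexagonSector (c : ℝ) (ε : ℝ) (i : Fin 4 × ℤ × ℤ) : Set (ℝ × ℝ) :=
  {p | InHexagon (c + ε * (p.1 - p.2 - (i.2.1 - 2 * i.2.2))) (ε * (p.2 - i.2.1)) ∧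
    (c + ε * (p.1 - p.2 - (i.2.1 - 2 * i.2.2)), ε * (p.2 - i.2.1)) ∈ sector i.1}

theorem isClosed_setOf_inHexagon : IsClosed {p : ℝ × ℝ | InHexagon p.1 p.2} := by
  have h : {p : ℝ × ℝ | InHexagon p.1 p.2} =
      (fun p : ℝ × ℝ => (4 * p.1 + p.2, p.1 + 4 * p.2, p.1 - p.2)) ⁻¹'
        (Set.Icc (-2) 2 ×ˢ Set.Icc (-2) 2 ×ˢ Set.Icc (-1) 1) := rfl
  rw [h]
  exact (isClosed_Icc.prod (isClosed_Icc.prod isClosed_Icc)).preimage (by fun_prop)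

theorem isClosed_sector (k : Fin 4) : IsClosed (sector k) := by
  fin_cases k
  · exact isClosed_le (by fun_prop) (by fun_prop)
  · exact (isClosed_le continuous_const continuous_fst).inter (isClosed_le continuous_fst continuous_snd)
  · exact (isClosed_le continuous_const continuous_snd).inter
      (isClosed_le continuous_snd continuous_fst)
  · exact isClosed_le (by fun_prop) (by fun_prop)

theorem isClosed_hexagonSector (c ε : ℝ) (i : Fin 4 × ℤ × ℤ) : IsClosed (hexagonSector c ε i) :=
  (isClosed_setOf_inHexagon.inter (isClosed_sector i.1)).preimage
    (f := fun p : ℝ × ℝ => (c + ε * (p.1 - p.2 - (i.2.1 - 2 * i.2.2)), ε * (p.2 - i.2.1)))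
    (by fun_prop)

theorem locallyFinite_hexagonSector (c : ℝ) {ε : ℝ} (hε : ε = 1 ∨ ε = -1) :
    LocallyFinite (hexagonSector c ε) := by
  intro p
  refine ⟨Metric.ball p 1, Metric.ball_mem_nhds _ one_pos, ?_⟩
  have hfin : ((Set.univ : Set (Fin 4)) ×ˢ (Set.Icc ⌊p.2 - 3⌋ ⌈p.2 + 3⌉ ×ˢ
      Set.Icc ⌊-|c| - |p.1| - |p.2| - 10⌋ ⌈|c| + |p.1| + |p.2| + 10⌉)).Finite :=
    Set.finite_univ.prod ((Set.finite_Icc _ _).prod (Set.finite_Icc _ _))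
  refine hfin.subset ?_
  rintro ⟨k, m, n⟩ ⟨q, ⟨hq, -⟩, hqp⟩
  obtain ⟨⟨h1, h2⟩, ⟨h3, h4⟩, h5, h6⟩ := hq
  rw [Metric.mem_ball, Prod.dist_eq, max_lt_iff, Real.dist_eq, Real.dist_eq, abs_lt, abs_lt] at hqp
  obtain ⟨⟨g1, g2⟩, g3, g4⟩ := hqp
  have c1 := neg_abs_le c
  have c2 := le_abs_self c
  have p1 := neg_abs_le p.1
  have p2 := le_abs_self p.1
  have q1 := neg_abs_le p.2
  have q2 := le_abs_self p.2
  dsimp only at h1 h2 h3 h4 h5 h6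
  refine ⟨Set.mem_univ _, ⟨?_, ?_⟩, ?_, ?_⟩
  · have : p.2 - 3 ≤ m := by rcases hε with rfl | rfl <;> linarith
    exact_mod_cast (Int.floor_le _).trans this
  · have : (m : ℝ) ≤ p.2 + 3 := by rcases hε with rfl | rfl <;> linarith
    exact_mod_cast this.trans (Int.le_ceil _)
  · have : -|c| - |p.1| - |p.2| - 10 ≤ n := by rcases hε with rfl | rfl <;> linarith
    exact_mod_cast (Int.floor_le _).trans this
  · have : (n : ℝ) ≤ |c| + |p.1| + |p.2| + 10 := by rcases hε with rfl | rfl <;> linarith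
    exact_mod_cast this.trans (Int.le_ceil _)

theorem eventually_isFold_contraction {Φ : ℝ × ℝ → ℝ × ℝ} (hΦ : ∀ p, IsFold p (Φ p))
    (p : ℝ × ℝ) : ∀ᶠ q in 𝓝 p,
      5 * ((Φ q - Φ p).1 - (Φ q - Φ p).2) ^ 2
          - 3 * ((Φ q - Φ p).1 - (Φ q - Φ p).2) * (Φ q - Φ p).2 + 4 * (Φ q - Φ p).2 ^ 2 ≤
        93 / 100 * (5 * ((q - p).1 - (q - p).2) ^ 2
          - 3 * ((q - p).1 - (q - p).2) * (q - p).2 + 4 * (q - p).2 ^ 2) := by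
  filter_upwards [(locallyFinite_hexagonSector 0 (.inl rfl)).eventually_subset
    (isClosed_hexagonSector _ _) p, (locallyFinite_hexagonSector 1 (.inr rfl)).eventually_subset
    (isClosed_hexagonSector _ _) p] with q hq1 hq2
  obtain ⟨m, n, ⟨h, e1, e2⟩ | ⟨h, e1, e2⟩⟩ := hΦ q
  · obtain ⟨k, hk⟩ := exists_mem_sector (q.1 - q.2 - (m - 2 * n)) (q.2 - m)
    obtain ⟨h', hk'⟩ : p ∈ hexagonSector 0 1 (k, m, n) := hq1 <| by
      simpa only [Set.mem_ofPred_eq, hexagonSector, zero_add, one_mul] using ⟨h, hk⟩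
    simp only [zero_add, one_mul] at h' hk'
    have := (hΦ p).unique (w' := (foldFst (p.1 - p.2 - (m - 2 * n)) (p.2 - m) + (m - n) +
      (foldSnd (p.1 - p.2 - (m - 2 * n)) (p.2 - m) + n),
      foldSnd (p.1 - p.2 - (m - 2 * n)) (p.2 - m) + n))
      ⟨m, n, .inl ⟨h', add_sub_cancel_right _ _, rfl⟩⟩
    have f1 : (Φ p).1 - (Φ p).2 = foldFst (p.1 - p.2 - (m - 2 * n)) (p.2 - m) + (m - n) := by
      rw [this]; ring
    have f2 : (Φ p).2 = foldSnd (p.1 - p.2 - (m - 2 * n)) (p.2 - m) + n := by rw [this]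
    convert fold_contraction h h' hk hk' using 1
    · have g1 : (Φ q - Φ p).1 - (Φ q - Φ p).2 = ((Φ q).1 - (Φ q).2) - ((Φ p).1 - (Φ p).2) := by
        simp only [Prod.fst_sub, Prod.snd_sub]; ring
      rw [g1, Prod.snd_sub, e1, f1, e2, f2]
      ring
    · simp only [Prod.fst_sub, Prod.snd_sub]; ring
  · obtain ⟨k, hk⟩ := exists_mem_sector (1 - (q.1 - q.2 - (m - 2 * n))) (-(q.2 - m))
    obtain ⟨h', hk'⟩ : p ∈ hexagonSector 1 (-1) (k, m, n) := hq2 <| by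
      simpa only [Set.mem_ofPred_eq, hexagonSector, neg_one_mul, ← sub_eq_add_neg] using ⟨h, hk⟩
    simp only [neg_one_mul, ← sub_eq_add_neg] at h' hk'
    have := (hΦ p).unique (w' := (-foldFst (1 - (p.1 - p.2 - (m - 2 * n))) (-(p.2 - m)) + (m - n) +
      (-foldSnd (1 - (p.1 - p.2 - (m - 2 * n))) (-(p.2 - m)) + n),
      -foldSnd (1 - (p.1 - p.2 - (m - 2 * n))) (-(p.2 - m)) + n))
      ⟨m, n, .inr ⟨h', add_sub_cancel_right _ _, rfl⟩⟩
    have f1 : (Φ p).1 - (Φ p).2 =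
        -foldFst (1 - (p.1 - p.2 - (m - 2 * n))) (-(p.2 - m)) + (m - n) := by
      rw [this]; ring
    have f2 : (Φ p).2 = -foldSnd (1 - (p.1 - p.2 - (m - 2 * n))) (-(p.2 - m)) + n := by rw [this]
    convert fold_contraction h h' hk hk' using 1
    · have g1 : (Φ q - Φ p).1 - (Φ q - Φ p).2 = ((Φ q).1 - (Φ q).2) - ((Φ p).1 - (Φ p).2) := by
        simp only [Prod.fst_sub, Prod.snd_sub]; ring
      rw [g1, Prod.snd_sub, e1, f1, e2, f2]
      ring
    · simp only [Prod.fst_sub, Prod.snd_sub]; ring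

theorem InHexagon.isFold {x y : ℝ} (h : InHexagon x y) :
    IsFold (x + y, y) (foldFst x y + foldSnd x y, foldSnd x y) := by
  refine ⟨0, 0, .inl ?_⟩
  have e : x + y - y - ((0 : ℤ) - 2 * (0 : ℤ)) = x := by push_cast; ring
  dsimp only
  rw [e]
  simpa using h

theorem InHexagon.isFold_add_digit {x y : ℝ} (h : InHexagon x y) :
    IsFold (1 - x - y, -y) (-foldFst x y - foldSnd x y, -foldSnd x y) := by
  refine ⟨0, 0, .inr ?_⟩
  have e : 1 - (1 - x - y - -y - ((0 : ℤ) - 2 * (0 : ℤ))) = x := by push_cast; ring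
  dsimp only
  rw [e]
  simpa using h

theorem IsFold.norm_sub_le {x s : ℝ} {w : ℝ × ℝ} (h : IsFold (x, s) w) :
    ‖w - (s, (2 * s - x) / 2)‖ ≤ 6 := by
  rw [Prod.norm_def, max_le_iff, Real.norm_eq_abs, Real.norm_eq_abs, abs_le, abs_le,
    Prod.fst_sub, Prod.snd_sub]
  dsimp only
  obtain ⟨m, n, ⟨h, e1, e2⟩ | ⟨h, e1, e2⟩⟩ := h <;> obtain ⟨⟨g1, g2⟩, ⟨g3, g4⟩, g5, g6⟩ := h.fold <;>
    obtain ⟨⟨h1, h2⟩, ⟨h3, h4⟩, h5, h6⟩ := h <;> dsimp only at * <;>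
    refine ⟨⟨?_, ?_⟩, ?_, ?_⟩ <;> linarith

theorem convex_setOf_inHexagon : Convex ℝ {p : ℝ × ℝ | InHexagon (p.1 - p.2) p.2} := by
  rintro p ⟨⟨h1, h2⟩, ⟨h3, h4⟩, h5, h6⟩ q ⟨⟨g1, g2⟩, ⟨g3, g4⟩, g5, g6⟩ a b ha hb hab
  have key : ∀ {l u s t : ℝ}, l ≤ s → s ≤ u → l ≤ t → t ≤ u →
      l ≤ a * s + b * t ∧ a * s + b * t ≤ u := fun {l u s t} h1 h2 h3 h4 => by
    obtain rfl : b = 1 - a := by linarith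
    constructor <;> nlinarith
  have k1 := key h1 h2 g1 g2
  have k2 := key h3 h4 g3 g4
  have k3 := key h5 h6 g5 g6
  refine ⟨⟨?_, ?_⟩, ⟨?_, ?_⟩, ?_, ?_⟩ <;> simp only [Prod.fst_add, Prod.snd_add, Prod.smul_fst,
    Prod.smul_snd, smul_eq_mul] <;> linarith

theorem isCompact_setOf_inHexagon : IsCompact {p : ℝ × ℝ | InHexagon (p.1 - p.2) p.2} := by
  refine ((isCompact_Icc (a := (-2 : ℝ)) (b := 2)).prod
    (isCompact_Icc (a := (-2 : ℝ)) (b := 2))).of_isClosed_subset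
    (isClosed_setOf_inHexagon.preimage (f := fun p : ℝ × ℝ => (p.1 - p.2, p.2)) (by fun_prop)) ?_
  rintro p ⟨⟨h1, h2⟩, ⟨h3, h4⟩, h5, h6⟩
  exact ⟨⟨by linarith, by linarith⟩, by linarith, by linarith⟩

theorem zero_mem_interior_setOf_inHexagon :
    (0 : ℝ × ℝ) ∈ interior {p : ℝ × ℝ | InHexagon (p.1 - p.2) p.2} := by
  rw [mem_interior_iff_mem_nhds]
  refine Filter.mem_of_superset (Metric.ball_mem_nhds _ (by norm_num : (0 : ℝ) < 1 / 10)) ?_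
  intro p hp
  rw [Metric.mem_ball, dist_zero_right, Prod.norm_def, max_lt_iff, Real.norm_eq_abs,
    Real.norm_eq_abs, abs_lt, abs_lt] at hp
  obtain ⟨⟨g1, g2⟩, g3, g4⟩ := hp
  refine ⟨⟨?_, ?_⟩, ⟨?_, ?_⟩, ?_, ?_⟩ <;> linarith

theorem IsCollinearTile.nonempty_homeomorph_closedBall_of_two {T : Set (ℝ × ℝ)}
    (hT : IsCollinearTile 2 2 T ∨ IsCollinearTile (-2) 2 T) :
    Nonempty (T ≃ₜ Metric.closedBall (0 : EuclideanSpace ℝ (Fin 2)) 1) := by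
  choose Φ hΦ using exists_isFold
  have hτ : (-(13 / 10) : ℝ) ^ 2 < 4 * (3 / 5) := by norm_num
  have hL := formMap_injective (q := 0) hτ (two_ne_zero)
  have hform : ∀ p : ℝ × ℝ, ‖formMap (-(13 / 10)) (3 / 5) 2 0 p‖ ^ 2 =
      1 / 5 * (5 * (p.1 - p.2) ^ 2 - 3 * (p.1 - p.2) * p.2 + 4 * p.2 ^ 2) := fun p => by
    rw [norm_formMap_sq hτ]; ring
  refine IsCollinearTile.nonempty_homeomorph_closedBall_of_conj (a := 2) (b := 2) (by norm_num) hT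
    hL (K := 93 / 100) (R := 6) (by norm_num) (by norm_num) (Φ := Φ)
    (norm_map_sub_sq_le_of_eventually (by norm_num) fun p => ?_) ?_ ?_ ?_
    (Q := {p | InHexagon (p.1 - p.2) p.2}) ?_ ?_ ?_ (c := 0) ?_ ?_ ?_
  · filter_upwards [eventually_isFold_contraction hΦ p] with q hq
    rw [hform, hform]
    linarith
  · intro p p' h
    exact (hΦ p).injective (h ▸ hΦ p')
  · intro x s
    exact_mod_cast (hΦ (x, s)).norm_sub_le
  · intro x s m n
    have h := (hΦ (x, s)).add_lattice m n
    exact_mod_cast (hΦ _).unique h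
  · exact isCompact_setOf_inHexagon
  · exact convex_setOf_inHexagon
  · exact ⟨0, zero_mem_interior_setOf_inHexagon⟩
  · intro p hp
    have := InHexagon.neg hp
    show InHexagon _ _
    convert this using 1 <;> simp
    ring
  · intro p hp
    obtain ⟨x, y, h, ⟨e1, e2⟩ | ⟨e1, e2⟩⟩ := exists_fold_eq hp
    · refine ⟨(x + y, y), ?_, 0, ⟨0, le_rfl, by norm_num, Prod.ext (by simp) (by simp)⟩, ?_⟩
      · show InHexagon (x + y - y) y
        rwa [add_sub_cancel_right]
      · rw [add_zero, (hΦ _).unique h.isFold, e1, e2]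
        simp
    · refine ⟨(-x - y, -y), ?_, (1, 0), ⟨1, by norm_num, by norm_num, by simp⟩, ?_⟩
      · show InHexagon (-x - y - -y) (-y)
        convert h.neg using 1
        ring
      · have : ((-x - y, -y) : ℝ × ℝ) + (1, 0) = (1 - x - y, -y) := by
          ext <;> simp
          ring
        rw [this, (hΦ _).unique h.isFold_add_digit, e1, e2]
        simp
  · rintro ⟨u, s⟩ hy d ⟨j, hj0, hj2, rfl⟩
    have h : InHexagon (u - s) s := hy
    obtain rfl | rfl : j = 0 ∨ j = 1 := by omega
    · have e : ((u, s) : ℝ × ℝ) + (((0 : ℤ) : ℝ), 0) = (u - s + s, s) := by simp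
      rw [e, (hΦ _).unique h.isFold]
      show InHexagon (_ + _ - _) _
      rw [add_sub_cancel_right]
      exact h.fold
    · have e : ((u, s) : ℝ × ℝ) + (((1 : ℤ) : ℝ), 0) = (1 - -(u - s) - -s, - -s) := by
        ext <;> simp
        ring
      rw [e, (hΦ _).unique h.neg.isFold_add_digit]
      show InHexagon (_ - _ - -_) _
      rw [sub_neg_eq_add, sub_add_cancel]
      exact h.neg.fold.neg

end Twindragon

section Transfer

theorem isCollinearTile_preimage {A B : ℤ} {T : Set (Fin 2 → ℝ)} (hTne : T.Nonempty)
    (hTcp : IsCompact T) {N : Matrix (Fin 2) (Fin 2) ℝ} {v : Fin 2 → ℝ}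
    (hT : N.mulVec '' T = ⋃ j ∈ Set.Icc (0 : ℤ) (B - 1), (fun x => x + (j : ℝ) • v) '' T)
    (f : (ℝ × ℝ) ≃L[ℝ] (Fin 2 → ℝ)) (hfv : f (1, 0) = v)
    (hf : ∀ x s : ℝ, N.mulVec (f (x, s)) = f (((-A : ℤ) : ℝ) * x - B * s, x)) :
    IsCollinearTile (-A) B (f ⁻¹' T) := by
  have hadd : ∀ (y : ℝ × ℝ) (j : ℤ), f (y + ((j : ℝ), 0)) = f y + (j : ℝ) • v := fun y j => by
    rw [map_add, ← hfv, ← map_smul]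
    simp
  refine ⟨hTne.preimage f.surjective, f.toHomeomorph.isCompact_preimage.2 hTcp, ?_, ?_⟩
  · rintro ⟨x, s⟩ hx
    have h : N.mulVec (f (x, s)) ∈ N.mulVec '' T := ⟨_, hx, rfl⟩
    rw [hT] at h
    simp only [Set.mem_iUnion, Set.mem_image, Set.mem_Icc, exists_prop] at h
    obtain ⟨j, ⟨hj0, hj1⟩, y, hy, e⟩ := h
    refine ⟨f.symm y, by simpa using hy, j, hj0, by omega, f.injective ?_⟩
    rw [← hf, ← e, hadd, f.apply_symm_apply]
  · intro y hy j hj0 hj1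
    have h : f y + (j : ℝ) • v ∈ N.mulVec '' T := by
      rw [hT]
      simp only [Set.mem_iUnion, Set.mem_image, Set.mem_Icc, exists_prop]
      exact ⟨j, ⟨hj0, by omega⟩, f y, hy, rfl⟩
    obtain ⟨z, hz, e⟩ := h
    refine ⟨f.symm z, by simpa using hz, f.injective ?_⟩
    rw [hadd, ← e, ← hf]
    simp

theorem exists_equiv_mulVec_eq {A B : ℤ} {M : Matrix (Fin 2) (Fin 2) ℤ}
    (hchar : M.charpoly = X ^ 2 + C A * X + C B) {v : Fin 2 → ℝ}
    (hindep : LinearIndependent ℝ ![v, (M.map (Int.cast : ℤ → ℝ)).mulVec v]) :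
    ∃ f : (ℝ × ℝ) ≃L[ℝ] (Fin 2 → ℝ), f (1, 0) = v ∧ ∀ x s : ℝ,
      (M.map (Int.cast : ℤ → ℝ)).mulVec (f (x, s)) = f (((-A : ℤ) : ℝ) * x - B * s, x) := by
  set N := M.map (Int.cast : ℤ → ℝ) with hN
  have hCH : N * N = -(A : ℝ) • N - (B : ℝ) • (1 : Matrix (Fin 2) (Fin 2) ℝ) := by
    have h := M.aeval_self_charpoly
    rw [hchar] at h
    simp only [map_add, map_mul, map_pow, aeval_X, aeval_C] at h
    have h' := congrArg (Int.castRingHom ℝ).mapMatrix h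
    have e : (Int.castRingHom ℝ).mapMatrix M = N := rfl
    simp only [map_add, map_mul, map_pow, map_zero, e, eq_intCast, map_intCast] at h'
    rw [← Matrix.diagonal_intCast, ← Matrix.diagonal_intCast] at h'
    have hA : ∀ c : ℝ, Matrix.diagonal (fun _ : Fin 2 => c) = c • 1 := fun c => by
      rw [Matrix.smul_one_eq_diagonal]
    have h'' : N * N + (A : ℝ) • N + (B : ℝ) • (1 : Matrix (Fin 2) (Fin 2) ℝ) = 0 := by
      simpa [hA, sq] using h'
    rw [add_assoc, add_eq_zero_iff_eq_neg] at h''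
    rw [h'']
    module
  set u : Fin 2 → ℝ := N.mulVec v + (A : ℝ) • v with hu
  let g : (ℝ × ℝ) →ₗ[ℝ] (Fin 2 → ℝ) :=
    (LinearMap.fst ℝ ℝ ℝ).smulRight v + (LinearMap.snd ℝ ℝ ℝ).smulRight u
  have hg : ∀ x s, g (x, s) = x • v + s • u := fun x s => rfl
  have hinj : Function.Injective g := by
    rw [injective_iff_map_eq_zero]
    rintro ⟨x, s⟩ h
    rw [hg, hu] at h
    have := LinearIndependent.pair_iff.1 hindep (x + s * A) s (by rw [← h]; module)
    obtain ⟨h1, rfl⟩ := this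
    simpa using h1
  let f : (ℝ × ℝ) ≃L[ℝ] (Fin 2 → ℝ) :=
    (LinearEquiv.ofInjectiveOfFinrankEq g hinj (by simp)).toContinuousLinearEquiv
  have hf : ∀ x s, f (x, s) = x • v + s • u := fun x s => rfl
  refine ⟨f, by simp [hf], fun x s => ?_⟩
  have hNN : N.mulVec (N.mulVec v) = -(A : ℝ) • N.mulVec v - (B : ℝ) • v := by
    rw [Matrix.mulVec_mulVec, hCH, Matrix.sub_mulVec, Matrix.smul_mulVec, Matrix.smul_mulVec,
      Matrix.one_mulVec]
  rw [hf, hf, hu, Matrix.mulVec_add, Matrix.mulVec_smul, Matrix.mulVec_smul, Matrix.mulVec_add,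
    Matrix.mulVec_smul, hNN]
  push_cast
  module

theorem IsCollinearTile.nonempty_homeomorph_closedBall {a b : ℤ} (hab : |a| ≤ b) (hb : 2 ≤ b)
    (h : 2 * |a| ≤ b + 2) {T : Set (ℝ × ℝ)} (hT : IsCollinearTile a b T) :
    Nonempty (T ≃ₜ Metric.closedBall (0 : EuclideanSpace ℝ (Fin 2)) 1) := by
  have hT' : IsCollinearTile |a| b T ∨ IsCollinearTile (-|a|) b T := by
    rcases abs_choice a with h | h <;> rw [h]
    · exact .inl hT
    · exact .inr (by rwa [neg_neg])
  have h0 := abs_nonneg a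
  rcases h0.eq_or_lt with h0 | h0
  · rw [abs_eq_zero.1 h0.symm] at hT
    exact IsCollinearTile.nonempty_homeomorph_closedBall_of_eq_zero hb hT
  by_cases h2 : |a| = 2 ∧ b = 2
  · rw [h2.1, h2.2] at hT'
    exact IsCollinearTile.nonempty_homeomorph_closedBall_of_two hT'
  · exact IsCollinearTile.nonempty_homeomorph_closedBall_of_pos (by omega) hT'

end Transfer

/-- If `2|A| ≤ B + 2`, the self-affine tile `T` with collinear
digit set is homeomorphic to the closed unit disk. -/
theorem tile_disklike_of_two_abs_le
    (A B : ℤ) (hAB : |A| ≤ B) (hB : 2 ≤ B)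
    (M : Matrix (Fin 2) (Fin 2) ℤ)
    (hchar : M.charpoly = X ^ 2 + C A * X + C B)
    (v : Fin 2 → ℤ)
    (hindep : LinearIndependent ℝ
      ![(fun i => (v i : ℝ)), (M.map (Int.cast : ℤ → ℝ)).mulVec fun i => (v i : ℝ)])
    (T : Set (Fin 2 → ℝ)) (hTne : T.Nonempty) (hTcp : IsCompact T)
    (hT : (M.map (Int.cast : ℤ → ℝ)).mulVec '' T =
      ⋃ j ∈ Set.Icc (0 : ℤ) (B - 1),
        (fun x => x + (j : ℝ) • fun i => (v i : ℝ)) '' T)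
    (hdl : 2 * |A| ≤ B + 2) :
    Nonempty (↥T ≃ₜ ↥(Metric.closedBall (0 : EuclideanSpace ℝ (Fin 2)) 1)) := by
  obtain ⟨f, hfv, hf⟩ := exists_equiv_mulVec_eq hchar hindep
  obtain ⟨e⟩ := (isCollinearTile_preimage hTne hTcp hT f hfv hf).nonempty_homeomorph_closedBall
    (by rwa [abs_neg]) hB (by rwa [abs_neg])
  have h : T = f.symm ⁻¹' (f ⁻¹' T) := by
    ext x
    simp
  exact ⟨(f.symm.toHomeomorph.sets h).trans e⟩
end

section
/- Let A, B ∈ ℤ with 0 < A ≤ B, B ≥ 2, 2A − B = 3 and A ≠ B, let M = [[0, −B], [1, −A]] acting on ℝ², and let T be the tile for M and digits {0, …, B−1}·e₁. For digits a₁, a₂, a₃, a₄, a₁', a₂', a₃', a₄' ∈ {0, …, B−1} with a₁ − a₁' = 1 and a₂ − a₂' = A, the subdivision pieces T_{a₁a₂a₃a₄} and T_{a₁'a₂'a₃'a₄'} have nonempty intersection if and only if a₃ = B−1, a₃' = 0 and a₄ − a₄' ∈ {−A, −A+1, −A+2}. -/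
noncomputable section

/-- The matrix `[[0, -B], [1, -A]]` as a real matrix. -/
def M' (A B : ℤ) : Matrix (Fin 2) (Fin 2) ℝ := !![0, -(B : ℝ); 1, -(A : ℝ)]

/-- `e₁ = (1, 0) ∈ ℝ²`. -/
def e1 : Fin 2 → ℝ := ![1, 0]

/-- The subdivision piece `T_{a₁…a_m} = M⁻¹(a₁e₁) + ⋯ + M^{-m}(a_m e₁) + M^{-m}·T`. -/
def subPiece (A B : ℤ) (T : Set (Fin 2 → ℝ)) {m : ℕ} (a : Fin m → ℤ) :
    Set (Fin 2 → ℝ) :=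
  (fun x => (∑ i : Fin m, ((M' A B)⁻¹ ^ ((i : ℕ) + 1)).mulVec ((a i : ℝ) • e1))
    + ((M' A B)⁻¹ ^ m).mulVec x) '' T

/-- The self-affinity of the tile: `M T` is the union of its translates by the digits. -/
def IsTile (A B : ℤ) (T : Set (Fin 2 → ℝ)) : Prop :=
  (M' A B).mulVec '' T = ⋃ j ∈ Set.Icc (0 : ℤ) (B - 1), (fun x => x + (j : ℝ) • e1) '' T

lemma M'_mulVec (A B : ℤ) (z : Fin 2 → ℝ) :
    (M' A B).mulVec z = ![-(B : ℝ) * z 1, z 0 - A * z 1] := by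
  ext i
  fin_cases i <;> simp [M', Matrix.mulVec, dotProduct, Fin.sum_univ_two, sub_eq_add_neg]

lemma isUnit_det_M' {A B : ℤ} (hB : 2 ≤ B) : IsUnit (M' A B).det := by
  have : (B : ℝ) ≠ 0 := by exact_mod_cast (by omega : B ≠ 0)
  simpa [M', Matrix.det_fin_two] using this

open scoped Pointwise in
lemma IsTile.exists_mulVec_sub_mem {A B : ℤ} {T : Set (Fin 2 → ℝ)} (hT : IsTile A B T)
    {z : Fin 2 → ℝ} (hz : z ∈ T - T) :
    ∃ d : ℤ, |d| ≤ B - 1 ∧ (M' A B).mulVec z - (d : ℝ) • e1 ∈ T - T := by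
  obtain ⟨x, hx, y, hy, rfl⟩ := hz
  have key : ∀ x ∈ T, ∃ j : ℤ, (0 ≤ j ∧ j ≤ B - 1) ∧
      ∃ y ∈ T, y + (j : ℝ) • e1 = (M' A B).mulVec x := fun x hx => by
    have h : (M' A B).mulVec x ∈ (M' A B).mulVec '' T := ⟨x, hx, rfl⟩
    rw [hT] at h
    simp only [Set.mem_iUnion] at h
    obtain ⟨j, hj, hy⟩ := h
    exact ⟨j, hj, hy⟩
  obtain ⟨j, hj, x', hx', hxe⟩ := key x hx
  obtain ⟨k, hk, y', hy', hye⟩ := key y hy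
  refine ⟨j - k, by rw [abs_le]; constructor <;> omega, x', hx', y', hy', ?_⟩
  simp only [Matrix.mulVec_sub, ← hxe, ← hye]
  push_cast
  module

open scoped Pointwise in
lemma IsTile.mem_sub_of_mulVec_eq {A B : ℤ} (hB : 2 ≤ B) {T : Set (Fin 2 → ℝ)}
    (hT : IsTile A B T) {z w : Fin 2 → ℝ} (hw : w ∈ T - T) {d : ℤ} (hd : |d| ≤ B - 1)
    (h : (M' A B).mulVec z = w + (d : ℝ) • e1) : z ∈ T - T := by
  obtain ⟨x, hx, y, hy, rfl⟩ := hw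
  have key : ∀ x ∈ T, ∀ j : ℤ, 0 ≤ j → j ≤ B - 1 →
      ∃ y ∈ T, (M' A B).mulVec y = x + (j : ℝ) • e1 := fun x hx j h0 h1 => by
    have h : x + (j : ℝ) • e1 ∈
        ⋃ j ∈ Set.Icc (0 : ℤ) (B - 1), (fun x => x + (j : ℝ) • e1) '' T := by
      simp only [Set.mem_iUnion]
      exact ⟨j, ⟨h0, h1⟩, x, hx, rfl⟩
    rw [← hT] at h
    exact h
  rw [abs_le] at hd
  obtain ⟨x', hx', hxe⟩ := key x hx (max d 0) (by omega) (by omega)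
  obtain ⟨y', hy', hye⟩ := key y hy (max d 0 - d) (by omega) (by omega)
  refine ⟨x', hx', y', hy', ?_⟩
  have hinj := Matrix.mulVec_injective_of_isUnit
    ((Matrix.isUnit_iff_isUnit_det _).2 (isUnit_det_M' (A := A) hB))
  apply hinj
  simp only [h, Matrix.mulVec_sub, hxe, hye]
  push_cast
  module

open scoped Pointwise in
lemma neg_mem_sub_self {T : Set (Fin 2 → ℝ)} {z : Fin 2 → ℝ} (hz : z ∈ T - T) :
    -z ∈ T - T := by
  rwa [← Set.mem_neg, neg_sub]

open scoped Pointwise in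
lemma isCompact_sub_self {T : Set (Fin 2 → ℝ)} (hT : IsCompact T) : IsCompact (T - T) := by
  rw [sub_eq_add_neg]
  exact hT.add hT.neg

/-- A quadratic form that is expanded by `M' A B` when `2 * A - B = 3` and `4 ≤ A`. -/
def expandedForm (A : ℤ) (z : Fin 2 → ℝ) : ℝ := z 1 ^ 2 + ((A - 2) * z 1 - z 0) ^ 2

lemma expandedForm_lt {A B : ℤ} (h3 : 2 * A - B = 3) (hA : 4 ≤ A) {z : Fin 2 → ℝ}
    (hz : z ≠ 0) : expandedForm A z < expandedForm A ((M' A B).mulVec z) := by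
  have hA' : (4 : ℝ) ≤ A := by exact_mod_cast hA
  have hB' : (B : ℝ) = 2 * A - 3 := by
    have : B = 2 * A - 3 := by omega
    rw [this]; push_cast; ring
  obtain ⟨v, hv⟩ : ∃ v, v = (A - 2) * z 1 - z 0 := ⟨_, rfl⟩
  have h0 : z 0 = (A - 2) * z 1 - v := by rw [hv]; ring
  have hform : expandedForm A ((M' A B).mulVec z) - expandedForm A z =
      (z 1 - (A - 4) * v) ^ 2 + 3 * z 1 ^ 2 + 4 * (A - 3) * v ^ 2 := by
    rw [M'_mulVec]
    simp only [expandedForm, Matrix.cons_val_zero, Matrix.cons_val_one, h0, hB']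
    ring
  have hpos : 0 < 3 * z 1 ^ 2 + 4 * (A - 3) * v ^ 2 := by
    by_cases h1 : z 1 = 0
    · have hv0 : v ≠ 0 := by
        rintro rfl
        apply hz
        ext i
        fin_cases i <;> simp [h0, h1]
      have : 0 < v ^ 2 := by positivity
      nlinarith [sq_nonneg (z 1)]
    · have : 0 < z 1 ^ 2 := by positivity
      nlinarith [sq_nonneg v]
  nlinarith [sq_nonneg (z 1 - (A - 4) * v)]

open scoped Pointwise in
lemma IsTile.mem_sub_of_mulVec_eq_neg {A B : ℤ} (hB : 2 ≤ B) (h3 : 2 * A - B = 3) (hA : 4 ≤ A)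
    {T : Set (Fin 2 → ℝ)} (hTne : T.Nonempty) (hTcp : IsCompact T) (hT : IsTile A B T)
    {s : Fin 2 → ℝ} {d : ℤ} (hd : |d| ≤ B - 1)
    (h : (M' A B).mulVec s = -s + (d : ℝ) • e1) : s ∈ T - T := by
  have hcont : Continuous fun t : Fin 2 → ℝ => expandedForm A (t - s) := by
    unfold expandedForm
    fun_prop
  obtain ⟨t, ht, hmin⟩ := (isCompact_sub_self hTcp).exists_isMinOn (hTne.sub hTne) hcont.continuousOn
  by_contra hs
  obtain ⟨t', ht'⟩ : ∃ t', (M' A B).mulVec t' = -t + (d : ℝ) • e1 :=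
    ⟨(M' A B)⁻¹.mulVec (-t + (d : ℝ) • e1), by
      rw [Matrix.mulVec_mulVec, Matrix.mul_nonsing_inv _ (isUnit_det_M' hB), Matrix.one_mulVec]⟩
  have htm : t' ∈ T - T := hT.mem_sub_of_mulVec_eq hB (neg_mem_sub_self ht) hd ht'
  have hne : t' - s ≠ 0 := fun h0 => hs (sub_eq_zero.1 h0 ▸ htm)
  have hlt := expandedForm_lt h3 hA hne
  have hM : (M' A B).mulVec (t' - s) = -(t - s) := by
    rw [Matrix.mulVec_sub, ht', h]
    module
  have heven : expandedForm A (-(t - s)) = expandedForm A (t - s) := by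
    simp only [expandedForm, Pi.neg_apply]
    ring
  rw [hM, heven] at hlt
  exact absurd (hmin htm) (not_le.2 hlt)

open scoped Pointwise in
lemma IsTile.exists_lattice_step {A B : ℤ} {T : Set (Fin 2 → ℝ)} (hT : IsTile A B T)
    {p q : ℤ} (hz : ![(p : ℝ), (q : ℝ)] ∈ T - T) :
    ∃ d : ℤ, (-(B - 1) ≤ d ∧ d ≤ B - 1) ∧
      ![((-B * q - d : ℤ) : ℝ), ((p - A * q : ℤ) : ℝ)] ∈ T - T := by
  obtain ⟨d, hd, h⟩ := hT.exists_mulVec_sub_mem hz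
  refine ⟨d, abs_le.1 hd, ?_⟩
  convert h using 1
  rw [M'_mulVec]
  ext i
  fin_cases i <;> simp [e1]

open scoped Pointwise in
lemma IsTile.lattice_mem_of_step {A B : ℤ} (hB : 2 ≤ B) {T : Set (Fin 2 → ℝ)}
    (hT : IsTile A B T) {p q r s : ℤ} (hw : ![(r : ℝ), (s : ℝ)] ∈ T - T)
    (hd : |-B * q - r| ≤ B - 1) (hs : s = p - A * q) :
    ![(p : ℝ), (q : ℝ)] ∈ T - T := by
  refine hT.mem_sub_of_mulVec_eq hB hw hd ?_
  rw [M'_mulVec, hs]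
  ext i
  fin_cases i <;> simp [e1]

open scoped Pointwise in
/-- The second coordinates of lattice points of `T - T` are at most `2` in absolute value. -/
lemma IsTile.abs_lattice_snd_le {A B : ℤ} (h3 : 2 * A - B = 3) (hA : 4 ≤ A)
    {T : Set (Fin 2 → ℝ)} (hTcp : IsCompact T) (hT : IsTile A B T)
    {p q : ℤ} (hz : ![(p : ℝ), (q : ℝ)] ∈ T - T) : |q| ≤ 2 := by
  have hdescent : ∀ C : ℕ,
      (∀ p q : ℤ, ![(p : ℝ), (q : ℝ)] ∈ T - T → |q| ≤ 2 + C) →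
      ∀ p q : ℤ, ![(p : ℝ), (q : ℝ)] ∈ T - T → |q| ≤ 2 := by
    intro C
    induction C with
    | zero => intro h; simpa using h
    | succ C ih =>
      intro hC
      apply ih
      intro p₀ q₀ hz₀
      obtain ⟨d₀, hd₀, hz₁⟩ := hT.exists_lattice_step hz₀
      obtain ⟨d₁, hd₁, hz₂⟩ := hT.exists_lattice_step hz₁
      obtain ⟨d₂, hd₂, hz₃⟩ := hT.exists_lattice_step hz₂
      obtain ⟨d₃, hd₃, hz₄⟩ := hT.exists_lattice_step hz₃
      have b₂ := abs_le.1 (hC _ _ hz₂)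
      have b₄ := abs_le.1 (hC _ _ hz₄)
      obtain rfl : B = 2 * A - 3 := by omega
      generalize hq₁ : p₀ - A * q₀ = q₁ at *
      generalize hq₂ : -(2 * A - 3) * q₀ - d₀ - A * q₁ = q₂ at *
      generalize hq₃ : -(2 * A - 3) * q₁ - d₁ - A * q₂ = q₃ at *
      generalize hq₄ : -(2 * A - 3) * q₂ - d₂ - A * q₃ = q₄ at *
      have key : (2 * A - 3) ^ 2 * q₀ = (A ^ 2 - 4 * A + 6) * q₂ - q₄
          - (2 * A - 3) * d₀ + A * d₁ - d₂ := by
        linear_combination -(2 * A - 3) * hq₂ + A * hq₃ - hq₄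
      push_cast at b₂ b₄
      have hc : 0 ≤ A ^ 2 - 4 * A + 6 := by nlinarith
      have hCn : (0 : ℤ) ≤ C := by positivity
      have u₁ := mul_le_mul_of_nonneg_left b₂.1 hc
      have u₂ := mul_le_mul_of_nonneg_left b₂.2 hc
      have v₁ := mul_le_mul_of_nonneg_left hd₀.1 (by omega : 0 ≤ 2 * A - 3)
      have v₂ := mul_le_mul_of_nonneg_left hd₀.2 (by omega : 0 ≤ 2 * A - 3)
      have w₁ := mul_le_mul_of_nonneg_left hd₁.1 (by omega : 0 ≤ A)
      have w₂ := mul_le_mul_of_nonneg_left hd₁.2 (by omega : 0 ≤ A)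
      have hpos : 18 ≤ 3 * A ^ 2 - 8 * A + 2 := by nlinarith
      have hCp := mul_le_mul_of_nonneg_right hpos hCn
      have hsq : 0 < (2 * A - 3) ^ 2 := by nlinarith
      have hlt : |q₀| < 3 + C := by
        rw [abs_lt]
        constructor
        · refine lt_of_mul_lt_mul_left ?_ hsq.le
          linarith
        · refine lt_of_mul_lt_mul_left ?_ hsq.le
          linarith
      omega
  obtain ⟨R, hR⟩ := (isCompact_sub_self hTcp).isBounded.exists_norm_le
  obtain ⟨C, hC⟩ := exists_nat_ge R
  refine hdescent C (fun p q hpq => ?_) p q hz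
  have h1 := (norm_le_pi_norm ![(p : ℝ), (q : ℝ)] 1).trans ((hR _ hpq).trans hC)
  simp only [Matrix.cons_val_one, Matrix.cons_val_zero, Real.norm_eq_abs] at h1
  have h2 : |q| ≤ (C : ℤ) := by exact_mod_cast h1
  omega

open scoped Pointwise in
/-- The lattice points of `T - T` with negative second coordinate. -/
lemma IsTile.lattice_mem_iff {A B : ℤ} (hB : 2 ≤ B) (h3 : 2 * A - B = 3) (hA : 4 ≤ A)
    {T : Set (Fin 2 → ℝ)} (hTne : T.Nonempty) (hTcp : IsCompact T) (hT : IsTile A B T)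
    {p q : ℤ} (hp : |p| ≤ B - 1) (hq : q < 0) :
    ![(p : ℝ), (q : ℝ)] ∈ T - T ↔
      q = -1 ∧ (p = -A ∨ p = -A + 1 ∨ p = -A + 2) := by
  rw [abs_le] at hp
  constructor
  · intro hz
    obtain ⟨d₀, hd₀, hz₁⟩ := hT.exists_lattice_step hz
    obtain ⟨d₁, hd₁, hz₂⟩ := hT.exists_lattice_step hz₁
    have b₀ := abs_le.1 (hT.abs_lattice_snd_le h3 hA hTcp hz)
    have b₁ := abs_le.1 (hT.abs_lattice_snd_le h3 hA hTcp hz₁)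
    have b₂ := abs_le.1 (hT.abs_lattice_snd_le h3 hA hTcp hz₂)
    generalize hq₁ : p - A * q = q₁ at *
    obtain rfl | rfl : q = -1 ∨ q = -2 := by omega
    · obtain rfl | rfl | rfl | rfl | rfl : q₁ = -2 ∨ q₁ = -1 ∨ q₁ = 0 ∨ q₁ = 1 ∨ q₁ = 2 := by
        omega
      all_goals omega
    · obtain rfl | rfl | rfl | rfl | rfl : q₁ = -2 ∨ q₁ = -1 ∨ q₁ = 0 ∨ q₁ = 1 ∨ q₁ = 2 := by
        omega
      all_goals omega
  · have hfix : ∀ m : ℤ, 0 ≤ m → m ≤ 2 →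
        ![((m * (A - 1) : ℤ) : ℝ), (m : ℝ)] ∈ T - T := fun m h0 h2 => by
      refine hT.mem_sub_of_mulVec_eq_neg hB h3 hA hTne hTcp (d := m * (A - 1 - B)) ?_ ?_
      · rw [abs_le]
        constructor <;> nlinarith
      · rw [M'_mulVec]
        ext i
        fin_cases i <;> simp [e1] <;> ring
    have hneg : ∀ {p q : ℤ}, ![(p : ℝ), (q : ℝ)] ∈ T - T →
        ![((-p : ℤ) : ℝ), ((-q : ℤ) : ℝ)] ∈ T - T := fun h => by
      simpa using neg_mem_sub_self h
    have h₁ := hfix 1 (by norm_num) (by norm_num)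
    have h₂ := hfix 2 (by norm_num) (by norm_num)
    have hone : ![((1 : ℤ) : ℝ), ((0 : ℤ) : ℝ)] ∈ T - T :=
      hT.lattice_mem_of_step hB h₁ (by rw [abs_le]; constructor <;> omega) (by ring)
    rintro ⟨rfl, rfl | rfl | rfl⟩
    · exact hT.lattice_mem_of_step hB hone (by rw [abs_le]; constructor <;> omega) (by ring)
    · simpa [neg_add_eq_sub] using hneg h₁
    · exact hT.lattice_mem_of_step hB h₂ (by rw [abs_le]; constructor <;> omega) (by ring)

lemma subPiece_four_eq {A B : ℤ} (hB : 2 ≤ B) (T : Set (Fin 2 → ℝ)) (a₁ a₂ a₃ a₄ : ℤ) :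
    subPiece A B T ![a₁, a₂, a₃, a₄] =
      (fun x => ((M' A B)⁻¹ ^ 4).mulVec
        (![(a₄ : ℝ) - B * a₂ + A * B * a₁, a₃ - A * a₂ + (A ^ 2 - B) * a₁] + x)) '' T := by
  unfold subPiece
  congr 1
  funext x
  have hinv : (M' A B)⁻¹ * M' A B = 1 := Matrix.nonsing_inv_mul _ (isUnit_det_M' hB)
  have hshift : ∀ (k : ℕ) (v : Fin 2 → ℝ), ((M' A B)⁻¹ ^ k).mulVec v =
      ((M' A B)⁻¹ ^ (k + 1)).mulVec ((M' A B).mulVec v) := fun k v => by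
    rw [Matrix.mulVec_mulVec, pow_succ, mul_assoc, hinv, mul_one]
  simp only [Fin.sum_univ_four]
  simp only [Fin.isValue, Fin.val_zero, Fin.val_one, Fin.val_two, Matrix.cons_val,
    show ((3 : Fin 4) : ℕ) = 3 from rfl, zero_add, Nat.reduceAdd]
  rw [hshift 1, hshift 2, hshift 2, hshift 3, hshift 3, hshift 3]
  simp only [Nat.reduceAdd, ← Matrix.mulVec_add]
  congr 1
  simp only [M'_mulVec]
  ext i
  fin_cases i <;> simp [e1] <;> ring

open scoped Pointwise in
lemma subPiece_four_inter_nonempty_iff {A B : ℤ} (hB : 2 ≤ B) (T : Set (Fin 2 → ℝ))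
    {a₁ a₂ a₃ a₄ a₁' a₂' a₃' a₄' : ℤ} (hd1 : a₁ - a₁' = 1) (hd2 : a₂ - a₂' = A) :
    (subPiece A B T ![a₁, a₂, a₃, a₄] ∩ subPiece A B T ![a₁', a₂', a₃', a₄']).Nonempty ↔
      ![((a₄ - a₄' : ℤ) : ℝ), ((a₃ - a₃' - B : ℤ) : ℝ)] ∈ T - T := by
  obtain rfl : a₁ = a₁' + 1 := by omega
  obtain rfl : a₂ = a₂' + A := by omega
  rw [subPiece_four_eq hB, subPiece_four_eq hB]
  have hinj : Function.Injective ((M' A B)⁻¹ ^ 4).mulVec :=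
    Matrix.mulVec_injective_of_isUnit (IsUnit.pow 4 (Matrix.isUnit_nonsing_inv_iff.2
      ((Matrix.isUnit_iff_isUnit_det _).2 (isUnit_det_M' hB))))
  constructor
  · rintro ⟨_, ⟨x, hx, rfl⟩, x', hx', h⟩
    refine ⟨x', hx', x, hx, ?_⟩
    have h := hinj h
    have h0 := congrFun h 0
    have h1 := congrFun h 1
    simp at h0 h1
    ext i
    fin_cases i <;> simp <;> linarith
  · rintro ⟨x', hx', x, hx, h⟩
    refine ⟨_, ⟨x, hx, rfl⟩, x', hx', ?_⟩
    have h0 := congrFun h 0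
    have h1 := congrFun h 1
    simp at h0 h1
    dsimp only
    congr 1
    ext i
    fin_cases i <;> simp <;> linarith

/-- For `0 < A ≤ B`, `B ≥ 2`, `2A - B = 3`, `A ≠ B`, and digits
with `a₁ - a₁' = 1` and `a₂ - a₂' = A`, the pieces `T_{a₁a₂a₃a₄}` and
`T_{a₁'a₂'a₃'a₄'}` intersect iff `a₃ = B-1`, `a₃' = 0` and
`a₄ - a₄' ∈ {-A, -A+1, -A+2}`. -/
theorem subPiece_four_inter_A
    (A B : ℤ) (hA : 0 < A) (hAB : A ≤ B) (hB : 2 ≤ B)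
    (h3 : 2 * A - B = 3) (hABne : A ≠ B)
    (T : Set (Fin 2 → ℝ)) (hTne : T.Nonempty) (hTcp : IsCompact T)
    (hT : (M' A B).mulVec '' T =
      ⋃ j ∈ Set.Icc (0 : ℤ) (B - 1), (fun x => x + (j : ℝ) • e1) '' T)
    (a₁ a₂ a₃ a₄ a₁' a₂' a₃' a₄' : ℤ)
    (ha₁ : a₁ ∈ Set.Icc (0 : ℤ) (B - 1)) (ha₂ : a₂ ∈ Set.Icc (0 : ℤ) (B - 1))
    (ha₃ : a₃ ∈ Set.Icc (0 : ℤ) (B - 1)) (ha₄ : a₄ ∈ Set.Icc (0 : ℤ) (B - 1))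
    (ha₁' : a₁' ∈ Set.Icc (0 : ℤ) (B - 1)) (ha₂' : a₂' ∈ Set.Icc (0 : ℤ) (B - 1))
    (ha₃' : a₃' ∈ Set.Icc (0 : ℤ) (B - 1)) (ha₄' : a₄' ∈ Set.Icc (0 : ℤ) (B - 1))
    (hd1 : a₁ - a₁' = 1) (hd2 : a₂ - a₂' = A) :
    (subPiece A B T ![a₁, a₂, a₃, a₄] ∩ subPiece A B T ![a₁', a₂', a₃', a₄']).Nonempty ↔
      (a₃ = B - 1 ∧ a₃' = 0 ∧
        (a₄ - a₄' = -A ∨ a₄ - a₄' = -A + 1 ∨ a₄ - a₄' = -A + 2)) := by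

  simp only [Set.mem_Icc] at *
  rw [subPiece_four_inter_nonempty_iff hB T hd1 hd2,
    IsTile.lattice_mem_iff hB h3 (by omega) hTne hTcp hT (by rw [abs_le]; constructor <;> omega)
      (by omega)]
  omega
end
end
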